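/- Extension to a time one map of a flow: let ℱ be a finite family of pairwise disjoint topological lines in ℝ² and let F be the union of the elements of ℱ. Let h′ : F → F be a homeomorphism (of F with the subspace topology) without fixed points such that h′(L) = L for every L ∈ ℱ. Then there exists a flow φ : ℝ × ℝ² → ℝ² such that the time one map φ(1,·) has no fixed point and φ(1,x) = h′(x) for every x ∈ F. -/

import Mathlib

open Set

/-- The plane. -/
abbrev Plane : Type := ℝ × ℝ

/-- `f` is (the underlying function of) a homeomorphism of the plane. -/
def IsHomeoFun (f : Plane → Plane) : Prop :=
  ∃ e : Plane ≃ₜ Plane, ∀ x, e x = f x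

/-- `g` and `g'` are isotopic relative to `O` : there is a continuous family
`F (t, ·)`, `t ∈ [0,1]`, of homeomorphisms of the plane going from `g` to `g'`
and agreeing with `g` on `O` for all times. -/
def IsotopicRel (g g' : Plane → Plane) (O : Set Plane) : Prop :=
  ∃ F : ℝ × Plane → Plane, Continuous F ∧
    (∀ t ∈ Icc (0:ℝ) 1, IsHomeoFun fun x => F (t, x)) ∧
    (∀ x, F (0, x) = g x) ∧
    (∀ x, F (1, x) = g' x) ∧
    (∀ t ∈ Icc (0:ℝ) 1, ∀ x ∈ O, F (t, x) = g x)

/-- A homeomorphism of the plane is orientation preserving iff it is isotopic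
to the identity. -/
def OrientationPreserving (h : Plane ≃ₜ Plane) : Prop :=
  IsotopicRel id (⇑h) (∅ : Set Plane)

/-- A Brouwer homeomorphism: orientation preserving and fixed point free. -/
def IsBrouwer (h : Plane ≃ₜ Plane) : Prop :=
  OrientationPreserving h ∧ ∀ x, h x ≠ x

/-- The orbit of a point under a homeomorphism. -/
def horbit (h : Plane ≃ₜ Plane) (x : Plane) : Set Plane :=
  {y | ∃ n : ℤ, y = (h.toEquiv ^ n) x}

/-- `ℤ₁ = ℤ × {1}`. -/
def Z1 : Set Plane := {p | ∃ n : ℤ, p = ((n : ℝ), 1)}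

/-- `ℤ₂ = ℤ × {2}`. -/
def Z2 : Set Plane := {p | ∃ n : ℤ, p = ((n : ℝ), 2)}

/-- The shear homeomorphism `(x, y) ↦ (x + f y, y)`. -/
def shear (f : ℝ → ℝ) (hf : Continuous f) : Plane ≃ₜ Plane where
  toFun p := (p.1 + f p.2, p.2)
  invFun p := (p.1 - f p.2, p.2)
  left_inv p := by simp
  right_inv p := by simp
  continuous_toFun := (continuous_fst.add (hf.comp continuous_snd)).prodMk continuous_snd
  continuous_invFun := (continuous_fst.sub (hf.comp continuous_snd)).prodMk continuous_snd

/-- The translation `T (x, y) = (x + 1, y)`. -/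
def T : Plane ≃ₜ Plane := shear (fun _ => 1) continuous_const

/-- The twist `T₁ (x, y) = (x + 2 - y, y)`. -/
def T₁ : Plane ≃ₜ Plane := shear (fun y => 2 - y) (by continuity)

/-- The twist `T₂ (x, y) = (x + y - 1, y)`. -/
def T₂ : Plane ≃ₜ Plane := shear (fun y => y - 1) (by continuity)

/-- The model Reeb homeomorphism `R₀ = T₁ ∘ T₂⁻¹`, `R₀ (x, y) = (x + 3 - 2y, y)`. -/
def R₀ : Plane ≃ₜ Plane := shear (fun y => 3 - 2 * y) (by continuity)

/-- The Euclidean norm on the plane. -/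
noncomputable def planeNorm (p : Plane) : ℝ := Real.sqrt (p.1 ^ 2 + p.2 ^ 2)

/-- An angle function for a fixed point free map `h'` along a curve `γ`. -/
def IsAngleFunction (h' : Plane → Plane) (γ : ℝ → Plane) (θ : ℝ → ℝ) : Prop :=
  ContinuousOn θ (Icc 0 1) ∧
    ∀ t ∈ Icc (0:ℝ) 1,
      h' (γ t) - γ t =
        planeNorm (h' (γ t) - γ t) • (Real.cos (θ t), Real.sin (θ t))

/-- The conjugate `Φ ∘ h ∘ Φ⁻¹`. -/
def conjH (Φ h : Plane ≃ₜ Plane) : Plane ≃ₜ Plane := Φ.symm.trans (h.trans Φ)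

/-- An admissible straightening `Φ` for `(h, O₁, O₂)` : an orientation preserving
homeomorphism sending `O₁, O₂` to `ℤ₁, ℤ₂` such that `Φ ∘ h ∘ Φ⁻¹` is isotopic
relative to `ℤ₁ ∪ ℤ₂` to a homeomorphism translating each line `ℝ × {i}` by `±1`. -/
def AdmissibleStraightening (h : Plane ≃ₜ Plane) (O₁ O₂ : Set Plane)
    (Φ : Plane ≃ₜ Plane) : Prop :=
  OrientationPreserving Φ ∧ Φ '' O₁ = Z1 ∧ Φ '' O₂ = Z2 ∧
    ∃ ε₁ ε₂ : ℝ, (ε₁ = 1 ∨ ε₁ = -1) ∧ (ε₂ = 1 ∨ ε₂ = -1) ∧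
      ∃ g : Plane ≃ₜ Plane,
        (∀ x : ℝ, g (x, 1) = (x + ε₁, 1)) ∧
        (∀ x : ℝ, g (x, 2) = (x + ε₂, 2)) ∧
        IsotopicRel (⇑(conjH Φ h)) (⇑g) (Z1 ∪ Z2)

/-- A flow on the plane. -/
def IsFlow (φ : ℝ → Plane → Plane) : Prop :=
  Continuous (fun p : ℝ × Plane => φ p.1 p.2) ∧
    (∀ x, φ 0 x = x) ∧ ∀ s t x, φ (s + t) x = φ s (φ t x)

/-- A topological line in the plane: the image of a proper injective continuous
map from `ℝ` to the plane. -/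
def IsTopLine (L : Set Plane) : Prop :=
  ∃ f : ℝ → Plane, Continuous f ∧ Function.Injective f ∧ IsProperMap f ∧ range f = L

namespace PlaneFlow

open Filter Topology Complex Bornology

/-! ### Logarithms of quotients on closed sets and separation in the plane -/

theorem eqOn_const_of_exp_eq_one {X : Type*} [TopologicalSpace X] {S : Set X}
    (hS : IsPreconnected S) {u : X → ℂ} (hu : ContinuousOn u S)
    (h1 : ∀ x ∈ S, exp (u x) = 1) {x y : X} (hx : x ∈ S) (hy : y ∈ S) : u x = u y := by
  have hc : (u '' S).Countable := by
    refine (Set.countable_range (fun n : ℤ => (n : ℂ) * (2 * Real.pi * I))).mono ?_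
    rintro _ ⟨x, hx, rfl⟩
    obtain ⟨n, hn⟩ := Complex.exp_eq_one_iff.1 (h1 x hx)
    exact ⟨n, hn.symm⟩
  exact hc.isTotallyDisconnected _ le_rfl (hS.image u hu) (mem_image_of_mem _ hx)
    (mem_image_of_mem _ hy)

/-- The function `z ↦ (z - p) / (z - q)` has a continuous logarithm on `A`, vanishing at
infinity. -/
def LogRatio (A : Set ℂ) (p q : ℂ) : Prop :=
  ∃ g : ℂ → ℂ, ContinuousOn g A ∧ (∀ z ∈ A, exp (g z) = (z - p) / (z - q)) ∧
    Tendsto g (cobounded ℂ ⊓ 𝓟 A) (𝓝 0)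

theorem LogRatio.symm {A : Set ℂ} {p q : ℂ} (h : LogRatio A p q) : LogRatio A q p := by
  obtain ⟨g, hg, he, h0⟩ := h
  refine ⟨fun z => -g z, hg.neg, fun z hz => ?_, by simpa using h0.neg⟩
  rw [exp_neg, he z hz, inv_div]

theorem LogRatio.trans {A : Set ℂ} {p q r : ℂ} (hq : q ∉ A)
    (h : LogRatio A p q) (h' : LogRatio A q r) : LogRatio A p r := by
  obtain ⟨g, hg, he, h0⟩ := h
  obtain ⟨g', hg', he', h0'⟩ := h'
  refine ⟨fun z => g z + g' z, hg.add hg', fun z hz => ?_, by simpa using h0.add h0'⟩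
  have : z - q ≠ 0 := fun h => hq (by rwa [← sub_eq_zero.1 h])
  rw [exp_add, he z hz, he' z hz]
  field_simp

theorem tendsto_ratio_cobounded (p q : ℂ) :
    Tendsto (fun z : ℂ => (z - p) / (z - q)) (cobounded ℂ) (𝓝 1) := by
  have h1 : Tendsto (fun z : ℂ => 1 + (q - p) * (z - q)⁻¹) (cobounded ℂ)
      (𝓝 (1 + (q - p) * 0)) := by
    refine tendsto_const_nhds.add (tendsto_const_nhds.mul ?_)
    refine tendsto_inv₀_cobounded.comp ?_
    simp [sub_eq_add_neg]
  rw [mul_zero, add_zero] at h1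
  refine h1.congr' ?_
  have : ∀ᶠ z in cobounded ℂ, z ≠ q := by
    have : IsBounded ({q} : Set ℂ) := isBounded_singleton
    filter_upwards [isBounded_def.1 this] with z hz
    simpa using hz
  filter_upwards [this] with z hz
  have : z - q ≠ 0 := sub_ne_zero.2 hz
  field_simp
  ring

theorem logRatio_of_dist_lt {A : Set ℂ} {p q : ℂ} (h : ∀ z ∈ A, ‖p - q‖ < ‖z - q‖) :
    LogRatio A p q := by
  have key : ∀ z ∈ A, (z - p) / (z - q) ∈ Metric.ball (1 : ℂ) 1 := fun z hz => by
    have h0 : 0 < ‖z - q‖ := (norm_nonneg _).trans_lt (h z hz)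
    have h1 : z - q ≠ 0 := norm_pos_iff.1 h0
    rw [mem_ball_iff_norm]
    have : (z - p) / (z - q) - 1 = -((p - q) / (z - q)) := by field_simp; ring
    rw [this, norm_neg, norm_div, div_lt_one h0]
    exact h z hz
  have key' : ∀ z ∈ A, (z - p) / (z - q) ∈ slitPlane := fun z hz => by
    have := key z hz
    exact ball_one_subset_slitPlane this
  have hne : ∀ z ∈ A, z - q ≠ 0 := fun z hz => norm_pos_iff.1 ((norm_nonneg _).trans_lt (h z hz))
  refine ⟨fun z => log ((z - p) / (z - q)), ?_, ?_, ?_⟩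
  · refine ContinuousOn.clog ?_ key'
    exact ContinuousOn.div (by fun_prop) (by fun_prop) hne
  · exact fun z hz => exp_log (slitPlane_ne_zero (key' z hz))
  · have := (continuousAt_clog one_mem_slitPlane).tendsto.comp (tendsto_ratio_cobounded p q)
    rw [log_one] at this
    exact this.mono_left inf_le_left

theorem logRatio_of_isPreconnected {A C : Set ℂ} (hA : IsClosed A) (hC : IsPreconnected C)
    (hCA : Disjoint C A) {p q : ℂ} (hp : p ∈ C) (hq : q ∈ C) : LogRatio A p q := by
  refine hC.induction₂ (LogRatio A) ?_ ?_ ?_ hp hq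
  · intro x hx
    have hxA : x ∈ Aᶜ := disjoint_left.1 hCA hx
    obtain ⟨ε, hε, hb⟩ := Metric.isOpen_iff.1 hA.isOpen_compl x hxA
    filter_upwards [mem_nhdsWithin_of_mem_nhds (Metric.ball_mem_nhds x hε)] with y hy
    refine (logRatio_of_dist_lt fun z hz => ?_).symm
    rw [← dist_eq_norm, ← dist_eq_norm]
    refine (Metric.mem_ball.1 hy).trans_le ?_
    by_contra! h
    exact hb (Metric.mem_ball.2 h) hz
  · intro x y z _ hy _ h h'
    exact h.trans (disjoint_left.1 hCA hy) h'
  · intro x y _ _ h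
    exact h.symm

theorem LogRatio.union {A B : Set ℂ} {p q : ℂ} (hA : IsClosed A) (hB : IsClosed B)
    (h : LogRatio A p q) (h' : LogRatio B p q)
    (hAB : ∀ z ∈ A ∩ B, ∃ C ⊆ A ∩ B, z ∈ C ∧ IsPreconnected C ∧ ¬ IsBounded C)
    (hq : q ∉ A ∩ B) (hp : p ∉ A ∩ B) :
    LogRatio (A ∪ B) p q := by
  classical
  obtain ⟨g, hg, he, h0⟩ := h
  obtain ⟨g', hg', he', h0'⟩ := h'
  have agree : ∀ z ∈ A ∩ B, g z = g' z := by
    intro z hz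
    obtain ⟨C, hCs, hzC, hC, hCb⟩ := hAB z hz
    have hu : ∀ w ∈ C, g w - g' w = g z - g' z := fun w hw =>
      eqOn_const_of_exp_eq_one hC (u := fun w => g w - g' w)
        ((hg.mono (hCs.trans inter_subset_left)).sub (hg'.mono (hCs.trans inter_subset_right)))
        (fun w hw => by
          have hwq : w - q ≠ 0 := fun h => hq (by rw [← sub_eq_zero.1 h]; exact hCs hw)
          have hwp : w - p ≠ 0 := fun h => hp (by rw [← sub_eq_zero.1 h]; exact hCs hw)
          rw [exp_sub, he w (hCs hw).1, he' w (hCs hw).2]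
          field_simp) hw hzC
    have hne : (cobounded ℂ ⊓ 𝓟 C).NeBot := by
      rw [inf_principal_neBot_iff]
      intro U hU
      by_contra hcon
      rw [not_nonempty_iff_eq_empty] at hcon
      refine hCb (IsBounded.subset (t := Uᶜ) ?_ ?_)
      · rwa [← isCobounded_compl_iff, compl_compl]
      · intro w hw hwU
        have : w ∈ U ∩ C := ⟨hwU, hw⟩
        simp [hcon] at this
    have l1 : Tendsto (fun w => g w - g' w) (cobounded ℂ ⊓ 𝓟 C) (𝓝 (0 - 0)) :=
      (h0.mono_left (inf_le_inf_left _ (principal_mono.2 (hCs.trans inter_subset_left)))).sub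
        (h0'.mono_left (inf_le_inf_left _ (principal_mono.2 (hCs.trans inter_subset_right))))
    have l2 : Tendsto (fun w => g w - g' w) (cobounded ℂ ⊓ 𝓟 C) (𝓝 (g z - g' z)) := by
      refine tendsto_const_nhds.congr' ?_
      filter_upwards [mem_inf_of_right (mem_principal_self C)] with w hw
      exact (hu w hw).symm
    have := tendsto_nhds_unique l1 l2
    rw [sub_zero] at this
    exact sub_eq_zero.1 this.symm
  set G : ℂ → ℂ := fun z => if z ∈ A then g z else g' z with hG
  have GA : EqOn G g A := fun z hz => by simp [hG, hz]
  have GB : EqOn G g' B := fun z hz => by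
    by_cases hzA : z ∈ A
    · simp [hG, hzA, agree z ⟨hzA, hz⟩]
    · simp [hG, hzA]
  refine ⟨G, ?_, ?_, ?_⟩
  · exact (hg.congr GA).union_of_isClosed (hg'.congr GB) hA hB
  · rintro z (hz | hz)
    · rw [GA hz, he z hz]
    · rw [GB hz, he' z hz]
  · rw [← sup_principal, inf_sup_left, tendsto_sup]
    constructor
    · refine h0.congr' ?_
      filter_upwards [mem_inf_of_right (mem_principal_self A)] with w hw using (GA hw).symm
    · refine h0'.congr' ?_
      filter_upwards [mem_inf_of_right (mem_principal_self B)] with w hw using (GB hw).symm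

theorem exists_log_of_simplyConnected {X : Type*} [TopologicalSpace X] [SimplyConnectedSpace X]
    [LocallyPathConnectedSpace X] {f : X → ℂ} (hf : Continuous f) (h0 : ∀ x, f x ≠ 0) :
    ∃ g : X → ℂ, Continuous g ∧ ∀ x, exp (g x) = f x := by
  obtain ⟨g, hg, he⟩ := exists_continuousOn_eqOn_exp_comp (X := X) (U := univ)
    ((Homeomorph.Set.univ X).toHomotopyEquiv.simplyConnectedSpace) isOpen_univ (g := f) hf.continuousOn
    (by rintro ⟨x, -, hx⟩; exact h0 x hx)
  exact ⟨g, continuousOn_univ.1 hg, fun x => he (mem_univ x)⟩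

theorem no_log_on_large_circle {q : ℂ} {R : ℝ} (hR : 0 < R) {k : ℂ → ℂ}
    (hk : ContinuousOn k (Metric.sphere q R)) (he : ∀ z ∈ Metric.sphere q R, exp (k z) = z - q) :
    False := by
  have hmem : ∀ θ : ℝ, q + R * exp (θ * I) ∈ Metric.sphere q R := fun θ => by
    simp [norm_exp_ofReal_mul_I, abs_of_pos hR]
  set u : ℝ → ℂ := fun θ => k (q + R * exp (θ * I)) - θ * I - Real.log R with hu
  have hcont : Continuous u := by
    have : Continuous fun θ : ℝ => k (q + R * exp (θ * I)) :=
      hk.comp_continuous (by fun_prop) hmem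
    exact (this.sub (by fun_prop)).sub continuous_const
  have h1 : ∀ θ ∈ (univ : Set ℝ), exp (u θ) = 1 := fun θ _ => by
    simp only [hu, exp_sub, he _ (hmem θ), ← ofReal_exp, Real.exp_log hR, add_sub_cancel_left]
    have : (R : ℂ) ≠ 0 := by exact_mod_cast hR.ne'
    field_simp
  have := eqOn_const_of_exp_eq_one isPreconnected_univ hcont.continuousOn h1
    (mem_univ 0) (mem_univ (2 * Real.pi))
  simp only [hu, ofReal_zero, zero_mul, exp_zero, ofReal_mul, ofReal_ofNat, exp_two_pi_mul_I,
    mul_one, sub_zero] at this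
  have h2 : (2 * Real.pi * I : ℂ) = 0 := by linear_combination this
  simp [Real.pi_ne_zero] at h2

/-- If `(z - p) / (z - q)` has a continuous logarithm on `A` then `A` does not separate `p`
and `q`. -/
theorem LogRatio.mem_connectedComponentIn {A : Set ℂ} {p q : ℂ} (hA : IsClosed A) (hp : p ∉ A)
    (hq : q ∉ A) (h : LogRatio A p q) : q ∈ connectedComponentIn Aᶜ p := by
  classical
  by_contra hqV
  obtain ⟨g, hg, he, h0⟩ := h
  set V := connectedComponentIn Aᶜ p with hV
  have hVo : IsOpen V := hA.isOpen_compl.connectedComponentIn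
  have hpV : p ∈ V := _root_.mem_connectedComponentIn hp
  have hVA : V ⊆ Aᶜ := connectedComponentIn_subset _ _
  have hfr : frontier V ⊆ A := by
    intro z hz
    by_contra hzA
    have hz' : z ∈ Aᶜ := hzA
    have hW : IsOpen (connectedComponentIn Aᶜ z) := hA.isOpen_compl.connectedComponentIn
    have hmz : z ∈ connectedComponentIn Aᶜ z := _root_.mem_connectedComponentIn hz'
    obtain ⟨w, hw1, hw2⟩ := mem_closure_iff.1 hz.1 _ hW hmz
    have e1 := connectedComponentIn_eq hw1
    have e2 := connectedComponentIn_eq hw2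
    rw [hVo.frontier_eq] at hz
    exact hz.2 (by rw [hV, e2, ← e1]; exact hmz)
  obtain ⟨G, hG⟩ := ContinuousMap.exists_restrict_eq hA ⟨A.domRestrict g, continuousOn_iff_continuous_domRestrict.1 hg⟩
  have hGg : ∀ z ∈ A, G z = g z := fun z hz => by
    have := DFunLike.congr_fun hG ⟨z, hz⟩
    simpa using this
  have hclq : q ∉ closure V := fun h => by
    rcases closure_eq_self_union_frontier V ▸ h with h | h
    · exact hqV h
    · exact hq (hfr h)
  set N : ℂ → ℂ := fun z => if z ∈ closure V then exp (G z) * (z - q) else z - p with hN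
  have hNc : Continuous N := by
    refine Continuous.if ?_ (by fun_prop) (by fun_prop)
    intro z hz
    have hz' : z ∈ A := hfr (frontier_closure_subset hz)
    have : z - q ≠ 0 := fun h => hq (by rwa [← sub_eq_zero.1 h])
    rw [hGg z hz', he z hz']
    field_simp
  have hN0 : ∀ z, N z ≠ 0 := fun z => by
    by_cases hz : z ∈ closure V
    · simp only [hN, hz, if_true]
      exact mul_ne_zero (exp_ne_zero _) (sub_ne_zero.2 fun h => hclq (h ▸ hz))
    · simp only [hN, hz, if_false]
      exact sub_ne_zero.2 fun h => hz (h ▸ subset_closure hpV)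
  obtain ⟨l, hl, hle⟩ := exists_log_of_simplyConnected hNc hN0
  have hsl : ∀ᶠ z in cobounded ℂ, (z - p) / (z - q) ∈ slitPlane :=
    (tendsto_ratio_cobounded p q).eventually (isOpen_slitPlane.mem_nhds one_mem_slitPlane)
  have hsm : ∀ᶠ z in cobounded ℂ, z ∈ A → G z = log ((z - p) / (z - q)) := by
    have l1 : Tendsto (fun z => g z - log ((z - p) / (z - q))) (cobounded ℂ ⊓ 𝓟 A)
        (𝓝 (0 - log 1)) :=
      h0.sub (((continuousAt_clog one_mem_slitPlane).tendsto.comp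
        (tendsto_ratio_cobounded p q)).mono_left inf_le_left)
    rw [log_one, sub_zero] at l1
    have l2 := l1.eventually (Metric.ball_mem_nhds (0 : ℂ) Real.pi_pos)
    rw [eventually_inf_principal] at l2
    filter_upwards [l2, hsl] with z hz hzs hzA
    have h3 := hz hzA
    rw [hGg z hzA]
    have h4 : exp (g z - log ((z - p) / (z - q))) = 1 := by
      rw [exp_sub, he z hzA, exp_log (slitPlane_ne_zero hzs), div_self (slitPlane_ne_zero hzs)]
    obtain ⟨n, hn⟩ := Complex.exp_eq_one_iff.1 h4
    rw [hn, dist_zero_right] at h3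
    simp only [norm_mul, norm_intCast, norm_ofNat, norm_real, norm_I, mul_one, Real.norm_eq_abs,
      abs_of_pos Real.pi_pos] at h3
    have hn0 : n = 0 := by
      by_contra hne
      have : (1 : ℝ) ≤ |(n : ℝ)| := by exact_mod_cast Int.one_le_abs hne
      nlinarith [Real.pi_pos]
    rw [hn0] at hn
    simpa [sub_eq_zero] using hn
  obtain ⟨R, hR⟩ : ∃ R : ℝ, ∀ z : ℂ, R ≤ ‖z - q‖ → (z - p) / (z - q) ∈ slitPlane ∧
      (z ∈ A → G z = log ((z - p) / (z - q))) := by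
    have := hsl.and hsm
    obtain ⟨R, -, hR⟩ := (Metric.hasBasis_cobounded_compl_closedBall q).eventually_iff.1 this
    refine ⟨R + 1, fun z hz => hR ?_⟩
    simp only [mem_compl_iff, Metric.mem_closedBall, dist_eq_norm]
    linarith
  set R' := max R 1
  have hR'0 : 0 < R' := lt_max_of_lt_right one_pos
  have hsph : ∀ z ∈ Metric.sphere q R', (z - p) / (z - q) ∈ slitPlane ∧
      (z ∈ A → G z = log ((z - p) / (z - q))) := fun z hz => hR z (by
    rw [mem_sphere_iff_norm.1 hz]; exact le_max_left _ _)
  have hsq : ∀ z ∈ Metric.sphere q R', z - q ≠ 0 := fun z hz => by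
    rw [← norm_pos_iff, mem_sphere_iff_norm.1 hz]; exact hR'0
  set m : ℂ → ℂ := fun z => if z ∈ closure V then G z else log ((z - p) / (z - q)) with hm
  have hmc : ContinuousOn m (Metric.sphere q R') := by
    refine ContinuousOn.if ?_ G.continuous.continuousOn ?_
    · rintro z ⟨hz, hz'⟩
      exact (hsph z hz).2 (hfr (frontier_closure_subset hz'))
    · refine ContinuousOn.mono ?_ inter_subset_left
      exact ContinuousOn.clog (ContinuousOn.div (by fun_prop) (by fun_prop) hsq)
        fun z hz => (hsph z hz).1
  refine no_log_on_large_circle hR'0 (k := fun z => l z - m z) (hl.continuousOn.sub hmc) ?_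
  intro z hz
  have hzq := hsq z hz
  rw [exp_sub, hle z]
  by_cases hzV : z ∈ closure V
  · simp only [hN, hm, hzV, if_true]
    field_simp [exp_ne_zero]
  · simp only [hN, hm, hzV, if_false]
    rw [exp_log (slitPlane_ne_zero (hsph z hz).1)]
    have : z - p ≠ 0 := fun h => by
      have := slitPlane_ne_zero (hsph z hz).1
      simp [h] at this
    field_simp

theorem continuousOn_invFun_range {X Y : Type*} [TopologicalSpace X] [TopologicalSpace Y]
    [Nonempty X] {γ : X → Y} (hγ : IsEmbedding γ) : ContinuousOn (Function.invFun γ) (range γ) := by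
  rw [continuousOn_iff_continuous_domRestrict]
  have : (range γ).domRestrict (Function.invFun γ) = hγ.toHomeomorph.symm := by
    ext ⟨_, x, rfl⟩
    have h1 : hγ.toHomeomorph.symm ⟨γ x, x, rfl⟩ = x :=
      hγ.toHomeomorph.symm_apply_apply x
    rw [h1]
    exact Function.leftInverse_invFun hγ.injective x
  rw [this]
  exact hγ.toHomeomorph.symm.continuous

theorem logRatio_image_Ici {γ : ℝ → ℂ} (hγ : IsClosedEmbedding γ) (b : ℝ) {p q : ℂ}
    (hp : p ∉ γ '' Ici b) (hq : q ∉ γ '' Ici b) : LogRatio (γ '' Ici b) p q := by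
  have hp' : ∀ s, γ (max b s) - p ≠ 0 := fun s h =>
    hp ⟨max b s, mem_Ici.2 (le_max_left _ _), sub_eq_zero.1 h⟩
  have hq' : ∀ s, γ (max b s) - q ≠ 0 := fun s h =>
    hq ⟨max b s, mem_Ici.2 (le_max_left _ _), sub_eq_zero.1 h⟩
  have hc := hγ.continuous
  have hfc : Continuous fun s : ℝ => (γ (max b s) - p) / (γ (max b s) - q) :=
    Continuous.div (by fun_prop) (by fun_prop) hq'
  obtain ⟨l, hl, hle⟩ := exists_log_of_simplyConnected hfc
    (fun s => div_ne_zero (hp' s) (hq' s))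
  have hinf : Tendsto (fun s : ℝ => γ (max b s)) atTop (cobounded ℂ) := by
    rw [Metric.cobounded_eq_cocompact]
    have h1 : Tendsto γ atTop (cocompact ℂ) := hγ.tendsto_cocompact.mono_left atTop_le_cocompact
    refine h1.congr' ?_
    filter_upwards [eventually_ge_atTop b] with s hs
    rw [max_eq_right hs]
  have hlim := (tendsto_ratio_cobounded p q).comp hinf
  obtain ⟨s0, hs0⟩ := eventually_atTop.1
    (hlim.eventually (isOpen_slitPlane.mem_nhds one_mem_slitPlane))
  simp only [Function.comp_apply] at hs0
  set m : ℝ → ℂ := fun s => log ((γ (max b s) - p) / (γ (max b s) - q)) with hm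
  have hmc : ContinuousOn m (Ici s0) := ContinuousOn.clog hfc.continuousOn fun s hs => hs0 s hs
  have hconst : ∀ s ∈ Ici s0, l s - m s = l s0 - m s0 := fun s hs =>
    eqOn_const_of_exp_eq_one isPreconnected_Ici (u := fun s => l s - m s)
      (hl.continuousOn.sub hmc) (fun s hs => by
        rw [exp_sub, hle, exp_log (slitPlane_ne_zero (hs0 s hs)),
          div_self (slitPlane_ne_zero (hs0 s hs))]) hs self_mem_Ici
  have hc1 : exp (l s0 - m s0) = 1 := by
    rw [exp_sub, hle, exp_log (slitPlane_ne_zero (hs0 s0 le_rfl)),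
      div_self (slitPlane_ne_zero (hs0 s0 le_rfl))]
  have hlim0 : Tendsto (fun s => l s - (l s0 - m s0)) atTop (𝓝 0) := by
    have h1 := (continuousAt_clog one_mem_slitPlane).tendsto.comp hlim
    rw [log_one] at h1
    refine h1.congr' ?_
    filter_upwards [eventually_ge_atTop s0] with s hs
    rw [← hconst s hs]
    simp [hm]
  have hinv : ∀ s, Function.invFun γ (γ s) = s := Function.leftInverse_invFun hγ.injective
  refine ⟨fun z => l (Function.invFun γ z) - (l s0 - m s0), ?_, ?_, ?_⟩
  · refine ContinuousOn.sub ?_ continuousOn_const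
    exact hl.comp_continuousOn ((continuousOn_invFun_range hγ.isEmbedding).mono
      (image_subset_range _ _))
  · rintro _ ⟨s, hs, rfl⟩
    have h := hle s
    rw [max_eq_right (mem_Ici.1 hs)] at h
    simp only [hinv]
    rw [exp_sub, hc1, div_one, h]
  · have ht : Tendsto (Function.invFun γ) (cobounded ℂ ⊓ 𝓟 (γ '' Ici b)) atTop := by
      refine tendsto_atTop.2 fun M => ?_
      rw [eventually_inf_principal]
      have hK : IsBounded (γ '' Icc b M) := (isCompact_Icc.image hc).isBounded
      filter_upwards [hK] with z hz hzb
      obtain ⟨s, hs, rfl⟩ := hzb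
      rw [hinv]
      by_contra! hlt
      exact hz ⟨s, ⟨hs, hlt.le⟩, rfl⟩
    exact hlim0.comp ht

theorem logRatio_image_Iic {γ : ℝ → ℂ} (hγ : IsClosedEmbedding γ) (b : ℝ) {p q : ℂ}
    (hp : p ∉ γ '' Iic b) (hq : q ∉ γ '' Iic b) : LogRatio (γ '' Iic b) p q := by
  have hγ' : IsClosedEmbedding (γ ∘ Neg.neg) :=
    hγ.comp (Homeomorph.neg ℝ).isClosedEmbedding
  have himg : (γ ∘ Neg.neg) '' Ici (-b) = γ '' Iic b := by
    rw [image_comp]; simp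
  rw [← himg] at hp hq ⊢
  exact logRatio_image_Ici hγ' _ hp hq

/-! ### Complements of finite families of proper lines -/

/-- A family of pairwise disjoint proper topological lines in `ℂ`. -/
structure LineFamily (ι : Type) where
  /-- The parametrizations of the lines. -/
  γ : ι → ℝ → ℂ
  emb : ∀ i, IsClosedEmbedding (γ i)
  disj : ∀ i j, i ≠ j → Disjoint (range (γ i)) (range (γ j))

/-- The union of the lines of the family. -/
def LineFamily.carrier {ι : Type} (Γ : LineFamily ι) : Set ℂ := ⋃ i, range (Γ.γ i)

theorem not_isBounded_image_Ici {γ : ℝ → ℂ} (hγ : IsClosedEmbedding γ) (b : ℝ) :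
    ¬ IsBounded (γ '' Ici b) := by
  intro h
  have hc : IsCompact (γ '' Ici b) :=
    Metric.isCompact_of_isClosed_isBounded (hγ.isClosedMap _ isClosed_Ici) h
  have h2 := hγ.isCompact_preimage hc
  rw [hγ.injective.preimage_image] at h2
  exact not_bddAbove_Ici b h2.bddAbove

theorem not_isBounded_image_Iic {γ : ℝ → ℂ} (hγ : IsClosedEmbedding γ) (b : ℝ) :
    ¬ IsBounded (γ '' Iic b) := by
  intro h
  have hc : IsCompact (γ '' Iic b) :=
    Metric.isCompact_of_isClosed_isBounded (hγ.isClosedMap _ isClosed_Iic) h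
  have h2 := hγ.isCompact_preimage hc
  rw [hγ.injective.preimage_image] at h2
  exact not_bddBelow_Iic b h2.bddBelow

theorem not_isBounded_range {γ : ℝ → ℂ} (hγ : IsClosedEmbedding γ) :
    ¬ IsBounded (range γ) := fun h =>
  not_isBounded_image_Ici hγ 0 (h.subset (image_subset_range _ _))

/-- A component of an open subset of the plane. -/
def IsComponent (O U : Set ℂ) : Prop := ∃ p ∈ O, U = connectedComponentIn O p

namespace IsComponent

variable {O U V : Set ℂ}

theorem isOpen (hO : IsOpen O) (h : IsComponent O U) : IsOpen U := by
  obtain ⟨p, -, rfl⟩ := h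
  exact hO.connectedComponentIn

theorem isPreconnected (h : IsComponent O U) : IsPreconnected U := by
  obtain ⟨p, -, rfl⟩ := h
  exact isPreconnected_connectedComponentIn

theorem nonempty (h : IsComponent O U) : U.Nonempty := by
  obtain ⟨p, hp, rfl⟩ := h
  exact ⟨p, mem_connectedComponentIn hp⟩

theorem subset (h : IsComponent O U) : U ⊆ O := by
  obtain ⟨p, -, rfl⟩ := h
  exact connectedComponentIn_subset _ _

theorem eq_connectedComponentIn (h : IsComponent O U) {q : ℂ} (hq : q ∈ U) :
    U = connectedComponentIn O q := by
  obtain ⟨p, -, rfl⟩ := h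
  exact connectedComponentIn_eq hq

theorem eq_of_mem (h : IsComponent O U) (h' : IsComponent O V) {q : ℂ} (hq : q ∈ U)
    (hq' : q ∈ V) : U = V := by
  rw [h.eq_connectedComponentIn hq, h'.eq_connectedComponentIn hq']

theorem subset_of_isPreconnected (h : IsComponent O U) {C : Set ℂ} (hC : IsPreconnected C)
    (hCO : C ⊆ O) {q : ℂ} (hq : q ∈ U) (hqC : q ∈ C) : C ⊆ U := by
  rw [h.eq_connectedComponentIn hq]
  exact hC.subset_connectedComponentIn hqC hCO

theorem closure_inter (hO : IsOpen O) (h : IsComponent O U) {z : ℂ} (hz : z ∈ closure U)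
    (hzO : z ∈ O) : z ∈ U := by
  have hc : IsComponent O (connectedComponentIn O z) := ⟨z, hzO, rfl⟩
  have hm : z ∈ connectedComponentIn O z := mem_connectedComponentIn hzO
  obtain ⟨w, hw1, hw2⟩ := mem_closure_iff.1 hz _ (hc.isOpen hO) hm
  rw [h.eq_of_mem hc hw2 hw1]
  exact hm

theorem frontier_subset (hO : IsOpen O) (h : IsComponent O U) : frontier U ⊆ Oᶜ := by
  intro z hz hzO
  rw [(h.isOpen hO).frontier_eq] at hz
  exact hz.2 (h.closure_inter hO hz.1 hzO)

end IsComponent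

namespace LineFamily

variable {ι : Type} (Γ : LineFamily ι)

theorem γ_mem (i : ι) (s : ℝ) : Γ.γ i s ∈ Γ.carrier := mem_iUnion.2 ⟨i, s, rfl⟩

theorem index_eq {i j : ι} {s t : ℝ} (h : Γ.γ i s = Γ.γ j t) : i = j := by
  by_contra hij
  exact disjoint_left.1 (Γ.disj i j hij) ⟨s, rfl⟩ ⟨t, h.symm⟩

theorem param_eq {i : ι} {s t : ℝ} (h : Γ.γ i s = Γ.γ i t) : s = t := (Γ.emb i).injective h

/-- The union of all lines but the `i`-th one. -/
def others (i : ι) : Set ℂ := ⋃ j : {j // j ≠ i}, range (Γ.γ j)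

theorem mem_others {i : ι} {z : ℂ} : z ∈ Γ.others i ↔ ∃ j, j ≠ i ∧ ∃ s, Γ.γ j s = z := by
  simp [others]

theorem disjoint_range_others (i : ι) : Disjoint (range (Γ.γ i)) (Γ.others i) := by
  rw [disjoint_left]
  rintro _ ⟨s, rfl⟩ h
  obtain ⟨j, hj, t, ht⟩ := Γ.mem_others.1 h
  exact hj (Γ.index_eq ht)

theorem carrier_eq (i : ι) (a b : ℝ) : Γ.carrier =
    (Γ.γ i '' Iic a ∪ Γ.γ i '' Ici b ∪ Γ.others i) ∪ Γ.γ i '' Ioo a b := by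
  ext z
  constructor
  · intro hz
    obtain ⟨j, s, rfl⟩ := mem_iUnion.1 hz
    by_cases hj : j = i
    · subst hj
      rcases le_or_gt s a with h | h
      · exact Or.inl (Or.inl (Or.inl ⟨s, h, rfl⟩))
      · rcases le_or_gt b s with h' | h'
        · exact Or.inl (Or.inl (Or.inr ⟨s, h', rfl⟩))
        · exact Or.inr ⟨s, ⟨h, h'⟩, rfl⟩
    · exact Or.inl (Or.inr (Γ.mem_others.2 ⟨j, hj, s, rfl⟩))
  · rintro (((⟨s, -, rfl⟩ | ⟨s, -, rfl⟩) | h) | ⟨s, -, rfl⟩)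
    · exact Γ.γ_mem _ _
    · exact Γ.γ_mem _ _
    · obtain ⟨j, -, s, rfl⟩ := Γ.mem_others.1 h
      exact Γ.γ_mem _ _
    · exact Γ.γ_mem _ _

theorem exists_unbounded_connected {i : ι} {a b : ℝ} {z : ℂ}
    (hz : z ∈ Γ.γ i '' Iic a ∪ Γ.γ i '' Ici b ∪ Γ.others i) :
    ∃ C ⊆ Γ.γ i '' Iic a ∪ Γ.γ i '' Ici b ∪ Γ.others i, z ∈ C ∧ IsPreconnected C ∧
      ¬ IsBounded C := by
  have hc := (Γ.emb i).continuous
  rcases hz with (h | h) | h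
  · exact ⟨_, subset_union_left.trans subset_union_left, h,
      isPreconnected_Iic.image _ hc.continuousOn, not_isBounded_image_Iic (Γ.emb i) a⟩
  · exact ⟨_, subset_union_right.trans subset_union_left, h,
      isPreconnected_Ici.image _ hc.continuousOn, not_isBounded_image_Ici (Γ.emb i) b⟩
  · obtain ⟨j, hj, s, rfl⟩ := Γ.mem_others.1 h
    refine ⟨range (Γ.γ j), ?_, ⟨s, rfl⟩, isPreconnected_range (Γ.emb j).continuous,
      not_isBounded_range (Γ.emb j)⟩
    rintro _ ⟨t, rfl⟩
    exact Or.inr (Γ.mem_others.2 ⟨j, hj, t, rfl⟩)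

theorem exists_arc_subset_ball (i : ι) (c : ℝ) {ε : ℝ} (hε : 0 < ε) :
    ∃ a b, a < c ∧ c < b ∧ Γ.γ i '' Icc a b ⊆ Metric.ball (Γ.γ i c) ε := by
  have h := (Γ.emb i).continuous.continuousAt (x := c) (Metric.ball_mem_nhds _ hε)
  obtain ⟨η, hη, hb⟩ := Metric.mem_nhds_iff.1 (mem_map.1 h)
  refine ⟨c - η / 2, c + η / 2, by linarith, by linarith, ?_⟩
  rintro _ ⟨s, hs, rfl⟩
  refine hb ?_
  rw [Metric.mem_ball, Real.dist_eq, abs_lt]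
  constructor <;> linarith [hs.1, hs.2]

variable [Finite ι]

theorem isClosed_others (i : ι) : IsClosed (Γ.others i) :=
  isClosed_iUnion_of_finite fun j => (Γ.emb j).isClosed_range

theorem isClosed_carrier : IsClosed Γ.carrier :=
  isClosed_iUnion_of_finite fun j => (Γ.emb j).isClosed_range

theorem isClosed_rest (i : ι) (a b : ℝ) :
    IsClosed (Γ.γ i '' Iic a ∪ Γ.γ i '' Ici b ∪ Γ.others i) :=
  (((Γ.emb i).isClosedMap _ isClosed_Iic).union ((Γ.emb i).isClosedMap _ isClosed_Ici)).union
    (Γ.isClosed_others i)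

/-- Components of the complement are uniformly locally connected at the points of the lines. -/
theorem exists_isPreconnected_ball (i : ι) (c : ℝ) {ε : ℝ} (hε : 0 < ε) :
    ∃ δ > 0, δ ≤ ε ∧ ∀ U, IsComponent Γ.carrierᶜ U → ∀ p ∈ U ∩ Metric.ball (Γ.γ i c) δ,
      ∀ q ∈ U ∩ Metric.ball (Γ.γ i c) δ, ∃ C ⊆ U ∩ Metric.ball (Γ.γ i c) ε,
        IsPreconnected C ∧ p ∈ C ∧ q ∈ C := by
  obtain ⟨a, b, hac, hcb, hab⟩ := Γ.exists_arc_subset_ball i c hε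
  set x := Γ.γ i c
  set E := Γ.γ i '' Iic a ∪ Γ.γ i '' Ici b ∪ Γ.others i with hE
  have hEc : IsClosed E := Γ.isClosed_rest i a b
  have hxE : x ∈ Eᶜ := by
    rintro ((⟨s, hs, h⟩ | ⟨s, hs, h⟩) | h)
    · exact absurd (Γ.param_eq h) (by rintro rfl; exact absurd hs (not_le.2 hac))
    · exact absurd (Γ.param_eq h) (by rintro rfl; exact absurd hs (not_le.2 hcb))
    · exact disjoint_left.1 (Γ.disjoint_range_others i) ⟨c, rfl⟩ h
  obtain ⟨δ, hδ, hball⟩ := Metric.isOpen_iff.1 hEc.isOpen_compl x hxE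
  refine ⟨min δ ε, lt_min hδ hε, min_le_right _ _, ?_⟩
  rintro U hU p ⟨hpU, hp⟩ q ⟨hqU, hq⟩
  have hO := Γ.isClosed_carrier.isOpen_compl
  have hEF : E ⊆ Γ.carrier := by rw [Γ.carrier_eq i a b]; exact subset_union_left
  have hpF : p ∉ Γ.carrier := hU.subset hpU
  have hqF : q ∉ Γ.carrier := hU.subset hqU
  have hpE : p ∈ Metric.ball x ε := Metric.ball_subset_ball (min_le_right _ _) hp
  have hqE : q ∈ Metric.ball x ε := Metric.ball_subset_ball (min_le_right _ _) hq
  have hBc : IsClosed (E ∪ (Metric.ball x ε)ᶜ) := hEc.union Metric.isOpen_ball.isClosed_compl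
  have h1 : LogRatio Γ.carrier p q := logRatio_of_isPreconnected Γ.isClosed_carrier
    hU.isPreconnected (disjoint_left.2 fun z hz => hU.subset hz) hpU hqU
  have h2 : LogRatio (E ∪ (Metric.ball x ε)ᶜ) p q := by
    refine logRatio_of_isPreconnected hBc (C := Metric.ball x (min δ ε))
      (convex_ball _ _).isPreconnected ?_ hp hq
    rw [disjoint_left]
    rintro z hz (h | h)
    · exact hball (Metric.ball_subset_ball (min_le_left _ _) hz) h
    · exact h (Metric.ball_subset_ball (min_le_right _ _) hz)
  have hker : Γ.carrier ∩ (E ∪ (Metric.ball x ε)ᶜ) = E := by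
    refine Subset.antisymm ?_ fun z hz => ⟨hEF hz, Or.inl hz⟩
    rintro z ⟨hzF, h | h⟩
    · exact h
    · rw [Γ.carrier_eq i a b] at hzF
      rcases hzF with h' | ⟨s, hs, rfl⟩
      · exact h'
      · exact absurd (hab ⟨s, Ioo_subset_Icc_self hs, rfl⟩) h
  have h3 := LogRatio.union Γ.isClosed_carrier hBc h1 h2
    (by rw [hker]; exact fun z hz => Γ.exists_unbounded_connected hz)
    (fun h => hqF h.1) (fun h => hpF h.1)
  have hcl := Γ.isClosed_carrier.union hBc
  have hp' : p ∉ Γ.carrier ∪ (E ∪ (Metric.ball x ε)ᶜ) := by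
    rintro (h | h | h)
    exacts [hpF h, hpF (hEF h), h hpE]
  have hq' : q ∉ Γ.carrier ∪ (E ∪ (Metric.ball x ε)ᶜ) := by
    rintro (h | h | h)
    exacts [hqF h, hqF (hEF h), h hqE]
  have h4 := h3.mem_connectedComponentIn hcl hp' hq'
  have hsub := connectedComponentIn_subset (Γ.carrier ∪ (E ∪ (Metric.ball x ε)ᶜ))ᶜ p
  have hpm : p ∈ connectedComponentIn (Γ.carrier ∪ (E ∪ (Metric.ball x ε)ᶜ))ᶜ p :=
    mem_connectedComponentIn hp'
  refine ⟨_, subset_inter ?_ ?_, isPreconnected_connectedComponentIn, hpm, h4⟩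
  · exact hU.subset_of_isPreconnected isPreconnected_connectedComponentIn
      (fun z hz h => hsub hz (Or.inl h)) hpU hpm
  · intro z hz
    by_contra h
    exact hsub hz (Or.inr (Or.inr h))

/-- A component of the complement which comes close to a line is adjacent to the whole line. -/
theorem range_subset_closure {i : ι} {c r : ℝ}
    (hr : Disjoint (Metric.ball (Γ.γ i c) r) (Γ.others i)) {U : Set ℂ}
    (hU : IsComponent Γ.carrierᶜ U) {p : ℂ} (hp : p ∈ Metric.ball (Γ.γ i c) r) (hpU : p ∈ U) :
    range (Γ.γ i) ⊆ closure U := by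
  rintro _ ⟨d, rfl⟩
  by_contra hy
  obtain ⟨ε, hε, hball⟩ := Metric.isOpen_iff.1 isClosed_closure.isOpen_compl _ hy
  obtain ⟨a, b, had, hdb, hab⟩ := Γ.exists_arc_subset_ball i d hε
  have hpF : p ∉ Γ.carrier := hU.subset hpU
  set E := Γ.γ i '' Iic a ∪ Γ.γ i '' Ici b ∪ Γ.others i with hE
  have hEF : E ⊆ Γ.carrier := by rw [Γ.carrier_eq i a b]; exact subset_union_left
  have hyE : Γ.γ i d ∉ E := by
    rintro ((⟨s, hs, h⟩ | ⟨s, hs, h⟩) | h)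
    · exact absurd (Γ.param_eq h) (by rintro rfl; exact absurd hs (not_le.2 had))
    · exact absurd (Γ.param_eq h) (by rintro rfl; exact absurd hs (not_le.2 hdb))
    · exact disjoint_left.1 (Γ.disjoint_range_others i) ⟨d, rfl⟩ h
  have hpE : p ∉ E := fun h => hpF (hEF h)
  have hcA := (Γ.emb i).isClosedMap _ (isClosed_Iic (a := a))
  have hcB := (Γ.emb i).isClosedMap _ (isClosed_Ici (a := b))
  have hI : Γ.γ i '' Iic a ∩ Γ.γ i '' Ici b = ∅ := by
    rw [← image_inter (Γ.emb i).injective, Iic_inter_Ici, Icc_eq_empty (by linarith), image_empty]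
  have h1 : LogRatio (Γ.γ i '' Iic a ∪ Γ.γ i '' Ici b) p (Γ.γ i d) := by
    refine LogRatio.union hcA hcB (logRatio_image_Iic (Γ.emb i) a ?_ ?_)
      (logRatio_image_Ici (Γ.emb i) b ?_ ?_) ?_ ?_ ?_
    · exact fun h => hpE (Or.inl (Or.inl h))
    · exact fun h => hyE (Or.inl (Or.inl h))
    · exact fun h => hpE (Or.inl (Or.inr h))
    · exact fun h => hyE (Or.inl (Or.inr h))
    · simp [hI]
    · simp [hI]
    · simp [hI]
  have h2 : LogRatio (Γ.others i) p (Γ.γ i d) := by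
    refine logRatio_of_isPreconnected (Γ.isClosed_others i)
      (C := Metric.ball (Γ.γ i c) r ∪ range (Γ.γ i)) ?_ ?_ (Or.inl hp) (Or.inr ⟨d, rfl⟩)
    · refine IsPreconnected.union (Γ.γ i c) ?_ ⟨c, rfl⟩ (convex_ball _ _).isPreconnected
        (isPreconnected_range (Γ.emb i).continuous)
      exact Metric.mem_ball_self (dist_nonneg.trans_lt hp)
    · exact disjoint_union_left.2 ⟨hr, Γ.disjoint_range_others i⟩
  have hI2 : (Γ.γ i '' Iic a ∪ Γ.γ i '' Ici b) ∩ Γ.others i = ∅ :=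
    disjoint_iff_inter_eq_empty.1 ((Γ.disjoint_range_others i).mono_left
      (union_subset (image_subset_range _ _) (image_subset_range _ _)))
  have h3 : LogRatio E p (Γ.γ i d) := by
    refine LogRatio.union (hcA.union hcB) (Γ.isClosed_others i) h1 h2 ?_ ?_ ?_ <;> simp [hI2]
  have h4 := h3.mem_connectedComponentIn (Γ.isClosed_rest i a b) hpE hyE
  have hO := Γ.isClosed_carrier.isOpen_compl
  have hne : (connectedComponentIn Eᶜ p ∩ frontier U).Nonempty := by
    by_contra hcon
    rw [not_nonempty_iff_eq_empty] at hcon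
    have := isPreconnected_connectedComponentIn (F := Eᶜ) (x := p)
    have h5 := this.subset_or_subset (hU.isOpen hO) isClosed_closure.isOpen_compl
      (disjoint_left.2 fun z hz hz' => hz' (subset_closure hz)) (fun z hz => by
        by_cases hzU : z ∈ closure U
        · by_cases hzU' : z ∈ U
          · exact Or.inl hzU'
          · have : z ∈ connectedComponentIn Eᶜ p ∩ frontier U :=
              ⟨hz, by rw [(hU.isOpen hO).frontier_eq]; exact ⟨hzU, hzU'⟩⟩
            rw [hcon] at this
            exact absurd this (notMem_empty _)
        · exact Or.inr hzU)
    rcases h5 with h5 | h5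
    · exact hy (subset_closure (h5 h4))
    · exact h5 (mem_connectedComponentIn hpE) (subset_closure hpU)
  obtain ⟨w, hw1, hw2⟩ := hne
  have hwF := hU.frontier_subset hO hw2
  rw [compl_compl, Γ.carrier_eq i a b] at hwF
  rcases hwF with h | ⟨s, hs, rfl⟩
  · exact connectedComponentIn_subset _ _ hw1 h
  · exact hball (hab ⟨s, Ioo_subset_Icc_self hs, rfl⟩) hw2.1

/-- The complement of a component is a union of unbounded connected sets. -/
theorem exists_unbounded_connected_compl {U : Set ℂ} (hU : IsComponent Γ.carrierᶜ U) {z : ℂ}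
    (hz : z ∉ U) : ∃ C ⊆ Uᶜ, z ∈ C ∧ IsPreconnected C ∧ ¬ IsBounded C := by
  have hO := Γ.isClosed_carrier.isOpen_compl
  have hline : ∀ i, range (Γ.γ i) ⊆ Uᶜ := by
    rintro i _ ⟨s, rfl⟩ h
    exact hU.subset h (Γ.γ_mem i s)
  by_cases hzF : z ∈ Γ.carrier
  · obtain ⟨i, s, rfl⟩ := mem_iUnion.1 hzF
    exact ⟨_, hline i, ⟨s, rfl⟩, isPreconnected_range (Γ.emb i).continuous,
      not_isBounded_range (Γ.emb i)⟩
  · have hW : IsComponent Γ.carrierᶜ (connectedComponentIn Γ.carrierᶜ z) := ⟨z, hzF, rfl⟩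
    set W := connectedComponentIn Γ.carrierᶜ z
    have hzW : z ∈ W := mem_connectedComponentIn hzF
    have hWU : Disjoint W U := by
      rw [disjoint_left]
      intro w hw hw'
      exact hz (hW.eq_of_mem hU hw hw' ▸ hzW)
    have hclU : closure W ⊆ Uᶜ := fun w hw hwU => by
      obtain ⟨v, hv, hv'⟩ := mem_closure_iff.1 hw _ (hU.isOpen hO) hwU
      exact disjoint_left.1 hWU hv' hv
    have hWne : W ≠ univ := fun h => by
      obtain ⟨u, hu⟩ := hU.nonempty
      exact disjoint_left.1 hWU (h ▸ mem_univ u) hu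
    have hfr : (frontier W).Nonempty := nonempty_frontier_iff.2 ⟨⟨z, hzW⟩, hWne⟩
    obtain ⟨w, hw⟩ := hfr
    have hwF := hW.frontier_subset hO hw
    rw [compl_compl] at hwF
    obtain ⟨i, s, rfl⟩ := mem_iUnion.1 hwF
    refine ⟨closure W ∪ range (Γ.γ i), union_subset hclU (hline i), Or.inl (subset_closure hzW),
      ?_, ?_⟩
    · exact IsPreconnected.union _ hw.1 ⟨s, rfl⟩ hW.isPreconnected.closure
        (isPreconnected_range (Γ.emb i).continuous)
    · exact fun h => not_isBounded_range (Γ.emb i) (h.subset subset_union_right)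

end LineFamily

/-! ### Uniform limits of polynomials on compact sets -/

/-- `f` is a uniform limit of polynomials on `K`. -/
def PolyApprox (K : Set ℂ) (f : ℂ → ℂ) : Prop :=
  ∀ ε > 0, ∃ p : Polynomial ℂ, ∀ z ∈ K, ‖f z - p.eval z‖ ≤ ε

namespace PolyApprox

variable {K : Set ℂ} {f g : ℂ → ℂ}

theorem polynomial (p : Polynomial ℂ) : PolyApprox K fun z => p.eval z := fun ε hε =>
  ⟨p, fun z _ => by simpa using hε.le⟩

theorem const (c : ℂ) : PolyApprox K fun _ => c := by
  simpa using polynomial (K := K) (Polynomial.C c)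

theorem id : PolyApprox K fun z => z := by
  simpa using polynomial (K := K) Polynomial.X

theorem of_forall_exists (h : ∀ ε > 0, ∃ g, PolyApprox K g ∧ ∀ z ∈ K, ‖f z - g z‖ ≤ ε) :
    PolyApprox K f := fun ε hε => by
  obtain ⟨g, hg, hfg⟩ := h (ε / 2) (half_pos hε)
  obtain ⟨p, hp⟩ := hg (ε / 2) (half_pos hε)
  refine ⟨p, fun z hz => ?_⟩
  have : f z - p.eval z = (f z - g z) + (g z - p.eval z) := by ring
  rw [this]
  exact (norm_add_le _ _).trans (by linarith [hfg z hz, hp z hz])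

theorem congr (h : PolyApprox K f) (hfg : ∀ z ∈ K, g z = f z) : PolyApprox K g := fun ε hε => by
  obtain ⟨p, hp⟩ := h ε hε
  exact ⟨p, fun z hz => by rw [hfg z hz]; exact hp z hz⟩

theorem add (hf : PolyApprox K f) (hg : PolyApprox K g) : PolyApprox K fun z => f z + g z :=
  fun ε hε => by
  obtain ⟨p, hp⟩ := hf (ε / 2) (half_pos hε)
  obtain ⟨q, hq⟩ := hg (ε / 2) (half_pos hε)
  refine ⟨p + q, fun z hz => ?_⟩
  have : f z + g z - (p + q).eval z = (f z - p.eval z) + (g z - q.eval z) := by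
    rw [Polynomial.eval_add]; ring
  rw [this]
  exact (norm_add_le _ _).trans (by linarith [hp z hz, hq z hz])

theorem continuousOn (hf : PolyApprox K f) : ContinuousOn f K := by
  choose p hp using fun n : ℕ => hf (1 / ((n : ℝ) + 1)) Nat.one_div_pos_of_nat
  have : TendstoUniformlyOn (fun n z => (p n).eval z) f atTop K := by
    rw [Metric.tendstoUniformlyOn_iff]
    intro ε hε
    obtain ⟨N, hN⟩ := exists_nat_one_div_lt hε
    filter_upwards [eventually_ge_atTop N] with n hn z hz
    rw [dist_eq_norm]
    refine (hp n z hz).trans_lt (lt_of_le_of_lt ?_ hN)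
    gcongr
  exact this.continuousOn (Frequently.of_forall fun n => (p n).continuous.continuousOn)

theorem exists_norm_le (hK : IsCompact K) (hf : PolyApprox K f) :
    ∃ M > 0, ∀ z ∈ K, ‖f z‖ ≤ M := by
  obtain ⟨M, hM⟩ := hK.exists_bound_of_continuousOn hf.continuousOn
  exact ⟨max M 1, lt_max_of_lt_right one_pos, fun z hz => (hM z hz).trans (le_max_left _ _)⟩

theorem mul (hK : IsCompact K) (hf : PolyApprox K f) (hg : PolyApprox K g) :
    PolyApprox K fun z => f z * g z := by
  obtain ⟨M, hM0, hM⟩ := hg.exists_norm_le hK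
  refine of_forall_exists fun ε hε => ?_
  obtain ⟨p, hp⟩ := hf (ε / M) (by positivity)
  refine ⟨fun z => p.eval z * g z, ?_, fun z hz => ?_⟩
  · obtain ⟨M', hM0', hM'⟩ := (polynomial (K := K) p).exists_norm_le hK
    intro η hη
    obtain ⟨q, hq⟩ := hg (η / M') (by positivity)
    refine ⟨p * q, fun z hz => ?_⟩
    rw [Polynomial.eval_mul, ← mul_sub, norm_mul]
    calc ‖p.eval z‖ * ‖g z - q.eval z‖ ≤ M' * (η / M') := by
          gcongr
          exacts [hM' z hz, hq z hz]
      _ = η := by field_simp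
  · rw [← sub_mul, norm_mul]
    calc ‖f z - p.eval z‖ * ‖g z‖ ≤ (ε / M) * M := by
          gcongr
          exacts [hp z hz, hM z hz]
      _ = ε := by field_simp

theorem neg (hK : IsCompact K) (hf : PolyApprox K f) : PolyApprox K fun z => - f z := by
  simpa using (const (-1)).mul hK hf

theorem sub (hK : IsCompact K) (hf : PolyApprox K f) (hg : PolyApprox K g) :
    PolyApprox K fun z => f z - g z := by
  simpa [sub_eq_add_neg] using hf.add (hg.neg hK)

theorem pow (hK : IsCompact K) (hf : PolyApprox K f) (n : ℕ) : PolyApprox K fun z => f z ^ n := by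
  induction n with
  | zero => simpa using const (K := K) 1
  | succ n ih => simpa [pow_succ] using ih.mul hK hf

theorem sum {ι : Type*} (s : Finset ι) {F : ι → ℂ → ℂ} (h : ∀ i ∈ s, PolyApprox K (F i)) :
    PolyApprox K fun z => ∑ i ∈ s, F i z := by
  classical
  induction s using Finset.induction_on with
  | empty => simpa using const (K := K) 0
  | insert a s ha ih =>
    simp only [Finset.sum_insert ha]
    exact (h a (by simp)).add (ih fun i hi => h i (by simp [hi]))

theorem comp_differentiableOn (hK : IsCompact K) (hf : PolyApprox K f) {F : ℂ → ℂ} {w : ℂ}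
    {R r : ℝ} (hF : DifferentiableOn ℂ F (Metric.ball w R)) (hr : 0 < r) (hrR : r < R)
    (h : ∀ z ∈ K, ‖f z - w‖ < r) : PolyApprox K fun z => F (f z) := by
  obtain ⟨R', hrR', hR'R⟩ := exists_between hrR
  have hR'0 : 0 < R' := hr.trans hrR'
  lift R' to NNReal using hR'0.le
  lift r to NNReal using hr.le
  have hs := (hF.mono (Metric.closedBall_subset_ball hR'R)).hasFPowerSeriesOnBall
    (by exact_mod_cast hR'0)
  have hu := hs.tendstoUniformlyOn (r' := r) (by exact_mod_cast hrR')
  rw [Metric.tendstoUniformlyOn_iff] at hu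
  refine of_forall_exists fun ε hε => ?_
  obtain ⟨n, hn⟩ := (hu ε hε).exists
  refine ⟨fun z => (cauchyPowerSeries F w R').partialSum n (f z - w), ?_, fun z hz => ?_⟩
  · simp only [FormalMultilinearSeries.partialSum]
    refine sum _ fun k _ => ?_
    have hc := (const (K := K) ((cauchyPowerSeries F w R').coeff k)).mul hK
      ((hf.sub hK (const w)).pow hK k)
    refine hc.congr fun z _ => ?_
    rw [FormalMultilinearSeries.apply_eq_pow_smul_coeff, smul_eq_mul, mul_comm]
  · have := hn (f z - w) (by simpa using h z hz)
    rw [dist_eq_norm, add_sub_cancel] at this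
    exact this.le

theorem exp (hK : IsCompact K) (hf : PolyApprox K f) : PolyApprox K fun z => exp (f z) := by
  obtain ⟨M, hM0, hM⟩ := hf.exists_norm_le hK
  exact hf.comp_differentiableOn hK (F := Complex.exp) (w := 0) (r := M + 1) (R := M + 2)
    (Complex.differentiable_exp.differentiableOn) (by linarith) (by linarith)
    (fun z hz => by rw [sub_zero]; linarith [hM z hz])

/-- `f` has a logarithm on `K` which is a uniform limit of polynomials. -/
def HasLog (K : Set ℂ) (f : ℂ → ℂ) : Prop :=
  ∃ g, PolyApprox K g ∧ ∀ z ∈ K, Complex.exp (g z) = f z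

theorem hasLog_of_near_one (hK : IsCompact K) (hf : PolyApprox K f)
    (h : ∀ z ∈ K, ‖f z - 1‖ < 1) : HasLog K f := by
  have hsl : ∀ z ∈ K, f z ∈ slitPlane := fun z hz =>
    ball_one_subset_slitPlane (by rw [mem_ball_iff_norm]; exact h z hz)
  obtain ⟨r, hr0, hr1, hr⟩ : ∃ r : ℝ, 0 < r ∧ r < 1 ∧ ∀ z ∈ K, ‖f z - 1‖ < r := by
    rcases K.eq_empty_or_nonempty with rfl | hne
    · exact ⟨1 / 2, by norm_num, by norm_num, by simp⟩
    obtain ⟨z0, hz0, hmax⟩ := hK.exists_isMaxOn hne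
      ((hf.continuousOn.sub continuousOn_const).norm : ContinuousOn (fun z => ‖f z - 1‖) K)
    obtain ⟨r, h1, h2⟩ := exists_between (h z0 hz0)
    exact ⟨r, (norm_nonneg _).trans_lt h1, h2, fun z hz => (hmax hz).trans_lt h1⟩
  refine ⟨fun z => log (f z), ?_, fun z hz => exp_log (slitPlane_ne_zero (hsl z hz))⟩
  refine hf.comp_differentiableOn hK (F := log) (w := 1) (R := 1) ?_ hr0 hr1 hr
  exact fun z hz => (differentiableAt_log (ball_one_subset_slitPlane hz)).differentiableWithinAt

theorem HasLog.mul (hf : HasLog K f) (hg : HasLog K g) : HasLog K fun z => f z * g z := by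
  obtain ⟨l, hl, hle⟩ := hf
  obtain ⟨m, hm, hme⟩ := hg
  exact ⟨_, hl.add hm, fun z hz => by rw [exp_add, hle z hz, hme z hz]⟩

theorem HasLog.congr (hf : HasLog K f) (h : ∀ z ∈ K, g z = f z) : HasLog K g := by
  obtain ⟨l, hl, hle⟩ := hf
  exact ⟨l, hl, fun z hz => by rw [h z hz, hle z hz]⟩

theorem HasLog.polyApprox_inv (hK : IsCompact K) (hf : HasLog K f) :
    PolyApprox K fun z => (f z)⁻¹ := by
  obtain ⟨l, hl, hle⟩ := hf
  exact ((hl.neg hK).exp hK).congr fun z hz => by rw [exp_neg, hle z hz]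

theorem hasLog_const {c : ℂ} (hc : c ≠ 0) : HasLog K fun _ => c :=
  ⟨fun _ => log c, const _, fun _ _ => exp_log hc⟩

theorem HasLog.sub_of_near (hK : IsCompact K) {a b : ℂ} (ha : HasLog K fun z => z - a)
    (h : ∀ z ∈ K, ‖b - a‖ < ‖z - a‖) : HasLog K fun z => z - b := by
  have hne : ∀ z ∈ K, z - a ≠ 0 := fun z hz =>
    norm_pos_iff.1 ((norm_nonneg _).trans_lt (h z hz))
  have h1 : PolyApprox K fun z => 1 - (b - a) * (z - a)⁻¹ :=
    (const 1).sub hK ((const (b - a)).mul hK (ha.polyApprox_inv hK))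
  refine (ha.mul (hasLog_of_near_one hK h1 fun z hz => ?_)).congr fun z hz => ?_
  · have := h z hz
    rw [sub_sub_cancel_left, norm_neg, norm_mul, norm_inv, ← div_eq_mul_inv, div_lt_one]
    · exact this
    · exact norm_pos_iff.2 (hne z hz)
  · have := hne z hz
    field_simp
    ring

theorem hasLog_sub (hK : IsCompact K) (hKc : IsPreconnected Kᶜ) {b : ℂ} (hb : b ∉ K) :
    HasLog K fun z => z - b := by
  obtain ⟨M, hM0, hM⟩ := (id (K := K)).exists_norm_le hK
  have hfar : HasLog K fun z => z - ((M + 1 : ℝ) : ℂ) := by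
    have hne : ((M + 1 : ℝ) : ℂ) ≠ 0 := by exact_mod_cast (by linarith : M + 1 ≠ 0)
    have h1 : PolyApprox K fun z => 1 - z * ((M + 1 : ℝ) : ℂ)⁻¹ :=
      (const 1).sub hK (id.mul hK (const _))
    refine ((hasLog_const (neg_ne_zero.2 hne)).mul
      (hasLog_of_near_one hK h1 fun z hz => ?_)).congr fun z hz => ?_
    · have := hM z hz
      rw [sub_sub_cancel_left, norm_neg, norm_mul, norm_inv, ← div_eq_mul_inv, norm_real,
        Real.norm_of_nonneg (by linarith), div_lt_one (by linarith)]
      linarith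
    · field_simp
      ring
  have hfarK : ((M + 1 : ℝ) : ℂ) ∈ Kᶜ := fun h => by
    have := hM _ h
    rw [norm_real, Real.norm_of_nonneg (by linarith)] at this
    linarith
  refine hKc.induction₂ (fun a b => HasLog K (fun z => z - a) ↔ HasLog K (fun z => z - b))
    ?_ (fun x y z _ _ _ h h' => h.trans h') (fun x y _ _ h => h.symm) hfarK hb |>.1 hfar
  intro x hx
  obtain ⟨ε, hε, hball⟩ := Metric.isOpen_iff.1 hK.isClosed.isOpen_compl x hx
  have hd : ∀ z ∈ K, ε ≤ ‖z - x‖ := fun z hz => by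
    by_contra! h
    exact hball (by rwa [mem_ball_iff_norm]) hz
  filter_upwards [mem_nhdsWithin_of_mem_nhds (Metric.ball_mem_nhds x (half_pos hε))] with y hy
  rw [mem_ball_iff_norm] at hy
  constructor
  · intro h
    exact h.sub_of_near hK fun z hz => by linarith [hd z hz]
  · intro h
    refine h.sub_of_near hK fun z hz => ?_
    have h1 := norm_add_le (z - y) (y - x)
    rw [sub_add_sub_cancel] at h1
    rw [norm_sub_rev]
    linarith [hd z hz]

theorem hasLog_polynomial (hK : IsCompact K) (hKc : IsPreconnected Kᶜ) (p : Polynomial ℂ)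
    (hp : ∀ z ∈ K, p.eval z ≠ 0) (hne : K.Nonempty) : HasLog K fun z => p.eval z := by
  induction h : p.natDegree generalizing p with
  | zero =>
    rw [Polynomial.natDegree_eq_zero] at h
    obtain ⟨c, rfl⟩ := h
    obtain ⟨z, hz⟩ := hne
    simpa using hasLog_const (K := K) (by simpa using hp z hz)
  | succ n ih =>
    obtain ⟨a, ha⟩ := IsAlgClosed.exists_root p (fun h0 => by
      rw [Polynomial.degree_eq_natDegree (by rintro rfl; simp at h), h] at h0
      exact absurd h0 (by exact_mod_cast Nat.succ_ne_zero n))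
    obtain ⟨q, rfl⟩ := Polynomial.dvd_iff_isRoot.2 ha
    have hq0 : q ≠ 0 := by rintro rfl; simp at h
    have hd : q.natDegree = n := by
      rw [Polynomial.natDegree_mul (Polynomial.X_sub_C_ne_zero a) hq0,
        Polynomial.natDegree_X_sub_C] at h
      omega
    have haK : a ∉ K := fun haK => hp a haK (by simp)
    refine ((hasLog_sub hK hKc haK).mul (ih q (fun z hz h0 => hp z hz (by simp [h0])) hd)).congr
      fun z _ => by simp

theorem hasLog (hK : IsCompact K) (hKc : IsPreconnected Kᶜ) (hne : K.Nonempty)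
    (hf : PolyApprox K f) (h0 : ∀ z ∈ K, f z ≠ 0) : HasLog K f := by
  obtain ⟨z0, hz0, hmin⟩ := hK.exists_isMinOn hne hf.continuousOn.norm
  have hm : 0 < ‖f z0‖ := norm_pos_iff.2 (h0 z0 hz0)
  obtain ⟨p, hp⟩ := hf (‖f z0‖ / 3) (by positivity)
  have hpz : ∀ z ∈ K, ‖f z0‖ / 3 < ‖p.eval z‖ := fun z hz => by
    have h1 : ‖f z0‖ ≤ ‖f z‖ := hmin hz
    have h2 := norm_sub_norm_le (f z) (p.eval z)
    linarith [hp z hz]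
  have hpne : ∀ z ∈ K, p.eval z ≠ 0 := fun z hz =>
    norm_pos_iff.1 (lt_trans (by positivity) (hpz z hz))
  have hlp := hasLog_polynomial hK hKc p hpne hne
  have h1 : PolyApprox K fun z => f z * (p.eval z)⁻¹ := hf.mul hK (hlp.polyApprox_inv hK)
  refine (hlp.mul (hasLog_of_near_one hK h1 fun z hz => ?_)).congr fun z hz => ?_
  · have hne := hpne z hz
    have : f z * (p.eval z)⁻¹ - 1 = (f z - p.eval z) / p.eval z := by field_simp
    rw [this, norm_div, div_lt_one (norm_pos_iff.2 hne)]
    exact (hp z hz).trans_lt (hpz z hz)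
  · have hne := hpne z hz
    field_simp

end PolyApprox

/-! ### Domains without holes and the Riemann mapping theorem -/

/-- A domain of the plane whose complement has no bounded component. -/
structure HoleFree (U : Set ℂ) : Prop where
  isOpen : IsOpen U
  isPreconnected : IsPreconnected U
  unbounded : ∀ z ∉ U, ∃ C ⊆ Uᶜ, z ∈ C ∧ IsPreconnected C ∧ ¬ IsBounded C

/-- A compact connected subset of `U` containing `p` which does not separate the plane. -/
structure Filled (U : Set ℂ) (p : ℂ) (K : Set ℂ) : Prop where
  isCompact : IsCompact K
  isPreconnected : IsPreconnected K
  mem : p ∈ K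
  subset : K ⊆ U
  compl : IsPreconnected Kᶜ

theorem isPreconnected_norm_gt (R : ℝ) : IsPreconnected {z : ℂ | R < ‖z‖} := by
  have : {z : ℂ | R < ‖z‖} = (fun x : ℝ × ℝ => (x.1 : ℂ) * exp (x.2 * I)) '' (Ioi R ×ˢ univ) := by
    ext z
    constructor
    · intro hz
      exact ⟨(‖z‖, arg z), ⟨hz, mem_univ _⟩, norm_mul_exp_arg_mul_I z⟩
    · rintro ⟨⟨r, θ⟩, ⟨hr, -⟩, rfl⟩
      have hr : R < r := hr
      simp only [mem_ofPred_eq, norm_mul, norm_exp_ofReal_mul_I, mul_one, norm_real,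
        Real.norm_eq_abs]
      exact hr.trans_le (le_abs_self r)
  rw [this]
  exact (isPreconnected_Ioi.prod isPreconnected_univ).image _ (by fun_prop)

namespace HoleFree

variable {U : Set ℂ} {p : ℂ}

theorem exists_filled (hU : HoleFree U) {K₀ : Set ℂ} (hK : IsCompact K₀)
    (hKc : IsPreconnected K₀) (hp : p ∈ K₀) (hKU : K₀ ⊆ U) : ∃ K, Filled U p K ∧ K₀ ⊆ K := by
  obtain ⟨R, hR⟩ : ∃ R, ∀ z ∈ K₀, ‖z‖ ≤ R := hK.isBounded.exists_norm_le
  have hO : IsOpen K₀ᶜ := hK.isClosed.isOpen_compl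
  have hsub : {z : ℂ | R < ‖z‖} ⊆ K₀ᶜ := fun z hz h => absurd (hR z h) (not_le.2 hz)
  set e : ℂ := ((R + 1 : ℝ) : ℂ)
  have he : e ∈ {z : ℂ | R < ‖z‖} := by
    simp only [e, mem_ofPred_eq, norm_real, Real.norm_eq_abs]
    exact (lt_add_one R).trans_le (le_abs_self _)
  have hW : IsComponent K₀ᶜ (connectedComponentIn K₀ᶜ e) := ⟨e, hsub he, rfl⟩
  set W := connectedComponentIn K₀ᶜ e
  have heW : e ∈ W := mem_connectedComponentIn (hsub he)
  have hfar : {z : ℂ | R < ‖z‖} ⊆ W :=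
    hW.subset_of_isPreconnected (isPreconnected_norm_gt R) hsub heW he
  have hcl : IsClosed Wᶜ := (hW.isOpen hO).isClosed_compl
  have hK₀W : K₀ ⊆ Wᶜ := fun z hz hzW => hW.subset hzW hz
  have hbd : Wᶜ ⊆ Metric.closedBall 0 R := fun z hz => by
    rw [mem_closedBall_zero_iff]
    by_contra! h
    exact hz (hfar h)
  refine ⟨Wᶜ, ⟨?_, ?_, hK₀W hp, ?_, ?_⟩, hK₀W⟩
  · exact (isCompact_closedBall 0 R).of_isClosed_subset hcl hbd
  · refine isPreconnected_of_forall p fun z hz => ?_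
    by_cases hzK : z ∈ K₀
    · exact ⟨K₀, hK₀W, hp, hzK, hKc⟩
    have hV : IsComponent K₀ᶜ (connectedComponentIn K₀ᶜ z) := ⟨z, hzK, rfl⟩
    set V := connectedComponentIn K₀ᶜ z
    have hzV : z ∈ V := mem_connectedComponentIn hzK
    have hVW : V ⊆ Wᶜ := fun w hw hwW => hz (hV.eq_of_mem hW hw hwW ▸ hzV)
    have hVne : V ≠ univ := fun h => hVW (h ▸ mem_univ e) heW
    obtain ⟨w, hw⟩ := nonempty_frontier_iff.2 ⟨⟨z, hzV⟩, hVne⟩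
    have hwK : w ∈ K₀ := by simpa using hV.frontier_subset hO hw
    refine ⟨K₀ ∪ closure V, union_subset hK₀W ?_, Or.inl hp, Or.inr (subset_closure hzV), ?_⟩
    · exact closure_minimal hVW hcl
    · exact IsPreconnected.union w hwK hw.1 hKc hV.isPreconnected.closure
  · intro z hz
    by_contra hzU
    obtain ⟨C, hCU, hzC, hC, hCb⟩ := hU.unbounded z hzU
    obtain ⟨w, hwC, hw⟩ : ∃ w ∈ C, R < ‖w‖ := by
      by_contra! h
      exact hCb (isBounded_iff_forall_norm_le.2 ⟨R, h⟩)
    exact hz (hW.subset_of_isPreconnected hC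
      (fun y hy hyK => hCU hy (hKU hyK)) (hfar hw) hwC hzC)
  · rw [compl_compl]
    exact hW.isPreconnected

theorem exists_filled_nhds (hU : HoleFree U) (hp : p ∈ U) {z : ℂ} (hz : z ∈ U) :
    ∃ K, Filled U p K ∧ K ∈ 𝓝 z := by
  have hpc : IsPathConnected U := hU.isOpen.isConnected_iff_isPathConnected.1
    ⟨⟨p, hp⟩, hU.isPreconnected⟩
  obtain ⟨γ, hγ⟩ := hpc.joinedIn p hp z hz
  obtain ⟨r, hr, hrU⟩ := Metric.nhds_basis_closedBall.mem_iff.1 (hU.isOpen.mem_nhds hz)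
  have hzr : z ∈ range γ := ⟨1, γ.target⟩
  obtain ⟨K, hK, hsub⟩ := hU.exists_filled (p := p) (K₀ := range γ ∪ Metric.closedBall z r)
    ((isCompact_range γ.continuous).union (isCompact_closedBall z r))
    (IsPreconnected.union z hzr (Metric.mem_closedBall_self hr.le)
      (isPreconnected_range γ.continuous) (convex_closedBall z r).isPreconnected)
    (Or.inl ⟨0, γ.source⟩) (union_subset (range_subset_iff.2 hγ) hrU)
  exact ⟨K, hK, mem_of_superset (Metric.closedBall_mem_nhds z hr) (subset_union_right.trans hsub)⟩

end HoleFree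

/-- `f` is a limit of polynomials, uniformly on filled compact subsets of `U`. -/
def Runge (U : Set ℂ) (p : ℂ) (f : ℂ → ℂ) : Prop := ∀ K, Filled U p K → PolyApprox K f

namespace Runge

variable {U : Set ℂ} {p : ℂ} {f g : ℂ → ℂ}

theorem const (c : ℂ) : Runge U p fun _ => c := fun _ _ => .const c
theorem id : Runge U p fun z => z := fun _ _ => .id
theorem add (hf : Runge U p f) (hg : Runge U p g) : Runge U p fun z => f z + g z :=
  fun K hK => (hf K hK).add (hg K hK)
theorem sub (hf : Runge U p f) (hg : Runge U p g) : Runge U p fun z => f z - g z :=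
  fun K hK => (hf K hK).sub hK.isCompact (hg K hK)
theorem mul (hf : Runge U p f) (hg : Runge U p g) : Runge U p fun z => f z * g z :=
  fun K hK => (hf K hK).mul hK.isCompact (hg K hK)
theorem exp (hf : Runge U p f) : Runge U p fun z => exp (f z) :=
  fun K hK => (hf K hK).exp hK.isCompact

theorem inv (hf : Runge U p f) (h0 : ∀ z ∈ U, f z ≠ 0) : Runge U p fun z => (f z)⁻¹ :=
  fun K hK => (PolyApprox.hasLog hK.isCompact hK.compl ⟨p, hK.mem⟩ (hf K hK)
    fun z hz => h0 z (hK.subset hz)).polyApprox_inv hK.isCompact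

theorem differentiableOn (hU : HoleFree U) (hp : p ∈ U) (hf : Runge U p f) :
    DifferentiableOn ℂ f U := by
  intro z hz
  obtain ⟨K, hK, hKz⟩ := hU.exists_filled_nhds hp hz
  have hd : DifferentiableOn ℂ f (interior K) := by
    choose q hq using fun n : ℕ => hf K hK (1 / ((n : ℝ) + 1)) Nat.one_div_pos_of_nat
    have : TendstoUniformlyOn (fun n z => (q n).eval z) f atTop K := by
      rw [Metric.tendstoUniformlyOn_iff]
      intro ε hε
      obtain ⟨N, hN⟩ := exists_nat_one_div_lt hε
      filter_upwards [eventually_ge_atTop N] with n hn z hz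
      rw [dist_eq_norm]
      refine (hq n z hz).trans_lt (lt_of_le_of_lt ?_ hN)
      gcongr
    exact (this.mono interior_subset).tendstoLocallyUniformlyOn.differentiableOn
      (Eventually.of_forall fun n => (q n).differentiable.differentiableOn) isOpen_interior
  exact (hd.differentiableAt (isOpen_interior.mem_nhds
    (mem_interior_iff_mem_nhds.2 hKz))).differentiableWithinAt

theorem exists_log (hU : HoleFree U) (hp : p ∈ U) (hf : Runge U p f) (h0 : ∀ z ∈ U, f z ≠ 0) :
    ∃ g, Runge U p g ∧ ∀ z ∈ U, Complex.exp (g z) = f z := by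
  classical
  have hloc : ∀ K, Filled U p K → ∃ g, PolyApprox K g ∧ (∀ z ∈ K, Complex.exp (g z) = f z) ∧
      g p = log (f p) := by
    intro K hK
    obtain ⟨g, hg, hge⟩ := PolyApprox.hasLog hK.isCompact hK.compl ⟨p, hK.mem⟩ (hf K hK)
      fun z hz => h0 z (hK.subset hz)
    refine ⟨fun z => g z + (log (f p) - g p), hg.add (.const _), fun z hz => ?_, by ring⟩
    rw [exp_add, exp_sub, hge z hz, hge p hK.mem, exp_log (h0 p hp), div_self (h0 p hp), mul_one]
  choose! G hG1 hG2 hG3 using hloc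
  have huniq : ∀ K L, Filled U p K → Filled U p L → K ⊆ L → ∀ z ∈ K, G L z = G K z := by
    intro K L hK hL hKL z hz
    have := eqOn_const_of_exp_eq_one hK.isPreconnected (u := fun z => G L z - G K z)
      (((hG1 L hL).continuousOn.mono hKL).sub (hG1 K hK).continuousOn) (fun w hw => by
        rw [exp_sub, hG2 L hL w (hKL hw), hG2 K hK w hw, div_self (h0 w (hK.subset hw))])
      hz hK.mem
    simp only [hG3 K hK, hG3 L hL, sub_self] at this
    exact sub_eq_zero.1 this
  have hex : ∀ z ∈ U, ∃ K, Filled U p K ∧ z ∈ K := fun z hz => by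
    obtain ⟨K, hK, hKz⟩ := hU.exists_filled_nhds hp hz
    exact ⟨K, hK, mem_of_mem_nhds hKz⟩
  choose! κ hκ1 hκ2 using hex
  have key : ∀ K, Filled U p K → ∀ z ∈ K, G (κ z) z = G K z := by
    intro K hK z hz
    have hzU := hK.subset hz
    obtain ⟨L, hL, hsub⟩ := hU.exists_filled (hK.isCompact.union (hκ1 z hzU).isCompact)
      (IsPreconnected.union p hK.mem (hκ1 z hzU).mem hK.isPreconnected (hκ1 z hzU).isPreconnected)
      (Or.inl hK.mem) (union_subset hK.subset (hκ1 z hzU).subset)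
    rw [← huniq _ _ hK hL (subset_union_left.trans hsub) z hz,
      ← huniq _ _ (hκ1 z hzU) hL (subset_union_right.trans hsub) z (hκ2 z hzU)]
  exact ⟨fun z => G (κ z) z, fun K hK => (hG1 K hK).congr (key K hK),
    fun z hz => hG2 _ (hκ1 z hz) z (hκ2 z hz)⟩

theorem exists_sqrt (hU : HoleFree U) (hp : p ∈ U) (hf : Runge U p f) (h0 : ∀ z ∈ U, f z ≠ 0) :
    ∃ g, Runge U p g ∧ ∀ z ∈ U, g z ^ 2 = f z := by
  obtain ⟨l, hl, hle⟩ := hf.exists_log hU hp h0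
  refine ⟨_, ((const (1 / 2)).mul hl).exp, fun z hz => ?_⟩
  rw [← hle z hz, ← exp_nat_mul]
  congr 1
  push_cast
  ring

end Runge

/-- The disc automorphism sending `a` to `0`. -/
noncomputable def moebius (a w : ℂ) : ℂ := (w - a) * (1 - starRingEnd ℂ a * w)⁻¹

theorem one_sub_conj_mul_ne_zero {a w : ℂ} (ha : ‖a‖ < 1) (hw : ‖w‖ < 1) :
    1 - starRingEnd ℂ a * w ≠ 0 := by
  intro h
  have h1 : ‖starRingEnd ℂ a * w‖ = 1 := by rw [← sub_eq_zero.1 h, norm_one]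
  rw [norm_mul, RCLike.norm_conj] at h1
  nlinarith [norm_nonneg a, norm_nonneg w]

theorem norm_moebius_lt {a w : ℂ} (ha : ‖a‖ < 1) (hw : ‖w‖ < 1) : ‖moebius a w‖ < 1 := by
  have h0 := one_sub_conj_mul_ne_zero ha hw
  rw [moebius, norm_mul, norm_inv, ← div_eq_mul_inv, div_lt_one (norm_pos_iff.2 h0)]
  refine lt_of_pow_lt_pow_left₀ 2 (norm_nonneg _) ?_
  have ha2 : ‖a‖ ^ 2 < 1 := by nlinarith [norm_nonneg a]
  have hw2 : ‖w‖ ^ 2 < 1 := by nlinarith [norm_nonneg w]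
  rw [← normSq_eq_norm_sq, normSq_apply] at ha2 hw2 ⊢
  rw [← normSq_eq_norm_sq, normSq_apply]
  simp only [sub_re, sub_im, one_re, one_im, mul_re, mul_im, conj_re, conj_im]
  nlinarith [mul_pos (sub_pos.2 ha2) (sub_pos.2 hw2)]

theorem moebius_injOn {a : ℂ} (ha : ‖a‖ < 1) : InjOn (moebius a) (Metric.ball 0 1) := by
  intro w hw w' hw' h
  rw [mem_ball_zero_iff] at hw hw'
  have h1 := one_sub_conj_mul_ne_zero ha hw
  have h2 := one_sub_conj_mul_ne_zero ha hw'
  simp only [moebius, ← div_eq_mul_inv] at h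
  rw [div_eq_div_iff h1 h2] at h
  have h3 : (1 - starRingEnd ℂ a * a) * (w - w') = 0 := by linear_combination h
  rcases mul_eq_zero.1 h3 with h4 | h4
  · exact absurd h4 (one_sub_conj_mul_ne_zero ha ha)
  · exact sub_eq_zero.1 h4

theorem hasDerivAt_moebius {a w : ℂ} (ha : ‖a‖ < 1) (hw : ‖w‖ < 1) :
    HasDerivAt (moebius a) ((1 - starRingEnd ℂ a * a) / (1 - starRingEnd ℂ a * w) ^ 2) w := by
  have h0 := one_sub_conj_mul_ne_zero ha hw
  have h1 : HasDerivAt (fun w => w - a) 1 w := (hasDerivAt_id w).sub_const a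
  have h2 : HasDerivAt (fun w => 1 - starRingEnd ℂ a * w) (-(starRingEnd ℂ a)) w := by
    simpa using ((hasDerivAt_id w).const_mul (starRingEnd ℂ a)).const_sub 1
  have h3 : HasDerivAt (moebius a) _ w := h1.fun_mul (h2.fun_inv h0)
  refine h3.congr_deriv ?_
  field_simp
  ring

/-- The limit of injective holomorphic functions is constant or injective. -/
theorem injOn_of_tendstoLocallyUniformlyOn {U : Set ℂ} (hU : IsOpen U) (hUc : IsPreconnected U)
    {F : ℕ → ℂ → ℂ} {f : ℂ → ℂ} {l : Filter ℕ} [l.NeBot]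
    (hF : ∀ n, DifferentiableOn ℂ (F n) U) (hinj : ∀ n, InjOn (F n) U)
    (hlim : TendstoLocallyUniformlyOn F f l U) {p : ℂ} (hp : p ∈ U) (hd : deriv f p ≠ 0) :
    InjOn f U := by
  have hfd : DifferentiableOn ℂ f U := hlim.differentiableOn (Eventually.of_forall hF) hU
  have hfa : AnalyticOnNhd ℂ f U := hfd.analyticOnNhd hU
  intro z1 hz1 z2 hz2 h12
  by_contra hne
  have hev : ∀ᶠ z in 𝓝[≠] z2, f z - f z1 ≠ 0 := by
    have ha : AnalyticAt ℂ (fun z => f z - f z1) z2 := (hfa z2 hz2).sub analyticAt_const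
    rcases ha.eventually_eq_zero_or_eventually_ne_zero with h | h
    · exfalso
      have he : EqOn f (fun _ => f z1) U := by
        refine hfa.eqOn_of_preconnected_of_eventuallyEq analyticOnNhd_const hUc hz2 ?_
        filter_upwards [h] with z hz using sub_eq_zero.1 hz
      refine hd ?_
      have : f =ᶠ[𝓝 p] fun _ => f z1 := by
        filter_upwards [hU.mem_nhds hp] with z hz using he hz
      rw [this.deriv_eq]
      simp
    · exact h
  rw [eventually_nhdsWithin_iff] at hev
  have hev2 : ∀ᶠ z in 𝓝 z2, z ∈ U ∧ z ≠ z1 ∧ (z ≠ z2 → f z - f z1 ≠ 0) :=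
    (hU.eventually_mem hz2).and ((isOpen_ne.eventually_mem (Ne.symm hne)).and hev)
  obtain ⟨r, hr, hball⟩ := Metric.nhds_basis_closedBall.eventually_iff.1 hev2
  have hBU : Metric.closedBall z2 r ⊆ U := fun z hz => (hball hz).1
  have hsne : (Metric.sphere z2 r).Nonempty := NormedSpace.sphere_nonempty.2 hr.le
  have hfc : ContinuousOn (fun z => ‖f z - f z1‖) (Metric.sphere z2 r) :=
    ((hfd.continuousOn.mono (Metric.sphere_subset_closedBall.trans hBU)).sub
      continuousOn_const).norm
  obtain ⟨z0, hz0, hmin⟩ := (isCompact_sphere z2 r).exists_isMinOn hsne hfc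
  set m := ‖f z0 - f z1‖ with hm
  have hm0 : 0 < m := norm_pos_iff.2 ((hball (Metric.sphere_subset_closedBall hz0)).2.2
    (ne_of_mem_of_not_mem hz0 (by simp [hr.ne])))
  have hK : IsCompact (insert z1 (Metric.closedBall z2 r)) := (isCompact_closedBall z2 r).insert z1
  have hu := (tendstoLocallyUniformlyOn_iff_forall_isCompact hU).1 hlim _
    (insert_subset hz1 hBU) hK
  rw [Metric.tendstoUniformlyOn_iff] at hu
  obtain ⟨n, hn⟩ := (hu (m / 6) (by positivity)).exists
  have hn1 := hn z1 (mem_insert _ _)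
  rw [dist_eq_norm] at hn1
  have hdiff : ∀ z ∈ Metric.closedBall z2 r,
      ‖(f z - f z1) - (F n z - F n z1)‖ ≤ m / 3 := fun z hz => by
    have h2 := hn z (mem_insert_of_mem _ hz)
    rw [dist_eq_norm] at h2
    have : (f z - f z1) - (F n z - F n z1) = (f z - F n z) - (f z1 - F n z1) := by ring
    rw [this]
    exact (norm_sub_le _ _).trans (by linarith)
  have hne0 : ∀ z ∈ Metric.closedBall z2 r, F n z - F n z1 ≠ 0 := fun z hz h =>
    (hball hz).2.1 (hinj n (hBU hz) hz1 (sub_eq_zero.1 h))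
  have hg : DifferentiableOn ℂ (fun z => (F n z - F n z1)⁻¹) (Metric.closedBall z2 r) :=
    (((hF n).mono hBU).sub_const _).inv hne0
  have hle := norm_le_of_forall_mem_frontier_norm_le (Metric.isBounded_ball (x := z2) (r := r))
    (hg.diffContOnCl_ball subset_rfl) (C := 3 / (2 * m)) (fun z hz => by
      have hz := Metric.frontier_ball_subset_sphere hz
      have h1 : m ≤ ‖f z - f z1‖ := hmin hz
      have h2 := hdiff z (Metric.sphere_subset_closedBall hz)
      have h3 := norm_sub_norm_le (f z - f z1) (F n z - F n z1)
      have h4 : 2 * m / 3 ≤ ‖F n z - F n z1‖ := by linarith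
      rw [norm_inv, inv_le_comm₀ (by linarith) (by positivity)]
      refine le_trans (le_of_eq ?_) h4
      field_simp) (subset_closure (Metric.mem_ball_self hr))
  have h5 := hdiff z2 (Metric.mem_closedBall_self hr.le)
  rw [← h12, sub_self, zero_sub, norm_neg] at h5
  have h6 : 0 < ‖F n z2 - F n z1‖ := norm_pos_iff.2 (hne0 z2 (Metric.mem_closedBall_self hr.le))
  rw [norm_inv, inv_le_comm₀ h6 (by positivity)] at hle
  have h7 : (3 / (2 * m))⁻¹ = 2 * m / 3 := by field_simp
  rw [h7] at hle
  linarith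

/-- Montel's theorem for functions with values in the unit disc. -/
theorem exists_tendstoLocallyUniformlyOn {U : Set ℂ} (hU : IsOpen U) {F : ℕ → ℂ → ℂ}
    (hF : ∀ n, DifferentiableOn ℂ (F n) U) (hb : ∀ n, ∀ z ∈ U, ‖F n z‖ ≤ 1) :
    ∃ f, TendstoLocallyUniformlyOn F f (hyperfilter ℕ : Filter ℕ) U := by
  have hex : ∀ z ∈ U, ∃ w, Tendsto (fun n => F n z) (hyperfilter ℕ : Filter ℕ) (𝓝 w) := by
    intro z hz
    obtain ⟨w, -, hw⟩ := (isCompact_closedBall (0 : ℂ) 1).ultrafilter_le_nhds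
      ((hyperfilter ℕ).map fun n => F n z) (le_principal_iff.2 (by
        rw [Ultrafilter.coe_map]
        exact mem_map.2 (univ_mem' fun n => by simpa using hb n z hz)))
    exact ⟨w, hw⟩
  choose! f hf using hex
  refine ⟨f, ?_⟩
  rw [Metric.tendstoLocallyUniformlyOn_iff]
  intro ε hε z hz
  obtain ⟨r, hr, hrU⟩ := Metric.isOpen_iff.1 hU z hz
  have hlip : ∀ n, ∀ x ∈ Metric.ball z r, dist (F n x) (F n z) ≤ 2 / r * dist x z :=
    fun n x hx => dist_le_div_mul_dist_of_mapsTo_ball ((hF n).mono hrU) (fun y hy => by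
      rw [Metric.mem_closedBall, dist_eq_norm]
      exact (norm_sub_le _ _).trans (by linarith [hb n y (hrU hy), hb n z hz])) hx
  have hlip' : ∀ x ∈ Metric.ball z r, dist (f x) (f z) ≤ 2 / r * dist x z := fun x hx =>
    le_of_tendsto ((hf x (hrU hx)).dist (hf z hz)) (Eventually.of_forall fun n => hlip n x hx)
  set η := min r (ε * r / 8)
  have hη : 0 < η := lt_min hr (by positivity)
  refine ⟨Metric.ball z η, mem_nhdsWithin_of_mem_nhds (Metric.ball_mem_nhds z hη), ?_⟩
  filter_upwards [Metric.tendsto_nhds.1 (hf z hz) (ε / 4) (by positivity)] with n hn x hx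
  have hxr : x ∈ Metric.ball z r := Metric.ball_subset_ball (min_le_left _ _) hx
  have hd : 2 / r * dist x z ≤ ε / 4 := by
    have h1 : dist x z ≤ ε * r / 8 := (le_of_lt hx).trans (min_le_right _ _)
    calc 2 / r * dist x z ≤ 2 / r * (ε * r / 8) := by gcongr
      _ = ε / 4 := by field_simp; norm_num
  calc dist (f x) (F n x) ≤ dist (f x) (f z) + dist (f z) (F n z) + dist (F n z) (F n x) :=
        dist_triangle4 _ _ _ _
    _ ≤ ε / 4 + ε / 4 + ε / 4 := by
        refine add_le_add (add_le_add ((hlip' x hxr).trans hd) ?_) ?_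
        · rw [dist_comm]; exact hn.le
        · rw [dist_comm]; exact (hlip n x hxr).trans hd
    _ < ε := by linarith

/-- Competitors in the extremal problem of the Riemann mapping theorem. -/
structure DiscMap (U : Set ℂ) (p : ℂ) (f : ℂ → ℂ) : Prop where
  runge : Runge U p f
  injOn : InjOn f U
  norm_lt : ∀ z ∈ U, ‖f z‖ < 1
  map_zero : f p = 0

theorem Runge.moebius {U : Set ℂ} {p a : ℂ} {f : ℂ → ℂ} (hf : Runge U p f) (ha : ‖a‖ < 1)
    (hb : ∀ z ∈ U, ‖f z‖ < 1) : Runge U p fun z => moebius a (f z) :=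
  (hf.sub (.const a)).mul (((Runge.const 1).sub ((Runge.const _).mul hf)).inv
    fun z hz => one_sub_conj_mul_ne_zero ha (hb z hz))

theorem exists_discMap {U : Set ℂ} {p a : ℂ} (hU : HoleFree U) (hp : p ∈ U) (ha : a ∉ U) :
    ∃ f, DiscMap U p f ∧ deriv f p ≠ 0 := by
  obtain ⟨q, hq, hq2⟩ := (Runge.id.sub (.const a) : Runge U p fun z => z - a).exists_sqrt hU hp
    fun z hz h => ha (by rwa [← sub_eq_zero.1 h])
  have hqd := (hq.differentiableOn hU hp).differentiableAt (hU.isOpen.mem_nhds hp)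
  have hder : 2 * q p * deriv q p = 1 := by
    have h1 : HasDerivAt (fun z => q z ^ 2) (2 * q p * deriv q p) p := by
      simpa using hqd.hasDerivAt.fun_pow 2
    have h2 : HasDerivAt (fun z => q z ^ 2) 1 p := by
      refine ((hasDerivAt_id p).sub_const a).congr_of_eventuallyEq ?_
      filter_upwards [hU.isOpen.mem_nhds hp] with z hz using hq2 z hz
    exact h1.unique h2
  have hqp : q p ≠ 0 := fun h => by simp [h] at hder
  have hdq : deriv q p ≠ 0 := fun h => by simp [h] at hder
  have hinj : ∀ z ∈ U, ∀ w ∈ U, q z ^ 2 = q w ^ 2 → z = w := fun z hz w hw h => by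
    rw [hq2 z hz, hq2 w hw] at h
    exact sub_left_injective h
  have hqa : AnalyticAt ℂ q p := (hq.differentiableOn hU hp).analyticAt (hU.isOpen.mem_nhds hp)
  have hmap : map q (𝓝 p) = 𝓝 (q p) := hqa.hasStrictDerivAt.map_nhds_eq hdq
  obtain ⟨r, hr, hball⟩ := Metric.mem_nhds_iff.1
    (hmap ▸ image_mem_map (hU.isOpen.mem_nhds hp) : q '' U ∈ 𝓝 (q p))
  have hfar : ∀ z ∈ U, r ≤ ‖q z + q p‖ := fun z hz => by
    by_contra! h
    obtain ⟨w, hw, hwz⟩ := hball (show -q z ∈ Metric.ball (q p) r by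
      rw [mem_ball_iff_norm, ← norm_neg, show -(-q z - q p) = q z + q p by ring]; exact h)
    have hzw : z = w := hinj z hz w hw (by rw [hwz]; ring)
    subst hzw
    have : q z = 0 := by linear_combination (1 / 2) * hwz
    have h2 := hq2 z hz
    rw [this] at h2
    exact ha (by rw [← sub_eq_zero.1 (show z - a = 0 by rw [← h2]; ring)]; exact hz)
  have hne : ∀ z ∈ U, q z + q p ≠ 0 := fun z hz => norm_pos_iff.1 (hr.trans_le (hfar z hz))
  have hinvle : ∀ z ∈ U, ‖(q z + q p)⁻¹‖ ≤ 1 / r := fun z hz => by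
    rw [norm_inv, ← one_div]
    exact one_div_le_one_div_of_le hr (hfar z hz)
  have hr3 : ((r / 3 : ℝ) : ℂ) ≠ 0 := by exact_mod_cast (by positivity : r / 3 ≠ 0)
  refine ⟨fun z => ((r / 3 : ℝ) : ℂ) * ((q z + q p)⁻¹ - (q p + q p)⁻¹), ⟨?_, ?_, ?_, by simp⟩, ?_⟩
  · exact (Runge.const _).mul (((hq.add (.const _)).inv hne).sub (.const _))
  · intro z hz w hw h
    have h1 := sub_left_injective (mul_left_cancel₀ hr3 h)
    have h2 : q z = q w := add_right_cancel (inv_injective h1)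
    exact hinj z hz w hw (by rw [h2])
  · intro z hz
    rw [norm_mul, norm_real, Real.norm_of_nonneg (by positivity)]
    calc r / 3 * ‖(q z + q p)⁻¹ - (q p + q p)⁻¹‖ ≤ r / 3 * (1 / r + 1 / r) := by
          gcongr
          exact (norm_sub_le _ _).trans (add_le_add (hinvle z hz) (hinvle p hp))
      _ = 2 / 3 := by field_simp; norm_num
      _ < 1 := by norm_num
  · have h1 := (((hqd.hasDerivAt.add_const (q p)).inv (hne p hp)).sub_const
      (q p + q p)⁻¹).const_mul ((r / 3 : ℝ) : ℂ)
    have h2 := h1.deriv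
    intro h0
    rw [show (fun z => ((r / 3 : ℝ) : ℂ) * ((q z + q p)⁻¹ - (q p + q p)⁻¹)) = _ from rfl] at h0
    have h3 := h0.symm.trans h2
    exact mul_ne_zero hr3 (div_ne_zero (neg_ne_zero.2 hdq) (pow_ne_zero 2 (hne p hp))) h3.symm

/-- A competitor omitting a value of the disc can be improved. -/
theorem DiscMap.exists_lt_deriv {U : Set ℂ} {p a : ℂ} (hU : HoleFree U) (hp : p ∈ U) {f : ℂ → ℂ}
    (hf : DiscMap U p f) (hd : deriv f p ≠ 0) (ha : ‖a‖ < 1) (haf : ∀ z ∈ U, f z ≠ a) :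
    ∃ g, DiscMap U p g ∧ ‖deriv f p‖ < ‖deriv g p‖ := by
  have hfd := (hf.runge.differentiableOn hU hp).differentiableAt (hU.isOpen.mem_nhds hp)
  have hlt : ∀ z ∈ U, ‖moebius a (f z)‖ < 1 := fun z hz => norm_moebius_lt ha (hf.norm_lt z hz)
  obtain ⟨q, hq, hq2⟩ := (hf.runge.moebius ha hf.norm_lt).exists_sqrt hU hp fun z hz h => by
    rcases mul_eq_zero.1 h with h | h
    · exact haf z hz (sub_eq_zero.1 h)
    · exact one_sub_conj_mul_ne_zero ha (hf.norm_lt z hz) (inv_eq_zero.1 h)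
  have hqlt : ∀ z ∈ U, ‖q z‖ < 1 := fun z hz => by
    have := hlt z hz
    rw [← hq2 z hz, norm_pow] at this
    exact (pow_lt_one_iff_of_nonneg (norm_nonneg _) two_ne_zero).1 this
  have hqd := (hq.differentiableOn hU hp).differentiableAt (hU.isOpen.mem_nhds hp)
  set c := q p with hc
  have hc1 : ‖c‖ < 1 := hqlt p hp
  have hc2 : c ^ 2 = -a := by rw [hc, hq2 p hp, hf.map_zero]; simp [PlaneFlow.moebius]
  have hc0 : c ≠ 0 := fun h => haf p hp (by
    rw [hf.map_zero]
    rw [h] at hc2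
    have : a = 0 := by linear_combination hc2
    exact this.symm)
  refine ⟨fun z => moebius c (q z), ⟨hq.moebius hc1 hqlt, ?_, ?_, ?_⟩, ?_⟩
  · intro z hz w hw h
    have h1 := moebius_injOn hc1 (by simpa using hqlt z hz) (by simpa using hqlt w hw) h
    have h2 : moebius a (f z) = moebius a (f w) := by rw [← hq2 z hz, ← hq2 w hw, h1]
    exact hf.injOn hz hw (moebius_injOn ha (by simpa using hf.norm_lt z hz)
      (by simpa using hf.norm_lt w hw) h2)
  · exact fun z hz => norm_moebius_lt hc1 (hqlt z hz)
  · simp [PlaneFlow.moebius, ← hc]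
  · have h1 : HasDerivAt (fun z => q z ^ 2) (2 * c * deriv q p) p := by
      simpa [← hc] using hqd.hasDerivAt.fun_pow 2
    have h2 : HasDerivAt (fun z => q z ^ 2) ((1 - starRingEnd ℂ a * a) * deriv f p) p := by
      have h3 := (hasDerivAt_moebius ha (hf.norm_lt p hp)).comp p hfd.hasDerivAt
      rw [hf.map_zero, mul_zero, sub_zero, one_pow, div_one] at h3
      refine h3.congr_of_eventuallyEq ?_
      filter_upwards [hU.isOpen.mem_nhds hp] with z hz using hq2 z hz
    have h4 := h1.unique h2
    have h5 := ((hasDerivAt_moebius hc1 hc1).comp_of_eq p hqd.hasDerivAt hc.symm).deriv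
    have h6 : deriv (fun z => moebius c (q z)) p =
        (1 - starRingEnd ℂ c * c) / (1 - starRingEnd ℂ c * c) ^ 2 * deriv q p := h5
    rw [h6]
    have e1 : (1 - starRingEnd ℂ a * a) = ((1 - (‖c‖ ^ 2) ^ 2 : ℝ) : ℂ) := by
      have : a = -c ^ 2 := by rw [hc2, neg_neg]
      rw [← normSq_eq_conj_mul_self, this, normSq_neg, map_pow, normSq_eq_norm_sq]
      push_cast
      ring
    have e2 : (1 - starRingEnd ℂ c * c) = ((1 - ‖c‖ ^ 2 : ℝ) : ℂ) := by
      rw [← normSq_eq_conj_mul_self, normSq_eq_norm_sq]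
      push_cast
      ring
    have hcp : 0 < ‖c‖ := norm_pos_iff.2 hc0
    have hcs : 0 < 1 - ‖c‖ ^ 2 := by nlinarith
    have hdp : 0 < ‖deriv f p‖ := norm_pos_iff.2 hd
    have h7 : 2 * ‖c‖ * ‖deriv q p‖ = (1 - (‖c‖ ^ 2) ^ 2) * ‖deriv f p‖ := by
      have := congrArg norm h4
      rw [e1] at this
      simpa only [norm_mul, norm_ofNat, norm_real, Real.norm_of_nonneg
        (show 0 ≤ 1 - (‖c‖ ^ 2) ^ 2 by nlinarith)] using this
    rw [e2, norm_mul, norm_div, norm_pow, norm_real, Real.norm_of_nonneg hcs.le]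
    have h8 : (1 - ‖c‖ ^ 2) / (1 - ‖c‖ ^ 2) ^ 2 * ‖deriv q p‖ =
        (1 + ‖c‖ ^ 2) / (2 * ‖c‖) * ‖deriv f p‖ := by
      field_simp
      linear_combination h7
    rw [h8]
    refine lt_mul_of_one_lt_left hdp ?_
    rw [one_lt_div (by positivity)]
    nlinarith [sq_nonneg (1 - ‖c‖)]

/-- **Riemann mapping theorem** for domains without holes. -/
theorem exists_riemannMap {U : Set ℂ} (hU : HoleFree U) {p : ℂ} (hp : p ∈ U) (hne : U ≠ univ) :
    ∃ f : ℂ → ℂ, DifferentiableOn ℂ f U ∧ InjOn f U ∧ f '' U = Metric.ball 0 1 := by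
  obtain ⟨a, ha⟩ := (ne_univ_iff_exists_notMem U).1 hne
  obtain ⟨f0, hf0, hd0⟩ := exists_discMap hU hp ha
  set S : Set ℝ := (fun f : ℂ → ℂ => ‖deriv f p‖) '' {f | DiscMap U p f} with hS
  obtain ⟨r, hr, hrU⟩ := Metric.isOpen_iff.1 hU.isOpen p hp
  have hbdd : BddAbove S := by
    refine ⟨1 / r, ?_⟩
    rintro _ ⟨f, hf, rfl⟩
    have hf : DiscMap U p f := hf
    refine norm_deriv_le_div_of_mapsTo_ball ((hf.runge.differentiableOn hU hp).mono hrU)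
      (fun z hz => ?_) hr
    rw [hf.map_zero, mem_closedBall_zero_iff]
    exact (hf.norm_lt z (hrU hz)).le
  have hSne : S.Nonempty := ⟨_, f0, hf0, rfl⟩
  obtain ⟨u, -, hu, huS⟩ := exists_seq_tendsto_sSup hSne hbdd
  choose F hF hFu using huS
  have hF : ∀ n, DiscMap U p (F n) := hF
  have hFd := fun n => (hF n).runge.differentiableOn hU hp
  obtain ⟨f, hf⟩ := exists_tendstoLocallyUniformlyOn hU.isOpen hFd
    fun n z hz => ((hF n).norm_lt z hz).le
  have hfd := hf.differentiableOn (Eventually.of_forall hFd) hU.isOpen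
  have hpt : ∀ z ∈ U, Tendsto (fun n => F n z) (hyperfilter ℕ : Filter ℕ) (𝓝 (f z)) :=
    fun z hz => hf.tendsto_at hz
  have hder : ‖deriv f p‖ = sSup S := by
    have h1 := ((hf.deriv (Eventually.of_forall hFd) hU.isOpen).tendsto_at hp).norm
    have h2 : Tendsto u (hyperfilter ℕ : Filter ℕ) (𝓝 (sSup S)) :=
      hu.mono_left (Nat.hyperfilter_le_atTop)
    refine tendsto_nhds_unique h1 (h2.congr fun n => ?_)
    exact (hFu n).symm
  have hpos : deriv f p ≠ 0 := by
    rw [← norm_pos_iff, hder]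
    exact (norm_pos_iff.2 hd0).trans_le (le_csSup hbdd ⟨f0, hf0, rfl⟩)
  have hinj := injOn_of_tendstoLocallyUniformlyOn hU.isOpen hU.isPreconnected hFd
    (fun n => (hF n).injOn) hf hp hpos
  have hf0 : f p = 0 := tendsto_nhds_unique (hpt p hp) (by simp [(hF _).map_zero])
  have hle : ∀ z ∈ U, ‖f z‖ ≤ 1 := fun z hz => le_of_tendsto (hpt z hz).norm
    (Eventually.of_forall fun n => ((hF n).norm_lt z hz).le)
  have hlt : ∀ z ∈ U, ‖f z‖ < 1 := fun z hz => by
    refine (hle z hz).lt_of_ne fun h1 => ?_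
    have := norm_eqOn_of_isPreconnected_of_isMaxOn hU.isPreconnected hU.isOpen hfd hz
      (fun w hw => by simpa [h1] using hle w hw) hp
    simp [hf0, h1] at this
  have hfG : DiscMap U p f := by
    refine ⟨fun K hK => ?_, hinj, hlt, hf0⟩
    have hu := (tendstoLocallyUniformlyOn_iff_forall_isCompact hU.isOpen).1 hf K hK.subset
      hK.isCompact
    rw [Metric.tendstoUniformlyOn_iff] at hu
    refine PolyApprox.of_forall_exists fun ε hε => ?_
    obtain ⟨n, hn⟩ := (hu ε hε).exists
    exact ⟨F n, (hF n).runge K hK, fun z hz => by rw [← dist_eq_norm]; exact (hn z hz).le⟩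
  refine ⟨f, hfd, hinj, Subset.antisymm ?_ ?_⟩
  · rintro _ ⟨z, hz, rfl⟩
    simpa using hlt z hz
  · intro b hb
    rw [mem_ball_zero_iff] at hb
    by_contra hcon
    obtain ⟨g, hg, hgd⟩ := hfG.exists_lt_deriv hU hp hpos hb fun z hz h => hcon ⟨z, hz, h⟩
    rw [hder] at hgd
    exact absurd (le_csSup hbdd ⟨g, hg, rfl⟩) (not_le.2 hgd)

section

open MeasureTheory

/-- The modulus of the derivative of `f` on `O`, extended by zero. -/
noncomputable def dnorm (f : ℂ → ℂ) (O : Set ℂ) (z : ℂ) : ℝ := O.indicator (fun z => ‖deriv f z‖) z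

theorem dnorm_nonneg (f : ℂ → ℂ) (O : Set ℂ) (z : ℂ) : 0 ≤ dnorm f O z :=
  indicator_nonneg (fun _ _ => norm_nonneg _) _

theorem measurable_dnorm (f : ℂ → ℂ) {O : Set ℂ} (hO : IsOpen O) : Measurable (dnorm f O) :=
  (measurable_deriv f).norm.indicator hO.measurableSet

theorem lintegral_dnorm_sq {f : ℂ → ℂ} {O : Set ℂ} (hO : IsOpen O) (hf : DifferentiableOn ℂ f O)
    (hinj : InjOn f O) : ∫⁻ z, ENNReal.ofReal (dnorm f O z ^ 2) = volume (f '' O) := by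
  have h := lintegral_abs_det_fderiv_eq_addHaar_image volume hO.measurableSet
    (f := f) (f' := fun z => (fderiv ℂ f z).restrictScalars ℝ) (fun z hz =>
      ((hf.differentiableAt (hO.mem_nhds hz)).hasFDerivAt.restrictScalars ℝ).hasFDerivWithinAt) hinj
  rw [← h, ← lintegral_indicator hO.measurableSet]
  refine lintegral_congr fun z => ?_
  by_cases hz : z ∈ O
  · simp only [dnorm, indicator_of_mem hz]
    have h1 : ((fderiv ℂ f z).restrictScalars ℝ).det = ‖deriv f z‖ ^ 2 := by
      have h2 : ((fderiv ℂ f z : ℂ →ₗ[ℂ] ℂ)) = LinearMap.toSpanSingleton ℂ ℂ (deriv f z) := by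
        ext; simp
      have h3 : LinearMap.det (LinearMap.toSpanSingleton ℂ ℂ (deriv f z)) = deriv f z := by
        simp [LinearMap.det_ring]
      rw [ContinuousLinearMap.det, ContinuousLinearMap.coe_restrictScalars,
        LinearMap.det_restrictScalars, h2, h3, Algebra.norm_complex_apply, normSq_eq_norm_sq]
    rw [h1, abs_of_nonneg (by positivity)]
  · simp [dnorm, indicator_of_notMem hz]

theorem exists_lintegral_circle_lt {n : ℂ → ℝ} (hn : Measurable n) (h0 : ∀ z, 0 ≤ n z)
    (hfin : ∫⁻ z, ENNReal.ofReal (n z ^ 2) ≠ ⊤) (c : ℂ) {ε r₀ : ℝ} (hε : 0 < ε) (hr₀ : 0 < r₀) :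
    ∃ r, 0 < r ∧ r < r₀ ∧ ∫⁻ θ in Ioo (-Real.pi) Real.pi,
      ENNReal.ofReal (r * n (circleMap c r θ)) < ENNReal.ofReal ε := by
  by_contra! hcon
  have hmeas : ∀ r : ℝ, Measurable fun θ : ℝ => n (circleMap c r θ) := fun r =>
    hn.comp (continuous_circleMap c r).measurable
  set A : ℝ → ENNReal := fun r => ∫⁻ θ in Ioo (-Real.pi) Real.pi,
    ENNReal.ofReal (r * n (circleMap c r θ) ^ 2)
  have hpol : ∫⁻ z, ENNReal.ofReal (n z ^ 2) = ∫⁻ r in Ioi 0, A r := by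
    rw [← lintegral_add_left_eq_self _ c, ← Complex.lintegral_comp_polarCoord_symm,
      polarCoord_target, Measure.volume_eq_prod, setLIntegral_prod]
    · refine setLIntegral_congr_fun measurableSet_Ioi fun r hr => ?_
      refine lintegral_congr fun θ => ?_
      have : c + Complex.polarCoord.symm (r, θ) = circleMap c r θ := by
        rw [Complex.polarCoord_symm_apply, circleMap, exp_mul_I, ofReal_cos, ofReal_sin]
      simp only [this, smul_eq_mul]
      rw [ENNReal.ofReal_mul (le_of_lt hr)]
    · refine Measurable.aemeasurable ?_
      refine (ENNReal.measurable_ofReal.comp measurable_fst).mul ?_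
      refine ENNReal.measurable_ofReal.comp ((hn.comp (measurable_const.add ?_)).pow_const 2)
      have : Continuous fun p : ℝ × ℝ => Complex.polarCoord.symm p := by
        simp only [Complex.polarCoord_symm_apply]
        fun_prop
      exact this.measurable
  set η : ℝ := ε / (4 * Real.pi) with hη
  have hπ := Real.pi_pos
  have hηp : 0 < η := by positivity
  have hle : ∀ r ∈ Ioo 0 r₀, ENNReal.ofReal (ε * η / 2 * r⁻¹) ≤ A r := by
    intro r hr
    have h1 := hcon r hr.1 hr.2
    have h2 : ∫⁻ θ in Ioo (-Real.pi) Real.pi, ENNReal.ofReal (r * n (circleMap c r θ)) ≤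
        ENNReal.ofReal (ε / 2) + ENNReal.ofReal (r / η) * A r := by
      have hm : Measurable fun θ : ℝ => ENNReal.ofReal (r * n (circleMap c r θ) ^ 2) :=
        ENNReal.measurable_ofReal.comp (((hmeas r).pow_const 2).const_mul r)
      have hAr : A r = ∫⁻ θ in Ioo (-Real.pi) Real.pi,
        ENNReal.ofReal (r * n (circleMap c r θ) ^ 2) := rfl
      rw [hAr, ← lintegral_const_mul _ hm]
      have h3 : ENNReal.ofReal (ε / 2) = ∫⁻ θ in Ioo (-Real.pi) Real.pi, ENNReal.ofReal η := by
        rw [setLIntegral_const, Real.volume_Ioo, ← ENNReal.ofReal_mul hηp.le]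
        congr 1
        rw [hη]
        field_simp
        ring
      rw [h3, ← lintegral_add_left measurable_const]
      refine lintegral_mono fun θ => ?_
      have hx := h0 (circleMap c r θ)
      set x := n (circleMap c r θ)
      rw [← ENNReal.ofReal_mul (by have := hr.1; positivity), ← ENNReal.ofReal_add hηp.le
        (by have := hr.1; positivity)]
      refine ENNReal.ofReal_le_ofReal ?_
      have h4 : r / η * (r * x ^ 2) = (r * x) ^ 2 / η := by ring
      rw [h4, ← sub_le_iff_le_add', le_div_iff₀ hηp]
      nlinarith [sq_nonneg (r * x - η)]
    have h5 : ENNReal.ofReal (ε / 2) ≤ ENNReal.ofReal (r / η) * A r := by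
      have h6 : ENNReal.ofReal ε = ENNReal.ofReal (ε / 2) + ENNReal.ofReal (ε / 2) := by
        rw [← ENNReal.ofReal_add (by positivity) (by positivity)]; congr 1; ring
      have h7 := h1.trans h2
      rw [h6] at h7
      exact (ENNReal.add_le_add_iff_left ENNReal.ofReal_ne_top).1 h7
    have hr1 := hr.1
    calc ENNReal.ofReal (ε * η / 2 * r⁻¹) = ENNReal.ofReal (η / r) * ENNReal.ofReal (ε / 2) := by
          rw [← ENNReal.ofReal_mul (by positivity)]; congr 1; field_simp
      _ ≤ ENNReal.ofReal (η / r) * (ENNReal.ofReal (r / η) * A r) := by gcongr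
      _ = A r := by
          rw [← mul_assoc, ← ENNReal.ofReal_mul (by positivity)]
          rw [show η / r * (r / η) = 1 by field_simp, ENNReal.ofReal_one, one_mul]
  have hlt : ∫⁻ r in Ioo 0 r₀, ENNReal.ofReal (ε * η / 2 * r⁻¹) < ⊤ := by
    refine lt_of_le_of_lt ?_ (lt_top_iff_ne_top.2 hfin)
    rw [hpol]
    refine (setLIntegral_mono' measurableSet_Ioo hle).trans ?_
    exact lintegral_mono_set fun r hr => hr.1
  have hker : IntegrableOn (fun r : ℝ => ε * η / 2 * r⁻¹) (Ioo 0 r₀) := by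
    refine ⟨(measurable_inv.const_mul _).aestronglyMeasurable, ?_⟩
    rw [hasFiniteIntegral_iff_ofReal]
    · exact hlt
    · filter_upwards [ae_restrict_mem measurableSet_Ioo] with r hr
      have := hr.1
      simp only [Pi.zero_apply]
      positivity
  have hint2 : IntervalIntegrable (fun r : ℝ => r⁻¹) volume 0 r₀ := by
    rw [intervalIntegrable_iff_integrableOn_Ioo_of_le hr₀.le]
    have := hker.const_mul (ε * η / 2)⁻¹
    refine this.congr (Eventually.of_forall fun r => ?_)
    simp only []
    field_simp
  rw [intervalIntegrable_inv_iff] at hint2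
  rcases hint2 with h | h
  · exact hr₀.ne h
  · exact h left_mem_uIcc

/-- **Length–area principle**: the circles around `c` have short images. -/
theorem exists_volume_image_sphere_le {f : ℂ → ℂ} {O : Set ℂ} (hO : IsOpen O)
    (hf : DifferentiableOn ℂ f O) (hinj : InjOn f O) (hb : IsBounded (f '' O)) (c : ℂ)
    {ε r₀ : ℝ} (hε : 0 < ε) (hr₀ : 0 < r₀) :
    ∃ r, 0 < r ∧ r < r₀ ∧ ∀ (g : ℂ → ℝ) (g' : ℂ → ℂ →L[ℝ] ℝ) (M : ℝ), 0 ≤ M →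
      (∀ w, HasFDerivAt g (g' w) w) → (∀ w ∈ f '' O, ‖g' w‖ ≤ M) →
      volume ((fun z => g (f z)) '' (O ∩ Metric.sphere c r)) ≤ ENNReal.ofReal (M * ε) := by
  obtain ⟨r, hr, hrr, hlt⟩ := exists_lintegral_circle_lt (measurable_dnorm f hO)
    (dnorm_nonneg f O) (by rw [lintegral_dnorm_sq hO hf hinj]; exact hb.measure_lt_top.ne)
    c hε hr₀
  refine ⟨r, hr, hrr, fun g g' M hM hg hgM => ?_⟩
  set s : Set ℝ := Ioc (-Real.pi) Real.pi ∩ circleMap c r ⁻¹' O with hs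
  have hsm : MeasurableSet s :=
    measurableSet_Ioc.inter ((continuous_circleMap c r).measurable hO.measurableSet)
  have himg : (fun z => g (f z)) '' (O ∩ Metric.sphere c r) ⊆
      (fun θ => g (f (circleMap c r θ))) '' s := by
    rintro _ ⟨z, ⟨hzO, hzs⟩, rfl⟩
    have hz : z ∈ range (circleMap c r) := by rwa [range_circleMap, abs_of_pos hr]
    rw [← (periodic_circleMap c r).image_Ioc Real.two_pi_pos (-Real.pi)] at hz
    obtain ⟨θ, hθ, rfl⟩ := hz
    exact ⟨θ, ⟨⟨hθ.1, hθ.2.trans (by linarith)⟩, hzO⟩, rfl⟩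
  refine (measure_mono himg).trans ?_
  have hder : ∀ θ ∈ s, HasDerivAt (fun θ => g (f (circleMap c r θ)))
      (g' (f (circleMap c r θ)) (fderiv ℂ f (circleMap c r θ) (circleMap 0 r θ * I))) θ := by
    intro θ hθ
    have h1 := ((hf.differentiableAt (hO.mem_nhds hθ.2)).hasFDerivAt.restrictScalars
      ℝ).comp_hasDerivAt θ (hasDerivAt_circleMap c r θ)
    exact (hg _).comp_hasDerivAt θ h1
  refine (addHaar_image_le_lintegral_abs_det_fderiv volume hsm
    (fun θ hθ => (hder θ hθ).hasFDerivAt.hasFDerivWithinAt)).trans ?_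
  simp only [ContinuousLinearMap.det_toSpanSingleton]
  calc _ ≤ ∫⁻ θ in s, ENNReal.ofReal M * ENNReal.ofReal (r * dnorm f O (circleMap c r θ)) := by
        refine setLIntegral_mono' hsm fun θ hθ => ?_
        rw [← ENNReal.ofReal_mul hM]
        refine ENNReal.ofReal_le_ofReal ?_
        have hθO : circleMap c r θ ∈ O := hθ.2
        rw [dnorm, indicator_of_mem hθO, ← Real.norm_eq_abs]
        refine ((g' _).le_opNorm _).trans ?_
        refine mul_le_mul (hgM _ (mem_image_of_mem f hθO)) ?_ (norm_nonneg _) hM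
        rw [mul_comm r]
        refine ((fderiv ℂ f _).le_opNorm _).trans (le_of_eq ?_)
        rw [← norm_deriv_eq_norm_fderiv]
        simp [abs_of_pos hr]
    _ ≤ ∫⁻ θ in Ioc (-Real.pi) Real.pi,
          ENNReal.ofReal M * ENNReal.ofReal (r * dnorm f O (circleMap c r θ)) :=
        lintegral_mono_set inter_subset_left
    _ = ENNReal.ofReal M * ∫⁻ θ in Ioo (-Real.pi) Real.pi,
          ENNReal.ofReal (r * dnorm f O (circleMap c r θ)) := by
        have hm : Measurable fun θ : ℝ => ENNReal.ofReal (r * dnorm f O (circleMap c r θ)) :=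
          ENNReal.measurable_ofReal.comp (((measurable_dnorm f hO).comp
            (continuous_circleMap c r).measurable).const_mul r)
        rw [lintegral_const_mul _ hm, setLIntegral_congr Ioo_ae_eq_Ioc.symm]
    _ ≤ ENNReal.ofReal M * ENNReal.ofReal ε := by gcongr
    _ = ENNReal.ofReal (M * ε) := (ENNReal.ofReal_mul hM).symm

end

section

open MeasureTheory

theorem _root_.IsPreconnected.subset_of_frontier {S W : Set ℂ} (hS : IsPreconnected S)
    (hW : IsOpen W) (h : (S ∩ W).Nonempty) (hd : ∀ z ∈ S, z ∉ frontier W) : S ⊆ W := by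
  by_contra hcon
  obtain ⟨z, hzS, hzW⟩ := not_subset.1 hcon
  have hcl : ∀ z ∈ S, z ∉ W → z ∈ (closure W)ᶜ := fun z hz hzW hzc =>
    hd z hz (by rw [hW.frontier_eq]; exact ⟨hzc, hzW⟩)
  obtain ⟨y, -, hy1, hy2⟩ := hS W (closure W)ᶜ hW isClosed_closure.isOpen_compl
    (fun z hz => (em (z ∈ W)).imp id (hcl z hz)) h ⟨z, hzS, hcl z hzS hzW⟩
  exact hy2 (subset_closure hy1)

/-- An open subset of the disc which avoids a neighbourhood of the centre and has thin
relative frontier is thin. -/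
theorem abs_sub_le_of_frontier {a b : ℂ → ℝ} {mk : ℝ → ℝ → ℂ}
    (hmk : Continuous fun p : ℝ × ℝ => mk p.1 p.2) (hac : Continuous a)
    (ha : ∀ s t, a (mk s t) = s) (hb : ∀ s t, b (mk s t) = t) (hab : ∀ w, mk (a w) (b w) = w)
    (hn : ∀ w, ‖w‖ ^ 2 = a w ^ 2 + b w ^ 2)
    {W : Set ℂ} (hW : IsOpen W) (hWc : IsPreconnected W) (hW1 : W ⊆ Metric.ball 0 1)
    {η : ℝ} (hη : 0 < η) (hη1 : η ≤ 1) (hdisj : ∀ w ∈ W, η ≤ ‖w‖)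
    (hva : volume (a '' (frontier W ∩ Metric.ball 0 1)) ≤ ENNReal.ofReal η)
    (hvb : volume (b '' (frontier W ∩ Metric.ball 0 1)) ≤ ENNReal.ofReal η)
    {w w' : ℂ} (hw : w ∈ W) (hw' : w' ∈ W) : |a w - a w'| ≤ 3 * η := by
  have hball : ∀ w : ℂ, w ∈ Metric.ball (0 : ℂ) 1 ↔ a w ^ 2 + b w ^ 2 < 1 := fun w => by
    rw [mem_ball_zero_iff, ← hn, sq_lt_one_iff₀ (norm_nonneg _)]
  have hker : ∀ u : ℝ, IsPreconnected {t : ℝ | u ^ 2 + t ^ 2 < 1} := fun u => by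
    have : {t : ℝ | u ^ 2 + t ^ 2 < 1} = Metric.ball 0 √(1 - u ^ 2) := by
      ext t
      rw [mem_ball_zero_iff, Real.norm_eq_abs, Real.lt_sqrt (abs_nonneg _), sq_abs]
      exact ⟨fun h => by linarith [h.out], fun h => show u ^ 2 + t ^ 2 < 1 by linarith⟩
    rw [this]
    exact (convex_ball _ _).isPreconnected
  obtain ⟨v, hv, hvE⟩ : ∃ v ∈ Ioo (-η) η, v ∉ b '' (frontier W ∩ Metric.ball 0 1) := by
    by_contra! h
    have h1 := (measure_mono (μ := volume) h).trans hvb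
    rw [Real.volume_Ioo, ENNReal.ofReal_le_ofReal_iff hη.le] at h1
    linarith
  have hv2 : v ^ 2 < η ^ 2 := by nlinarith [hv.1, hv.2]
  have hhor : ∀ u, u ^ 2 + v ^ 2 < 1 → mk u v ∉ W := by
    intro u hu huW
    have hc : IsPreconnected ((fun s => mk s v) '' {s : ℝ | v ^ 2 + s ^ 2 < 1}) :=
      (hker v).image _ (hmk.comp (continuous_id.prodMk continuous_const)).continuousOn
    have hsub := hc.subset_of_frontier hW ⟨mk u v, ⟨u, by simp only [mem_ofPred_eq]; linarith, rfl⟩,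
        huW⟩ (by
      rintro _ ⟨s, hs, rfl⟩ hf
      refine hvE ⟨_, ⟨hf, (hball _).2 ?_⟩, hb s v⟩
      rw [ha, hb]
      linarith [hs.out])
    have h0 : mk 0 v ∈ W := hsub ⟨0, by simp only [mem_ofPred_eq]; nlinarith, rfl⟩
    have h1 := hdisj _ h0
    have h2 : ‖mk 0 v‖ ^ 2 < η ^ 2 := by rw [hn, ha, hb]; linarith
    exact absurd (pow_lt_pow_left₀ (lt_of_pow_lt_pow_left₀ 2 hη.le h2) (norm_nonneg _) two_ne_zero)
      (not_lt.2 (pow_le_pow_left₀ hη.le h1 2))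
  have hJ : a '' W ⊆ a '' (frontier W ∩ Metric.ball 0 1) ∪
      (Icc (-1) (-(1 - η)) ∪ Icc (1 - η) 1) := by
    rintro _ ⟨z, hz, rfl⟩
    by_contra hcon
    rw [mem_union, not_or] at hcon
    obtain ⟨hc1, hc2⟩ := hcon
    set u := a z
    have hz1 : u ^ 2 + b z ^ 2 < 1 := (hball z).1 (hW1 hz)
    have hu1 : |u| < 1 := by
      rw [← sq_lt_one_iff_abs_lt_one]
      nlinarith [sq_nonneg (b z)]
    have hu2 : |u| < 1 - η := by
      by_contra! h
      rw [abs_lt] at hu1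
      refine hc2 ?_
      rcases abs_cases u with ⟨h3, h4⟩ | ⟨h3, h4⟩ <;> rw [h3] at h
      · exact Or.inr ⟨h, hu1.2.le⟩
      · exact Or.inl ⟨hu1.1.le, by linarith⟩
    have hu3 : u ^ 2 + v ^ 2 < 1 := by
      have : u ^ 2 < (1 - η) ^ 2 := by
        rw [← sq_abs u]
        exact pow_lt_pow_left₀ hu2 (abs_nonneg _) two_ne_zero
      nlinarith
    refine hhor u hu3 ?_
    have hc : IsPreconnected ((fun s => mk u s) '' {s : ℝ | u ^ 2 + s ^ 2 < 1}) :=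
      (hker u).image _ (hmk.comp (continuous_const.prodMk continuous_id)).continuousOn
    have hsub := hc.subset_of_frontier hW ⟨z, ⟨b z, hz1, hab z⟩, hz⟩ (by
      rintro _ ⟨s, hs, rfl⟩ hf
      refine hc1 ⟨_, ⟨hf, (hball _).2 ?_⟩, ha u s⟩
      rw [ha, hb]
      exact hs)
    exact hsub ⟨v, hu3, rfl⟩
  have hvol : volume (a '' W) ≤ ENNReal.ofReal (3 * η) := by
    refine (measure_mono hJ).trans ((measure_union_le _ _).trans ?_)
    refine (add_le_add hva (measure_union_le _ _)).trans ?_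
    rw [Real.volume_Icc, Real.volume_Icc, ← ENNReal.ofReal_add (by linarith) (by linarith),
      ← ENNReal.ofReal_add hη.le (by linarith)]
    exact ENNReal.ofReal_le_ofReal (by linarith)
  have key : ∀ w ∈ W, ∀ w' ∈ W, a w - a w' ≤ 3 * η := fun w hw w' hw' => by
    have hsub : Icc (a w') (a w) ⊆ a '' W :=
      (hWc.image _ hac.continuousOn).ordConnected.out ⟨w', hw', rfl⟩ ⟨w, hw, rfl⟩
    have h1 := (measure_mono (μ := volume) hsub).trans hvol
    rwa [Real.volume_Icc, ENNReal.ofReal_le_ofReal_iff (by positivity)] at h1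
  rw [abs_le]
  exact ⟨by linarith [key w' hw' w hw], key w hw w' hw'⟩

/-- `f` and `ψ` are mutually inverse conformal maps between `U` and the unit disc. -/
structure DiscChart (U : Set ℂ) (f ψ : ℂ → ℂ) : Prop where
  isOpen : IsOpen U
  diff : DifferentiableOn ℂ f U
  diff_symm : DifferentiableOn ℂ ψ (Metric.ball 0 1)
  mem : ∀ z ∈ U, f z ∈ Metric.ball (0 : ℂ) 1
  mem_symm : ∀ w ∈ Metric.ball (0 : ℂ) 1, ψ w ∈ U
  left_inv : ∀ z ∈ U, ψ (f z) = z
  right_inv : ∀ w ∈ Metric.ball (0 : ℂ) 1, f (ψ w) = w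

theorem exists_discChart {U : Set ℂ} (hU : HoleFree U) (hn : U.Nonempty) (hne : U ≠ univ) :
    ∃ f ψ, DiscChart U f ψ := by
  obtain ⟨p, hp⟩ := hn
  obtain ⟨f, hfd, hinj, himg⟩ := exists_riemannMap hU hp hne
  have hU' := hU.isOpen
  set ψ := Function.invFunOn f U with hψ
  have hl : ∀ z ∈ U, ψ (f z) = z := fun z hz => hinj.leftInvOn_invFunOn hz
  have hm : ∀ w ∈ Metric.ball (0 : ℂ) 1, ψ w ∈ U := fun w hw =>
    Function.invFunOn_mem (f := f) (s := U) (by rwa [← himg] at hw)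
  have hr : ∀ w ∈ Metric.ball (0 : ℂ) 1, f (ψ w) = w := fun w hw =>
    Function.invFunOn_eq (f := f) (s := U) (by rwa [← himg] at hw)
  have hfa : AnalyticOnNhd ℂ f U := hfd.analyticOnNhd hU'
  have hnc : ¬ ∃ w, ∀ z ∈ U, f z = w := by
    rintro ⟨w, hw⟩
    have h0 : f (ψ 0) = 0 := hr 0 (by simp)
    have h1 : f (ψ (1 / 2)) = 1 / 2 := hr _ (by simp; norm_num)
    rw [hw _ (hm 0 (by simp))] at h0
    rw [hw _ (hm _ (by simp; norm_num)), h0] at h1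
    norm_num at h1
  have hopen := (hfa.is_constant_or_isOpen hU.isPreconnected).resolve_left hnc
  have hψc : ∀ w ∈ Metric.ball (0 : ℂ) 1, ContinuousAt ψ w := by
    intro w hw
    rw [ContinuousAt, tendsto_def]
    intro s hs
    obtain ⟨t, hts, hto, hwt⟩ := mem_nhds_iff.1 (inter_mem hs (hU'.mem_nhds (hm w hw)))
    refine mem_of_superset ((hopen t (hts.trans inter_subset_right) hto).mem_nhds
      ⟨ψ w, hwt, hr w hw⟩) ?_
    rintro _ ⟨z, hz, rfl⟩
    rw [mem_preimage, hl z (hts hz).2]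
    exact (hts hz).1
  refine ⟨f, ψ, hU', hfd, ?_, fun z hz => himg ▸ mem_image_of_mem f hz, hm, hl, hr⟩
  intro w hw
  have hψd : ∀ w ∈ Metric.ball (0 : ℂ) 1, deriv f (ψ w) ≠ 0 → DifferentiableAt ℂ ψ w :=
    fun w hw hd => (HasDerivAt.of_local_left_inverse (hψc w hw)
      (hfd.differentiableAt (hU'.mem_nhds (hm w hw))).hasDerivAt hd
      (by filter_upwards [Metric.isOpen_ball.mem_nhds hw] with y hy using hr y hy)).differentiableAt
  refine (analyticAt_of_differentiable_on_punctured_nhds_of_continuousAt ?_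
    (hψc w hw)).differentiableAt.differentiableWithinAt
  have hda : AnalyticAt ℂ (deriv f) (ψ w) := (hfa _ (hm w hw)).deriv
  rcases hda.eventually_eq_zero_or_eventually_ne_zero with h | h
  · exfalso
    obtain ⟨r, hr0, hrb⟩ := Metric.eventually_nhds_iff_ball.1 (h.and (hU'.mem_nhds (hm w hw)))
    have hmem : ψ w + ((r / 2 : ℝ) : ℂ) ∈ Metric.ball (ψ w) r := by
      simp [abs_of_pos hr0, hr0]
    have hconst : f (ψ w + ((r / 2 : ℝ) : ℂ)) = f (ψ w) :=
      (convex_ball (ψ w) r).is_const_of_fderivWithin_eq_zero (𝕜 := ℂ) (f := f)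
        (hfd.mono fun z hz => (hrb z hz).2) (fun z hz => by
          rw [fderivWithin_of_isOpen Metric.isOpen_ball hz]
          ext
          simp [(hrb z hz).1]) hmem (Metric.mem_ball_self hr0)
    have := hinj (hrb _ hmem).2 (hm w hw) hconst
    simp [hr0.ne'] at this
  · have ht : Tendsto ψ (𝓝[≠] w) (𝓝[≠] (ψ w)) := by
      refine tendsto_nhdsWithin_of_tendsto_nhds_of_eventually_within _
        ((hψc w hw).tendsto.mono_left nhdsWithin_le_nhds) ?_
      filter_upwards [self_mem_nhdsWithin, mem_nhdsWithin_of_mem_nhds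
        (Metric.isOpen_ball.mem_nhds hw)] with y hy1 hy2 heq
      exact hy1 (by rw [mem_singleton_iff, ← hr y hy2, heq, hr w hw])
    filter_upwards [ht.eventually h, mem_nhdsWithin_of_mem_nhds
      (Metric.isOpen_ball.mem_nhds hw)] with y hy1 hy2 using hψd y hy2 hy1

end

section

open MeasureTheory

/-- Points of `U` close to `x` can be joined by connected subsets of `U` close to `x`. -/
def LocConnAt (U : Set ℂ) (x : ℂ) : Prop :=
  ∀ ε > 0, ∃ δ > 0, ∀ p ∈ U ∩ Metric.ball x δ, ∀ q ∈ U ∩ Metric.ball x δ,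
    ∃ C ⊆ U ∩ Metric.ball x ε, IsPreconnected C ∧ p ∈ C ∧ q ∈ C

theorem isPreconnected_ball_inter_sphere {w : ℂ} (hw : ‖w‖ = 1) {r : ℝ} (hr : 0 < r) :
    IsPreconnected (Metric.ball (0 : ℂ) 1 ∩ Metric.sphere w r) := by
  have hr' : (r : ℂ) ≠ 0 := ofReal_ne_zero.2 hr.ne'
  have hw' : w ≠ 0 := norm_ne_zero_iff.1 (by rw [hw]; exact one_ne_zero)
  have hcos : ∀ α : ℝ, ‖w - r * w * exp (α * I)‖ ^ 2 = 1 - 2 * r * Real.cos α + r ^ 2 := by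
    intro α
    have h1 : w - r * w * exp (α * I) = w * (1 - r * exp (α * I)) := by ring
    rw [h1, norm_mul, hw, one_mul, ← normSq_eq_norm_sq, normSq_apply]
    simp only [sub_re, sub_im, one_re, one_im, re_ofReal_mul, im_ofReal_mul, exp_ofReal_mul_I_re,
      exp_ofReal_mul_I_im]
    linear_combination r ^ 2 * Real.sin_sq_add_cos_sq α
  have hsp : ∀ α : ℝ, w - r * w * exp (α * I) ∈ Metric.sphere w r := by
    intro α
    simp [norm_exp_ofReal_mul_I, hw, abs_of_pos hr]
  have hmem : ∀ α : ℝ, w - r * w * exp (α * I) ∈ Metric.ball (0 : ℂ) 1 ↔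
      r < 2 * Real.cos α := by
    intro α
    rw [mem_ball_zero_iff, ← sq_lt_one_iff₀ (norm_nonneg _), hcos]
    constructor
    · intro h
      by_contra! h'
      nlinarith
    · intro h
      nlinarith
  refine isPreconnected_of_forall (w - r * w * exp ((0 : ℝ) * I)) fun ζ hζ => ?_
  set α := arg ((w - ζ) / (r * w)) with hα
  have hnorm : ‖(w - ζ) / (r * w)‖ = 1 := by
    have := hζ.2
    rw [mem_sphere_iff_norm, norm_sub_rev] at this
    rw [norm_div, this, norm_mul, hw, norm_real, Real.norm_eq_abs, abs_of_pos hr, mul_one,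
      div_self hr.ne']
  have hζα : ζ = w - r * w * exp (α * I) := by
    have := norm_mul_exp_arg_mul_I ((w - ζ) / (r * w))
    rw [hnorm, ofReal_one, one_mul] at this
    rw [hα, this]
    field_simp
    ring
  have hαm : r < 2 * Real.cos α := (hmem α).1 (hζα ▸ hζ.1)
  refine ⟨(fun β : ℝ => w - r * w * exp (β * I)) '' Icc (-|α|) |α|, ?_,
    ⟨0, by simp, rfl⟩, ⟨α, ⟨neg_abs_le α, le_abs_self α⟩, hζα.symm⟩,
    isPreconnected_Icc.image _ (by fun_prop)⟩
  rintro _ ⟨β, hβ, rfl⟩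
  refine ⟨(hmem β).2 (hαm.trans_le ?_), hsp β⟩
  have : Real.cos |α| ≤ Real.cos |β| :=
    Real.cos_le_cos_of_nonneg_of_le_pi (abs_nonneg _) (abs_arg_le_pi _) (abs_le.2 hβ)
  rw [Real.cos_abs, Real.cos_abs] at this
  linarith

namespace DiscChart

variable {U : Set ℂ} {f ψ : ℂ → ℂ}

theorem image_eq (D : DiscChart U f ψ)
    {V : Set ℂ} (hV : V ⊆ U) : f '' V = Metric.ball 0 1 ∩ ψ ⁻¹' V := by
  ext w
  constructor
  · rintro ⟨z, hz, rfl⟩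
    exact ⟨D.mem z (hV hz), by rwa [mem_preimage, D.left_inv z (hV hz)]⟩
  · rintro ⟨h1, h2⟩
    exact ⟨ψ w, h2, D.right_inv w h1⟩

theorem isOpen_image (D : DiscChart U f ψ)
    {V : Set ℂ} (hV : V ⊆ U) (hVo : IsOpen V) : IsOpen (f '' V) := by
  rw [D.image_eq hV]
  exact D.diff_symm.continuousOn.isOpen_inter_preimage Metric.isOpen_ball hVo

theorem continuousAt_symm (D : DiscChart U f ψ)
    {w : ℂ} (hw : w ∈ Metric.ball (0 : ℂ) 1) : ContinuousAt ψ w :=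
  D.diff_symm.continuousOn.continuousAt (Metric.isOpen_ball.mem_nhds hw)

theorem mem_sphere_of_mem_frontier (D : DiscChart U f ψ) {x : ℂ} {r : ℝ} {V : Set ℂ}
    (hV : IsComponent (U ∩ Metric.ball x r) V) {w : ℂ} (hw : w ∈ frontier (f '' V))
    (hw1 : w ∈ Metric.ball (0 : ℂ) 1) : ψ w ∈ U ∩ Metric.sphere x r := by
  have hO : IsOpen (U ∩ Metric.ball x r) := D.isOpen.inter Metric.isOpen_ball
  have hVU : V ⊆ U := hV.subset.trans inter_subset_left
  rw [(D.isOpen_image hVU (hV.isOpen hO)).frontier_eq] at hw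
  have hcl : ψ w ∈ closure V := by
    refine closure_mono ?_ ((D.continuousAt_symm hw1).continuousWithinAt.mem_closure_image hw.1)
    rintro _ ⟨_, ⟨z, hz, rfl⟩, rfl⟩
    rwa [D.left_inv z (hVU hz)]
  refine ⟨D.mem_symm w hw1, ?_⟩
  have h1 : ψ w ∈ Metric.closedBall x r :=
    closure_minimal (hV.subset.trans (inter_subset_right.trans Metric.ball_subset_closedBall))
      Metric.isClosed_closedBall hcl
  have h2 : ψ w ∉ Metric.ball x r := fun h => hw.2
    ⟨ψ w, hV.closure_inter hO hcl ⟨D.mem_symm w hw1, h⟩, D.right_inv w hw1⟩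
  exact le_antisymm h1 (not_lt.1 h2)

theorem exists_dist_le (D : DiscChart U f ψ)
    {x : ℂ} (hx : x ∉ U) (hl : LocConnAt U x) {ε : ℝ} (hε : 0 < ε) :
    ∃ δ > 0, ∀ p ∈ U ∩ Metric.ball x δ, ∀ q ∈ U ∩ Metric.ball x δ, dist (f p) (f q) ≤ ε := by
  have h0 : (0 : ℂ) ∈ Metric.ball (0 : ℂ) 1 := by simp
  have hd : 0 < dist (ψ 0) x := dist_pos.2 fun h => hx (h ▸ D.mem_symm 0 h0)
  obtain ⟨η₀, hη₀, hball⟩ := Metric.continuousAt_iff.1 (D.continuousAt_symm h0) _ (half_pos hd)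
  set η := min (ε / 6) (min 1 η₀)
  have hη : 0 < η := by positivity
  obtain ⟨r, hr, hr2, hvol⟩ := exists_volume_image_sphere_le D.isOpen D.diff
    (fun a ha b hb h => by rw [← D.left_inv a ha, h, D.left_inv b hb])
    (Metric.isBounded_ball.subset (image_subset_iff.2 D.mem)) x hη (half_pos hd)
  obtain ⟨δ, hδ, hC⟩ := hl r hr
  refine ⟨δ, hδ, fun p hp q hq => ?_⟩
  obtain ⟨C, hCs, hCp, hpC, hqC⟩ := hC p hp q hq
  set V := connectedComponentIn (U ∩ Metric.ball x r) p
  have hV : IsComponent (U ∩ Metric.ball x r) V := ⟨p, hCs hpC, rfl⟩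
  have hCV : C ⊆ V := hCp.subset_connectedComponentIn hpC hCs
  have hVU : V ⊆ U := hV.subset.trans inter_subset_left
  have hWo := D.isOpen_image hVU (hV.isOpen (D.isOpen.inter Metric.isOpen_ball))
  have hWc : IsPreconnected (f '' V) :=
    hV.isPreconnected.image _ (D.diff.continuousOn.mono hVU)
  have hW1 : f '' V ⊆ Metric.ball 0 1 := image_subset_iff.2 fun z hz => D.mem z (hVU hz)
  have hdisj : ∀ w ∈ f '' V, η ≤ ‖w‖ := by
    rintro _ ⟨z, hz, rfl⟩
    by_contra! h
    have h1 := @hball (f z) (by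
      rw [dist_zero_right]
      exact h.trans_le ((min_le_right _ _).trans (min_le_right _ _)))
    rw [D.left_inv z (hVU hz)] at h1
    have h2 : dist z x < r := (hV.subset hz).2
    have h3 := dist_triangle_left (ψ 0) x z
    linarith
  have hfr : frontier (f '' V) ∩ Metric.ball 0 1 ⊆ f '' (U ∩ Metric.sphere x r) :=
    fun w hw => ⟨ψ w, D.mem_sphere_of_mem_frontier hV hw.1 hw.2, D.right_inv w hw.2⟩
  have hvol' : ∀ (g : ℂ →L[ℝ] ℝ), ‖g‖ ≤ 1 →
      volume (g '' (frontier (f '' V) ∩ Metric.ball 0 1)) ≤ ENNReal.ofReal η := by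
    intro g hg
    have := hvol g (fun _ => g) 1 zero_le_one (fun w => g.hasFDerivAt) (fun _ _ => hg)
    rw [one_mul] at this
    refine (measure_mono ?_).trans this
    rintro _ ⟨w, hw, rfl⟩
    obtain ⟨z, hz, rfl⟩ := hfr hw
    exact ⟨z, hz, rfl⟩
  have hre : volume (re '' (frontier (f '' V) ∩ Metric.ball 0 1)) ≤ ENNReal.ofReal η :=
    hvol' reCLM reCLM_norm.le
  have him : volume (im '' (frontier (f '' V) ∩ Metric.ball 0 1)) ≤ ENNReal.ofReal η :=
    hvol' imCLM imCLM_norm.le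
  have hη1 : η ≤ 1 := (min_le_right _ _).trans (min_le_left _ _)
  have hpW : f p ∈ f '' V := ⟨p, hCV hpC, rfl⟩
  have hqW : f q ∈ f '' V := ⟨q, hCV hqC, rfl⟩
  have h1 := abs_sub_le_of_frontier (a := re) (b := im) (mk := fun s t => s + t * I)
    (by fun_prop) continuous_re (by simp) (by simp) (fun w => re_add_im w)
    (fun w => by rw [← normSq_eq_norm_sq, normSq_apply]; ring)
    hWo hWc hW1 hη hη1 hdisj hre him hpW hqW
  have h2 := abs_sub_le_of_frontier (a := im) (b := re) (mk := fun s t => t + s * I)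
    (by fun_prop) continuous_im (by simp) (by simp) (fun w => re_add_im w)
    (fun w => by rw [← normSq_eq_norm_sq, normSq_apply]; ring)
    hWo hWc hW1 hη hη1 hdisj him hre hpW hqW
  rw [Complex.dist_eq]
  have h3 := norm_le_abs_re_add_abs_im (f p - f q)
  rw [sub_re, sub_im] at h3
  have h4 : η ≤ ε / 6 := min_le_left _ _
  linarith

theorem exists_tendsto (D : DiscChart U f ψ)
    (hl : ∀ x ∈ frontier U, LocConnAt U x) {x : ℂ} (hx : x ∈ closure U) :
    ∃ w, Tendsto f (𝓝[U] x) (𝓝 w) := by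
  have := mem_closure_iff_nhdsWithin_neBot.1 hx
  by_cases hxU : x ∈ U
  · exact ⟨f x, D.diff.continuousOn x hxU⟩
  refine cauchy_map_iff_exists_tendsto.1 ?_
  refine Metric.cauchy_iff.2 ⟨inferInstance, fun ε hε => ?_⟩
  obtain ⟨δ, hδ, h⟩ := D.exists_dist_le hxU
    (hl x (by rw [D.isOpen.frontier_eq]; exact ⟨hx, hxU⟩)) (half_pos hε)
  refine ⟨f '' (U ∩ Metric.ball x δ), image_mem_map
    (inter_mem self_mem_nhdsWithin (mem_nhdsWithin_of_mem_nhds (Metric.ball_mem_nhds x hδ))), ?_⟩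
  rintro _ ⟨p, hp, rfl⟩ _ ⟨q, hq, rfl⟩
  linarith [h p hp q hq]

theorem continuousOn_extend (D : DiscChart U f ψ) (hl : ∀ x ∈ frontier U, LocConnAt U x) :
    ContinuousOn (extendFrom U f) (closure U) :=
  continuousOn_extendFrom Subset.rfl fun _ => D.exists_tendsto hl

theorem extend_eq (D : DiscChart U f ψ) {z : ℂ} (hz : z ∈ U) : extendFrom U f z = f z :=
  extendFrom_eq (subset_closure hz) (D.diff.continuousOn z hz)

theorem norm_extend (D : DiscChart U f ψ)
    (hl : ∀ x ∈ frontier U, LocConnAt U x) {x : ℂ} (hx : x ∈ frontier U) :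
    ‖extendFrom U f x‖ = 1 := by
  rw [D.isOpen.frontier_eq] at hx
  have ht := tendsto_extendFrom (D.exists_tendsto hl hx.1)
  have := mem_closure_iff_nhdsWithin_neBot.1 hx.1
  refine le_antisymm (le_of_tendsto ht.norm ?_) (not_lt.1 fun h => hx.2 ?_)
  · filter_upwards [self_mem_nhdsWithin] with z hz
    exact (mem_ball_zero_iff.1 (D.mem z hz)).le
  · have hw : extendFrom U f x ∈ Metric.ball (0 : ℂ) 1 := mem_ball_zero_iff.2 h
    have h1 := (D.continuousAt_symm hw).tendsto.comp ht
    have h2 : Tendsto (ψ ∘ f) (𝓝[U] x) (𝓝 x) := by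
      refine (tendsto_id.mono_left nhdsWithin_le_nhds).congr' ?_
      filter_upwards [self_mem_nhdsWithin] with z hz
      exact (D.left_inv z hz).symm
    rw [tendsto_nhds_unique h2 h1]
    exact D.mem_symm _ hw

theorem exists_crossing (D : DiscChart U f ψ)
    (hl : ∀ x ∈ frontier U, LocConnAt U x) {x : ℂ} (hx : x ∈ frontier U)
    {ρ : ℝ} (hρ : 0 < ρ) : ∃ d > 0, ∀ r, 0 < r → r < d →
      ∃ ζ ∈ Metric.ball (0 : ℂ) 1 ∩ Metric.sphere (extendFrom U f x) r, dist (ψ ζ) x < ρ := by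
  have hxc : x ∈ closure U := frontier_subset_closure hx
  have ht := tendsto_extendFrom (D.exists_tendsto hl hxc)
  have := mem_closure_iff_nhdsWithin_neBot.1 hxc
  set w := extendFrom U f x with hw
  have hw1 : ‖w‖ = 1 := D.norm_extend hl hx
  obtain ⟨δ, hδ, hC⟩ := hl x hx ρ hρ
  have hnear : ∀ᶠ z in 𝓝[U] x, z ∈ U ∩ Metric.ball x δ :=
    inter_mem self_mem_nhdsWithin (mem_nhdsWithin_of_mem_nhds (Metric.ball_mem_nhds x hδ))
  obtain ⟨z₁, hz₁⟩ := hnear.exists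
  refine ⟨dist (f z₁) w, dist_pos.2 fun h => ?_, fun r hr hrd => ?_⟩
  · have := D.mem z₁ hz₁.1
    rw [h, mem_ball_zero_iff, hw1] at this
    exact lt_irrefl _ this
  · obtain ⟨z₂, hz₂, hz₂r⟩ := (hnear.and (ht (Metric.ball_mem_nhds w hr))).exists
    obtain ⟨C, hCs, hCp, h1, h2⟩ := hC z₁ hz₁ z₂ hz₂
    have hCU : C ⊆ U := hCs.trans inter_subset_left
    obtain ⟨z, hz, hzr⟩ := hCp.intermediate_value h2 h1
      (f := fun z => dist (f z) w)
      (continuous_id.dist continuous_const |>.comp_continuousOn (D.diff.continuousOn.mono hCU))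
      (show r ∈ Icc (dist (f z₂) w) (dist (f z₁) w) from ⟨(Metric.mem_ball.1 hz₂r).le, hrd.le⟩)
    refine ⟨f z, ⟨D.mem z (hCU hz), hzr⟩, ?_⟩
    rw [D.left_inv z (hCU hz)]
    exact (hCs hz).2

theorem extend_injOn_frontier (D : DiscChart U f ψ) (hl : ∀ x ∈ frontier U, LocConnAt U x) :
    InjOn (extendFrom U f) (frontier U) := by
  intro x hx y hy hxy
  by_contra hne
  set w := extendFrom U f x with hw
  have hw1 : ‖w‖ = 1 := D.norm_extend hl hx
  set R := dist x y with hRdef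
  have hR : 0 < R := dist_pos.2 hne
  obtain ⟨d₁, hd₁, hc₁⟩ := D.exists_crossing hl hx (ρ := R / 4) (by positivity)
  obtain ⟨d₂, hd₂, hc₂⟩ := D.exists_crossing hl hy (ρ := R / 4) (by positivity)
  set O := Metric.ball (0 : ℂ) 1 ∩ ψ ⁻¹' (Metric.ball x R)
  have hOo : IsOpen O :=
    D.diff_symm.continuousOn.isOpen_inter_preimage Metric.isOpen_ball Metric.isOpen_ball
  obtain ⟨r, hr, hrd, hvol⟩ := exists_volume_image_sphere_le hOo
    (D.diff_symm.mono inter_subset_left)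
    (fun a ha b hb h => by rw [← D.right_inv a ha.1, h, D.right_inv b hb.1])
    (Metric.isBounded_ball.subset (image_subset_iff.2 fun w hw => hw.2)) w
    (ε := R / 8) (r₀ := min d₁ d₂) (by positivity) (by positivity)
  obtain ⟨ζ₁, hζ₁, h₁⟩ := hc₁ r hr (hrd.trans_le (min_le_left _ _))
  obtain ⟨ζ₂, hζ₂, h₂⟩ := hc₂ r hr (hrd.trans_le (min_le_right _ _))
  rw [← hxy] at hζ₂
  have hv := hvol (fun z => ‖z - x‖ ^ 2) (fun z => 2 • (innerSL ℝ (z - x)).comp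
    (ContinuousLinearMap.id ℝ ℂ)) (2 * R) (by positivity)
    (fun z => ((hasFDerivAt_id z).sub_const x).norm_sq) (by
      rintro _ ⟨ζ, hζ, rfl⟩
      have : ‖ψ ζ - x‖ ≤ R := by
        rw [← dist_eq_norm]
        exact (Metric.mem_ball.1 hζ.2).le
      refine (norm_nsmul_le).trans ?_
      rw [ContinuousLinearMap.comp_id, innerSL_apply_norm]
      simpa using this)
  have hsub : Icc (R ^ 2 / 16) (9 * R ^ 2 / 16) ⊆
      (fun z => ‖ψ z - x‖ ^ 2) '' (O ∩ Metric.sphere w r) := by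
    intro t ht
    have hcont : ContinuousOn (fun z => ‖ψ z - x‖ ^ 2)
        (Metric.ball (0 : ℂ) 1 ∩ Metric.sphere w r) :=
      (((D.diff_symm.continuousOn.mono inter_subset_left).sub continuousOn_const).norm).pow 2
    have ht1 : ‖ψ ζ₁ - x‖ ^ 2 ≤ t := by
      rw [dist_eq_norm] at h₁
      have := pow_le_pow_left₀ (norm_nonneg _) h₁.le 2
      linarith [ht.1]
    have ht2 : t ≤ ‖ψ ζ₂ - x‖ ^ 2 := by
      have h3 : 3 * R / 4 ≤ ‖ψ ζ₂ - x‖ := by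
        rw [← dist_eq_norm]
        have := dist_triangle_left x y (ψ ζ₂)
        linarith
      have := pow_le_pow_left₀ (by positivity) h3 2
      linarith [ht.2]
    obtain ⟨ζ, hζ, hζt⟩ := (isPreconnected_ball_inter_sphere hw1 hr).intermediate_value
      hζ₁ hζ₂ hcont ⟨ht1, ht2⟩
    refine ⟨ζ, ⟨⟨hζ.1, ?_⟩, hζ.2⟩, hζt⟩
    rw [mem_preimage, Metric.mem_ball, dist_eq_norm]
    refine lt_of_pow_lt_pow_left₀ 2 hR.le ?_
    have : ‖ψ ζ - x‖ ^ 2 = t := hζt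
    rw [this]
    have := pow_pos hR 2
    linarith [ht.2]
  have hfin := (measure_mono (μ := volume) hsub).trans hv
  rw [Real.volume_Icc, ENNReal.ofReal_le_ofReal_iff (by positivity)] at hfin
  have := pow_pos hR 2
  nlinarith

theorem tendsto_symm (D : DiscChart U f ψ)
    (hl : ∀ x ∈ frontier U, LocConnAt U x) {x : ℂ} (hx : x ∈ frontier U) :
    Tendsto ψ (𝓝[Metric.ball 0 1] (extendFrom U f x)) (𝓝 x) := by
  have hxc : x ∈ closure U := frontier_subset_closure hx
  have ht := tendsto_extendFrom (D.exists_tendsto hl hxc)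
  have := mem_closure_iff_nhdsWithin_neBot.1 hxc
  set w := extendFrom U f x with hw
  have hw1 : ‖w‖ = 1 := D.norm_extend hl hx
  rw [Metric.nhds_basis_ball.tendsto_right_iff]
  intro r hr
  obtain ⟨δ, hδ, hC⟩ := hl x hx r hr
  have hnear : ∀ᶠ z in 𝓝[U] x, z ∈ U ∩ Metric.ball x δ :=
    inter_mem self_mem_nhdsWithin (mem_nhdsWithin_of_mem_nhds (Metric.ball_mem_nhds x hδ))
  obtain ⟨p, hp⟩ := hnear.exists
  set V := connectedComponentIn (U ∩ Metric.ball x r) p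
  have hδV : U ∩ Metric.ball x δ ⊆ V := fun q hq => by
    obtain ⟨C, hCs, hCp, h1, h2⟩ := hC p hp q hq
    exact hCp.subset_connectedComponentIn h1 hCs h2
  have hV : IsComponent (U ∩ Metric.ball x r) V := by
    obtain ⟨C, hCs, hCp, h1, h2⟩ := hC p hp p hp
    exact ⟨p, hCs h1, rfl⟩
  have hVU : V ⊆ U := hV.subset.trans inter_subset_left
  have hWo := D.isOpen_image hVU (hV.isOpen (D.isOpen.inter Metric.isOpen_ball))
  by_cases hs : ∃ s > 0, Metric.ball (0 : ℂ) 1 ∩ Metric.ball w s ⊆ f '' V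
  · obtain ⟨s, hs, hsub⟩ := hs
    filter_upwards [self_mem_nhdsWithin,
      mem_nhdsWithin_of_mem_nhds (Metric.ball_mem_nhds w hs)] with ζ h1 h2
    obtain ⟨z, hz, rfl⟩ := hsub ⟨h1, h2⟩
    rw [D.left_inv z (hVU hz)]
    exact (hV.subset hz).2
  · exfalso
    push Not at hs
    have hfreq : w ∈ closure (f '' (U ∩ Metric.sphere x r)) := by
      rw [Metric.mem_closure_iff]
      intro s hs0
      by_contra! hcon
      refine hs s hs0 ((((convex_ball (0 : ℂ) 1).inter (convex_ball w s)).isPreconnected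
        ).subset_of_frontier hWo ?_ ?_)
      · obtain ⟨z, hz1, hz2⟩ := (hnear.and (ht (Metric.ball_mem_nhds w hs0))).exists
        exact ⟨f z, ⟨D.mem z hz1.1, hz2⟩, ⟨z, hδV hz1, rfl⟩⟩
      · intro ζ hζ hfr
        have h1 := hcon ζ ⟨ψ ζ, D.mem_sphere_of_mem_frontier hV hfr hζ.1, D.right_inv ζ hζ.1⟩
        rw [dist_comm] at h1
        exact absurd hζ.2 (not_lt.2 h1)
    have := mem_closure_iff_nhdsWithin_neBot.1 hfreq
    have hmaps : ∀ ζ ∈ f '' (U ∩ Metric.sphere x r), ψ ζ ∈ U ∩ Metric.sphere x r := by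
      rintro _ ⟨z, hz, rfl⟩
      rwa [D.left_inv z hz.1]
    obtain ⟨y, hy, hcl⟩ := (isCompact_sphere x r).exists_mapClusterPt_of_frequently
      (f := ψ) (l := 𝓝[f '' (U ∩ Metric.sphere x r)] w)
      (Eventually.frequently (by
        filter_upwards [self_mem_nhdsWithin] with ζ hζ using (hmaps ζ hζ).2))
    obtain ⟨𝒰, h𝒰, hψ𝒰⟩ := mapClusterPt_iff_ultrafilter.1 hcl
    have hS : f '' (U ∩ Metric.sphere x r) ∈ 𝒰 := h𝒰 self_mem_nhdsWithin
    have hψU : Tendsto ψ 𝒰 (𝓝[U] y) := tendsto_nhdsWithin_iff.2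
      ⟨hψ𝒰, by filter_upwards [hS] with ζ hζ using (hmaps ζ hζ).1⟩
    have hyc : y ∈ closure U :=
      mem_closure_of_tendsto hψ𝒰 (by filter_upwards [hS] with ζ hζ using (hmaps ζ hζ).1)
    have h1 := (tendsto_extendFrom (D.exists_tendsto hl hyc)).comp hψU
    have h2 : Tendsto (f ∘ ψ) 𝒰 (𝓝 w) := by
      refine (tendsto_id.mono_left (h𝒰.trans nhdsWithin_le_nhds)).congr' ?_
      filter_upwards [hS] with ζ hζ
      obtain ⟨z, hz, rfl⟩ := hζ
      simp [D.left_inv z hz.1]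
    have hFy : extendFrom U f y = w := tendsto_nhds_unique h1 h2
    have hyU : y ∉ U := fun hyU => by
      rw [D.extend_eq hyU] at hFy
      have := D.mem y hyU
      rw [hFy, mem_ball_zero_iff, hw1] at this
      exact lt_irrefl _ this
    have hyf : y ∈ frontier U := by rw [D.isOpen.frontier_eq]; exact ⟨hyc, hyU⟩
    have := D.extend_injOn_frontier hl hyf hx hFy
    rw [this, Metric.mem_sphere, dist_self] at hy
    exact hr.ne hy

end DiscChart

end

/-- `G` maps the closure of `U` homeomorphically onto a subset of the closed upper half-plane,
sending `U` onto the open half-plane and the frontier into the real axis; `Ψ` is the inverse. -/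
structure HalfPlaneChart (U : Set ℂ) (G Ψ : ℂ → ℂ) : Prop where
  continuousOn : ContinuousOn G (closure U)
  continuousOn_symm : ContinuousOn Ψ (G '' closure U)
  left_inv : ∀ z ∈ closure U, Ψ (G z) = z
  image_eq : G '' U = {w | 0 < w.im}
  im_eq_zero : ∀ z ∈ frontier U, (G z).im = 0

theorem DiscChart.exists_unit_notMem {U : Set ℂ} {f ψ : ℂ → ℂ} (D : DiscChart U f ψ)
    (hl : ∀ x ∈ frontier U, LocConnAt U x) (hb : ¬ IsBounded U) :
    ∃ w : ℂ, ‖w‖ = 1 ∧ ∀ z ∈ closure U, extendFrom U f z ≠ w := by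
  by_contra! hcon
  have key : IsBounded (ψ '' (Metric.closedBall 0 1 ∩ Metric.ball 0 1)) := by
    refine (isCompact_closedBall (0 : ℂ) 1).induction_on
      (p := fun s => IsBounded (ψ '' (s ∩ Metric.ball 0 1))) (by simp)
      (fun s t hst ht => ht.subset (image_mono (inter_subset_inter_left _ hst)))
      (fun s t hs ht => by rw [union_inter_distrib_right, image_union]; exact hs.union ht) ?_
    intro w hw
    obtain ⟨x, hx⟩ : ∃ x, Tendsto ψ (𝓝[Metric.ball 0 1] w) (𝓝 x) := by
      rcases (mem_closedBall_zero_iff.1 hw).lt_or_eq with h | h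
      · exact ⟨ψ w, (D.continuousAt_symm (mem_ball_zero_iff.2 h)).continuousWithinAt⟩
      · obtain ⟨z, hz, rfl⟩ := hcon w h
        have hzU : z ∉ U := fun hzU => by
          rw [D.extend_eq hzU] at h
          exact (mem_ball_zero_iff.1 (D.mem z hzU)).ne h
        exact ⟨z, D.tendsto_symm hl (by rw [D.isOpen.frontier_eq]; exact ⟨hz, hzU⟩)⟩
    obtain ⟨t, ht, hts⟩ := mem_nhdsWithin_iff_exists_mem_nhds_inter.1
      (hx (Metric.ball_mem_nhds x one_pos))
    exact ⟨t, mem_nhdsWithin_of_mem_nhds ht, Metric.isBounded_ball.subset (image_subset_iff.2 hts)⟩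
  refine hb (key.subset fun z hz => ⟨f z, ⟨?_, D.mem z hz⟩, D.left_inv z hz⟩)
  exact Metric.ball_subset_closedBall (D.mem z hz)

theorem DiscChart.exists_halfPlaneChart {U : Set ℂ} {f ψ : ℂ → ℂ} (D : DiscChart U f ψ)
    (hl : ∀ x ∈ frontier U, LocConnAt U x) (hb : ¬ IsBounded U) :
    ∃ G Ψ, HalfPlaneChart U G Ψ := by
  obtain ⟨w₀, hw₀, hne⟩ := D.exists_unit_notMem hl hb
  set F := extendFrom U f with hF
  set Φ := extendFrom (Metric.ball (0 : ℂ) 1) ψ with hΦ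
  have hw₀' : w₀ ≠ 0 := norm_ne_zero_iff.1 (by rw [hw₀]; exact one_ne_zero)
  have hcases : ∀ z ∈ closure U, z ∈ U ∨ z ∈ frontier U := fun z hz => by
    rw [D.isOpen.frontier_eq]
    exact (em (z ∈ U)).imp id fun h => ⟨hz, h⟩
  have hFle : ∀ z ∈ closure U, F z ∈ closure (Metric.ball (0 : ℂ) 1) := fun z hz => by
    rw [closure_ball _ one_ne_zero, mem_closedBall_zero_iff]
    rcases hcases z hz with h | h
    · rw [hF, D.extend_eq h]
      exact (mem_ball_zero_iff.1 (D.mem z h)).le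
    · exact (D.norm_extend hl h).le
  have hlim : ∀ z ∈ closure U, Tendsto ψ (𝓝[Metric.ball 0 1] (F z)) (𝓝 z) := fun z hz => by
    rcases hcases z hz with h | h
    · rw [hF, D.extend_eq h]
      have := (D.continuousAt_symm (D.mem z h)).tendsto
      rw [D.left_inv z h] at this
      exact this.mono_left nhdsWithin_le_nhds
    · exact D.tendsto_symm hl h
  have hΦF : ∀ z ∈ closure U, Φ (F z) = z := fun z hz => extendFrom_eq (hFle z hz) (hlim z hz)
  have hΦc : ContinuousOn Φ (F '' closure U) :=
    continuousOn_extendFrom (image_subset_iff.2 hFle)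
      (by rintro _ ⟨z, hz, rfl⟩; exact ⟨z, hlim z hz⟩)
  set κ : ℂ → ℂ := fun ζ => I * (w₀ + ζ) / (w₀ - ζ) with hκ
  set κ' : ℂ → ℂ := fun η => w₀ * (η - I) / (η + I) with hκ'
  have hκκ : ∀ ζ, ζ ≠ w₀ → κ' (κ ζ) = ζ := fun ζ hζ => by
    have h1 : w₀ - ζ ≠ 0 := sub_ne_zero.2 hζ.symm
    have h2 : I * (w₀ + ζ) / (w₀ - ζ) + I = 2 * I * w₀ / (w₀ - ζ) := by
      field_simp
      ring
    have h3 : I * (w₀ + ζ) / (w₀ - ζ) - I = 2 * I * ζ / (w₀ - ζ) := by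
      field_simp
      ring
    simp only [hκ, hκ', h2, h3]
    field_simp
  have hκim : ∀ ζ, ζ ≠ w₀ → (κ ζ).im = (1 - ‖ζ‖ ^ 2) / normSq (w₀ - ζ) := fun ζ hζ => by
    have h1 : normSq w₀ = 1 := by rw [normSq_eq_norm_sq, hw₀, one_pow]
    rw [normSq_apply] at h1
    rw [← normSq_eq_norm_sq, normSq_apply ζ, hκ]
    simp only [div_im, mul_re, mul_im, I_re, I_im, add_re, add_im, sub_re, sub_im]
    rw [← sub_div]
    congr 1
    linear_combination h1
  have hκim' : ∀ ζ, ζ ≠ w₀ → ‖ζ‖ ≤ 1 → 0 ≤ (κ ζ).im := fun ζ hζ h1 => by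
    rw [hκim ζ hζ]
    have := pow_le_one₀ (n := 2) (norm_nonneg ζ) h1
    exact div_nonneg (by linarith) (normSq_nonneg _)
  have hImt : ∀ z ∈ closure U, 0 ≤ (κ (F z)).im := fun z hz => by
    refine hκim' _ (hne z hz) ?_
    have := hFle z hz
    rwa [closure_ball _ one_ne_zero, mem_closedBall_zero_iff] at this
  have hκ'c : ContinuousOn κ' (κ ∘ F '' closure U) := by
    refine ContinuousOn.div (by fun_prop) (by fun_prop) ?_
    rintro _ ⟨z, hz, rfl⟩ h
    have h1 := congrArg im h
    have h2 := hImt z hz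
    simp only [add_im, I_im, zero_im, Function.comp_apply] at h1
    linarith
  refine ⟨κ ∘ F, Φ ∘ κ', ?_, ?_, ?_, ?_, ?_⟩
  · refine ContinuousOn.comp (t := {w₀}ᶜ) ?_ (D.continuousOn_extend hl) hne
    exact ContinuousOn.div (by fun_prop) (by fun_prop) fun ζ hζ => sub_ne_zero.2 (Ne.symm hζ)
  · refine hΦc.comp hκ'c ?_
    rintro _ ⟨z, hz, rfl⟩
    exact ⟨z, hz, (hκκ _ (hne z hz)).symm⟩
  · intro z hz
    simp only [Function.comp_apply]
    rw [hκκ _ (hne z hz), hΦF z hz]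
  · ext η
    constructor
    · rintro ⟨z, hz, rfl⟩
      have hz' := subset_closure hz
      have h1 := mem_ball_zero_iff.1 (D.mem z hz)
      rw [mem_ofPred_eq, Function.comp_apply, hκim _ (hne z hz')]
      refine div_pos ?_ (normSq_pos.2 (sub_ne_zero.2 (hne z hz').symm))
      rw [hF, D.extend_eq hz]
      have := (sq_lt_one_iff₀ (norm_nonneg (f z))).2 h1
      linarith
    · intro hη
      rw [mem_ofPred_eq] at hη
      have h1 : η + I ≠ 0 := fun h => by
        have := congrArg im h
        simp only [add_im, I_im, zero_im] at this
        linarith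
      have h2 : κ' η ∈ Metric.ball (0 : ℂ) 1 := by
        rw [mem_ball_zero_iff, hκ']
        simp only [norm_div, norm_mul, hw₀, one_mul]
        rw [div_lt_one (norm_pos_iff.2 h1)]
        refine lt_of_pow_lt_pow_left₀ 2 (norm_nonneg _) ?_
        rw [← normSq_eq_norm_sq, ← normSq_eq_norm_sq, normSq_apply, normSq_apply]
        simp only [sub_re, sub_im, add_re, add_im, I_re, I_im]
        nlinarith
      refine ⟨ψ (κ' η), D.mem_symm _ h2, ?_⟩
      rw [Function.comp_apply, hF, D.extend_eq (D.mem_symm _ h2), D.right_inv _ h2]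
      have h3 : w₀ - w₀ * (η - I) / (η + I) = 2 * I * w₀ / (η + I) := by
        field_simp
        ring
      have h4 : w₀ + w₀ * (η - I) / (η + I) = 2 * η * w₀ / (η + I) := by
        field_simp
        ring
      simp only [hκ, hκ', h3, h4]
      field_simp
  · intro z hz
    have hz' := frontier_subset_closure hz
    rw [Function.comp_apply, hκim _ (hne z hz'), D.norm_extend hl hz]
    simp

/-! ### Dynamics on the line -/

section Line

theorem exists_lt_pow_apply (K : ℝ ≃o ℝ) (hK : ∀ x, x < K x) (y : ℝ) :
    ∃ n : ℕ, y < (K ^ n) 0 := by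
  by_contra! h
  have hs : ∀ n : ℕ, (K ^ (n + 1)) 0 = K ((K ^ n) 0) := fun n => by
    rw [pow_succ']
    rfl
  have hmono : Monotone fun n : ℕ => (K ^ n) 0 :=
    monotone_nat_of_le_succ fun n => by rw [hs]; exact (hK _).le
  obtain ⟨l, hl⟩ : ∃ l, Tendsto (fun n : ℕ => (K ^ n) 0) atTop (𝓝 l) :=
    ⟨_, tendsto_atTop_ciSup hmono ⟨y, by rintro _ ⟨n, rfl⟩; exact h n⟩⟩
  have h1 := (K.continuous.tendsto l).comp hl
  have h2 := hl.comp (tendsto_add_atTop_nat 1)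
  have h3 : K l = l := tendsto_nhds_unique h1 (h2.congr fun n => hs n)
  exact (hK l).ne' h3

theorem exists_conj_add_one_of_lt (K : ℝ ≃o ℝ) (hK : ∀ x, x < K x) :
    ∃ u : ℝ ≃ₜ ℝ, ∀ s, K (u s) = u (s + 1) := by
  have hc : 0 < K 0 := hK 0
  have hs : ∀ (n : ℤ) x, (K ^ (n + 1)) x = K ((K ^ n) x) := fun n x => by
    rw [add_comm, zpow_add, zpow_one]
    rfl
  have hs' : ∀ (n : ℤ) x, (K ^ (n + 1)) x = (K ^ n) (K x) := fun n x => by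
    rw [zpow_add, zpow_one]
    rfl
  have horb : StrictMono fun n : ℤ => (K ^ n) 0 :=
    strictMono_int_of_lt_succ fun n => by rw [hs]; exact hK _
  set u : ℝ → ℝ := fun s => (K ^ ⌊s⌋) (Int.fract s * K 0) with hu
  have hmono : StrictMono u := by
    intro s t hst
    rcases (Int.floor_mono hst.le).lt_or_eq with h | h
    · calc u s < (K ^ ⌊s⌋) (K 0) := (K ^ ⌊s⌋).strictMono (by
            nlinarith [Int.fract_lt_one s])
        _ = (K ^ (⌊s⌋ + 1)) 0 := (hs' _ _).symm
        _ ≤ (K ^ ⌊t⌋) 0 := horb.monotone h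
        _ ≤ u t := (K ^ ⌊t⌋).monotone (mul_nonneg (Int.fract_nonneg t) hc.le)
    · simp only [hu, ← h]
      refine (K ^ ⌊s⌋).strictMono (mul_lt_mul_of_pos_right ?_ hc)
      rw [Int.fract, Int.fract, ← h]
      linarith
  have hsurj : Function.Surjective u := by
    intro y
    obtain ⟨n₁, hn₁⟩ := exists_lt_pow_apply K hK y
    obtain ⟨n₂, hn₂⟩ : ∃ n : ℤ, (K ^ n) 0 ≤ y := by
      have hsy : ∀ x, K.symm x < x := fun x => by
        have := hK (K.symm x)
        rwa [K.apply_symm_apply] at this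
      set K' : ℝ ≃o ℝ := (OrderIso.neg ℝ).trans (K.symm.dual.trans (OrderIso.neg ℝ).symm)
      have hK' : ∀ x, K' x = - K.symm (-x) := fun x => rfl
      obtain ⟨n, hn⟩ := exists_lt_pow_apply K' (fun x => by rw [hK']; linarith [hsy (-x)]) (-y)
      have hpow : ∀ n : ℕ, (K' ^ n) 0 = - (K ^ (-(n : ℤ))) 0 := by
        intro n
        induction n with
        | zero => simp
        | succ n ih =>
          have h1 : (K' ^ (n + 1)) 0 = K' ((K' ^ n) 0) := by rw [pow_succ']; rfl
          have h2 : K ((K ^ (-((n + 1 : ℕ) : ℤ))) 0) = (K ^ (-(n : ℤ))) 0 := by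
            rw [← hs]
            congr 2
            push_cast
            ring
          rw [h1, ih, hK', neg_neg, ← h2, K.symm_apply_apply]
      rw [hpow] at hn
      exact ⟨_, by linarith⟩
    obtain ⟨n, hn, hmax⟩ := Int.exists_greatest_of_bdd (P := fun n => (K ^ n) 0 ≤ y)
      ⟨n₁, fun m hm => by
        by_contra! hlt
        have h1 := horb hlt
        simp only [zpow_natCast] at h1
        linarith⟩ ⟨n₂, hn₂⟩
    have hn1 : y < (K ^ n) (K 0) := by
      rw [← hs']
      by_contra! hcon
      have := hmax _ hcon
      linarith
    set x := (K ^ n).symm y with hx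
    have hxy : (K ^ n) x = y := (K ^ n).apply_symm_apply y
    rw [← hxy] at hn hn1
    have h0 : 0 ≤ x := (K ^ n).le_iff_le.1 hn
    have h1 : x < K 0 := (K ^ n).lt_iff_lt.1 hn1
    have h2 : x / K 0 ∈ Ico (0 : ℝ) 1 := ⟨div_nonneg h0 hc.le, (div_lt_one hc).2 h1⟩
    refine ⟨n + x / K 0, ?_⟩
    have hfl : ⌊(n : ℝ) + x / K 0⌋ = n := by
      rw [Int.floor_intCast_add, Int.floor_eq_zero_iff.2 h2, add_zero]
    have hfr : Int.fract ((n : ℝ) + x / K 0) = x / K 0 := by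
      rw [Int.fract_intCast_add, Int.fract_eq_self.2 h2]
    simp only [hu, hfl, hfr]
    rw [div_mul_cancel₀ _ hc.ne', hxy]
  refine ⟨(hmono.orderIsoOfSurjective u hsurj).toHomeomorph, fun s => ?_⟩
  change K (u s) = u (s + 1)
  simp only [hu, Int.floor_add_one, Int.fract_add_one, hs]

/-- A fixed point free homeomorphism of the line is conjugate to a translation. -/
theorem exists_conj_add_one {k : ℝ → ℝ} (hk : Continuous k) (hb : Function.Bijective k)
    (hfix : ∀ x, k x ≠ x) : ∃ u : ℝ ≃ₜ ℝ, ∀ s, k (u s) = u (s + 1) := by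
  have hzero : ∀ a b, a ≤ k a → k b ≤ b → False := fun a b ha hb => by
    obtain ⟨x, -, hx⟩ := isPreconnected_univ.intermediate_value₂ (mem_univ a) (mem_univ b)
      continuous_id.continuousOn hk.continuousOn ha hb
    exact hfix x hx.symm
  rcases hk.strictMono_of_inj hb.1 with hm | hm
  · set K := hm.orderIsoOfSurjective k hb.2
    rcases lt_or_gt_of_ne (hfix 0) with h0 | h0
    · have hlt : ∀ x, k x < x := fun x => by
        by_contra! hcon
        exact hzero x 0 hcon h0.le
      obtain ⟨u, hu⟩ := exists_conj_add_one_of_lt K.symm fun x => by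
        have := hlt (K.symm x)
        change K (K.symm x) < _ at this
        rwa [K.apply_symm_apply] at this
      refine ⟨(Homeomorph.neg ℝ).trans u, fun s => ?_⟩
      have h1 := hu (-s - 1)
      rw [sub_add_cancel, K.symm_apply_eq] at h1
      change K (u (-s)) = u (-(s + 1))
      rw [← h1, neg_add']
    · exact exists_conj_add_one_of_lt K fun x => by
        by_contra! hcon
        exact hzero 0 x h0.le hcon
  · exfalso
    rcases le_total (k 0) 0 with h | h
    · exact hzero (k 0) 0 (hm.antitone h) h
    · exact hzero 0 (k 0) h (hm.antitone h)

open Classical in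
/-- The flow on the line which translates the parameter of each of the curves `e i` and fixes all
other points. -/
noncomputable def lineFlow {A : Type} (e : A → ℝ → ℝ) (t x : ℝ) : ℝ :=
  if h : ∃ p : A × ℝ, e p.1 p.2 = x then e h.choose.1 (h.choose.2 + t) else x

variable {A : Type} {e : A → ℝ → ℝ}

theorem lineFlow_apply (hinj : ∀ i j s t, e i s = e j t → i = j ∧ s = t) (t : ℝ) (i : A) (s : ℝ) :
    lineFlow e t (e i s) = e i (s + t) := by
  have h : ∃ p : A × ℝ, e p.1 p.2 = e i s := ⟨(i, s), rfl⟩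
  obtain ⟨h1, h2⟩ := hinj _ _ _ _ h.choose_spec
  rw [lineFlow, dif_pos h, h1, h2]

theorem lineFlow_of_forall_ne {x : ℝ} (hx : ∀ i s, e i s ≠ x) (t : ℝ) : lineFlow e t x = x := by
  rw [lineFlow, dif_neg]
  rintro ⟨p, hp⟩
  exact hx _ _ hp

theorem lineFlow_cases (e : A → ℝ → ℝ) (x : ℝ) : (∃ i s, e i s = x) ∨ ∀ i s, e i s ≠ x := by
  by_cases h : ∃ i s, e i s = x
  · exact Or.inl h
  · exact Or.inr fun i s hs => h ⟨i, s, hs⟩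

theorem lineFlow_zero (hinj : ∀ i j s t, e i s = e j t → i = j ∧ s = t) (x : ℝ) :
    lineFlow e 0 x = x := by
  rcases lineFlow_cases e x with ⟨i, s, rfl⟩ | h
  · rw [lineFlow_apply hinj, add_zero]
  · exact lineFlow_of_forall_ne h 0

theorem lineFlow_add (hinj : ∀ i j s t, e i s = e j t → i = j ∧ s = t) (s t x : ℝ) :
    lineFlow e (s + t) x = lineFlow e s (lineFlow e t x) := by
  rcases lineFlow_cases e x with ⟨i, r, rfl⟩ | h
  · rw [lineFlow_apply hinj, lineFlow_apply hinj, lineFlow_apply hinj]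
    congr 1
    ring
  · rw [lineFlow_of_forall_ne h, lineFlow_of_forall_ne h, lineFlow_of_forall_ne h]

theorem lt_of_ordConnected {P Q : Set ℝ} (hP : P.OrdConnected) (hQ : Q.OrdConnected)
    (hPQ : Disjoint P Q) {x y p q : ℝ} (hx : x ∈ P) (hp : p ∈ P) (hy : y ∈ Q) (hq : q ∈ Q)
    (hxy : x < y) : p < q := by
  by_contra! h
  rcases le_or_gt q x with h1 | h1
  · exact disjoint_left.1 hPQ hx (hQ.out hq hy ⟨h1, hxy.le⟩)
  · exact disjoint_left.1 hPQ (hP.out hx hp ⟨h1.le, h⟩) hq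

theorem lineFlow_strictMono (he : ∀ i, Continuous (e i))
    (hinj : ∀ i j s t, e i s = e j t → i = j ∧ s = t) (t : ℝ) : StrictMono (lineFlow e t) := by
  have hoc : ∀ i, (range (e i)).OrdConnected := fun i => (isPreconnected_range (he i)).ordConnected
  have hsing : ∀ x : ℝ, ({x} : Set ℝ).OrdConnected := fun x => ordConnected_singleton
  intro x y hxy
  rcases lineFlow_cases e x with ⟨i, a, rfl⟩ | hx <;>
    rcases lineFlow_cases e y with ⟨j, b, rfl⟩ | hy
  · rw [lineFlow_apply hinj, lineFlow_apply hinj]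
    by_cases hij : i = j
    · subst hij
      rcases (he i).strictMono_of_inj (fun s t h => (hinj i i s t h).2) with hm | hm
      · exact hm (by linarith [hm.lt_iff_lt.1 hxy])
      · exact hm (by linarith [hm.lt_iff_gt.1 hxy])
    · refine lt_of_ordConnected (hoc i) (hoc j) ?_ ⟨a, rfl⟩ ⟨_, rfl⟩ ⟨b, rfl⟩ ⟨_, rfl⟩ hxy
      rw [disjoint_left]
      rintro _ ⟨s, rfl⟩ ⟨s', h⟩
      exact hij (hinj _ _ _ _ h).1.symm
  · rw [lineFlow_apply hinj, lineFlow_of_forall_ne hy]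
    refine lt_of_ordConnected (hoc i) (hsing y) ?_ ⟨a, rfl⟩ ⟨_, rfl⟩ rfl rfl hxy
    rw [disjoint_singleton_right]
    rintro ⟨s, h⟩
    exact hy _ _ h
  · rw [lineFlow_apply hinj, lineFlow_of_forall_ne hx]
    refine lt_of_ordConnected (hsing x) (hoc j) ?_ rfl rfl ⟨b, rfl⟩ ⟨_, rfl⟩ hxy
    rw [disjoint_singleton_left]
    rintro ⟨s, h⟩
    exact hx _ _ h
  · rwa [lineFlow_of_forall_ne hx, lineFlow_of_forall_ne hy]

theorem continuous_lineFlow (he : ∀ i, Continuous (e i))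
    (hinj : ∀ i j s t, e i s = e j t → i = j ∧ s = t) :
    Continuous fun p : ℝ × ℝ => lineFlow e p.1 p.2 := by
  have hmono := lineFlow_strictMono he hinj
  have hx : ∀ t, Continuous (lineFlow e t) := fun t =>
    ((hmono t).orderIsoOfSurjective _ fun y => ⟨lineFlow e (-t) y, by
      rw [← lineFlow_add hinj, add_neg_cancel, lineFlow_zero hinj]⟩).continuous
  have ht : ∀ x, Continuous fun t => lineFlow e t x := fun x => by
    rcases lineFlow_cases e x with ⟨i, s, rfl⟩ | h
    · simp only [lineFlow_apply hinj]
      exact (he i).comp (by fun_prop)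
    · simp only [lineFlow_of_forall_ne h]
      exact continuous_const
  rw [continuous_iff_continuousAt]
  rintro ⟨t₀, x₀⟩
  refine tendsto_order.2 ⟨fun a ha => ?_, fun a ha => ?_⟩
  · obtain ⟨x₁, hx₁, hx₁a⟩ : ∃ x₁ < x₀, a < lineFlow e t₀ x₁ := by
      have h1 : ∀ᶠ x in 𝓝[<] x₀, a < lineFlow e t₀ x :=
        ((hx t₀).tendsto x₀).mono_left nhdsWithin_le_nhds |>.eventually (lt_mem_nhds ha)
      exact ((eventually_mem_nhdsWithin (s := Iio x₀)).and h1).exists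
    filter_upwards [((ht x₁).tendsto t₀).eventually (lt_mem_nhds hx₁a) |>.prod_nhds
      (lt_mem_nhds hx₁)] with p hp
    exact hp.1.trans (hmono p.1 hp.2)
  · obtain ⟨x₁, hx₁, hx₁a⟩ : ∃ x₁ > x₀, lineFlow e t₀ x₁ < a := by
      have h1 : ∀ᶠ x in 𝓝[>] x₀, lineFlow e t₀ x < a :=
        ((hx t₀).tendsto x₀).mono_left nhdsWithin_le_nhds |>.eventually (gt_mem_nhds ha)
      exact ((eventually_mem_nhdsWithin (s := Ioi x₀)).and h1).exists
    filter_upwards [((ht x₁).tendsto t₀).eventually (gt_mem_nhds hx₁a) |>.prod_nhds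
      (gt_mem_nhds hx₁)] with p hp
    exact (hmono p.1 hp.2).trans hp.1

end Line

namespace HalfPlaneChart

variable {U : Set ℂ} {G Ψ : ℂ → ℂ}

theorem right_inv (h : HalfPlaneChart U G Ψ) {w : ℂ} (hw : w ∈ G '' closure U) : G (Ψ w) = w := by
  obtain ⟨z, hz, rfl⟩ := hw
  rw [h.left_inv z hz]

theorem mem_image_of_im_pos (h : HalfPlaneChart U G Ψ)
    {w : ℂ} (hw : 0 < w.im) : w ∈ G '' closure U := by
  have : w ∈ G '' U := by rw [h.image_eq]; exact hw
  exact image_mono subset_closure this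

theorem symm_mem_of_im_pos (h : HalfPlaneChart U G Ψ) {w : ℂ} (hw : 0 < w.im) : Ψ w ∈ U := by
  have : w ∈ G '' U := by rw [h.image_eq]; exact hw
  obtain ⟨z, hz, rfl⟩ := this
  rwa [h.left_inv z (subset_closure hz)]

theorem im_pos (h : HalfPlaneChart U G Ψ) {z : ℂ} (hz : z ∈ U) : 0 < (G z).im := by
  have : G z ∈ G '' U := mem_image_of_mem G hz
  rwa [h.image_eq] at this

end HalfPlaneChart

namespace LineFamily

variable {ι : Type} (Γ : LineFamily ι) [Finite ι]

theorem exists_ball_disjoint_others (i : ι) (c : ℝ) :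
    ∃ r > 0, Disjoint (Metric.ball (Γ.γ i c) r) (Γ.others i) := by
  obtain ⟨r, hr, hb⟩ := Metric.isOpen_iff.1 (Γ.isClosed_others i).isOpen_compl (Γ.γ i c)
    (disjoint_left.1 (Γ.disjoint_range_others i) ⟨c, rfl⟩)
  exact ⟨r, hr, disjoint_left.2 hb⟩

theorem range_subset_closure_of_mem {U : Set ℂ} (hU : IsComponent Γ.carrierᶜ U) {i : ι} {c : ℝ}
    (h : Γ.γ i c ∈ closure U) : range (Γ.γ i) ⊆ closure U := by
  obtain ⟨r, hr, hd⟩ := Γ.exists_ball_disjoint_others i c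
  obtain ⟨p, hpU, hp⟩ := Metric.mem_closure_iff.1 h r hr
  exact Γ.range_subset_closure hd hU (by rwa [Metric.mem_ball, dist_comm]) hpU

theorem mem_frontier {U : Set ℂ} (hU : IsComponent Γ.carrierᶜ U) {i : ι} {c : ℝ}
    (h : Γ.γ i c ∈ closure U) : Γ.γ i c ∈ frontier U := by
  rw [(hU.isOpen Γ.isClosed_carrier.isOpen_compl).frontier_eq]
  exact ⟨h, fun hc => hU.subset hc (Γ.γ_mem i c)⟩

theorem exists_eq_of_mem_frontier {U : Set ℂ} (hU : IsComponent Γ.carrierᶜ U) {z : ℂ}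
    (h : z ∈ frontier U) : ∃ i c, Γ.γ i c = z := by
  have := hU.frontier_subset Γ.isClosed_carrier.isOpen_compl h
  rw [compl_compl] at this
  simpa [carrier] using this

theorem exists_halfPlaneChart [Nonempty ι] {U : Set ℂ} (hU : IsComponent Γ.carrierᶜ U) :
    ∃ G Ψ, HalfPlaneChart U G Ψ := by
  have hO := Γ.isClosed_carrier.isOpen_compl
  have hne : U ≠ univ := fun h => by
    obtain ⟨i⟩ := ‹Nonempty ι›
    exact hU.subset (h ▸ mem_univ (Γ.γ i 0)) (Γ.γ_mem i 0)
  obtain ⟨f, ψ, D⟩ := exists_discChart ⟨hU.isOpen hO, hU.isPreconnected,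
    fun z hz => Γ.exists_unbounded_connected_compl hU hz⟩ hU.nonempty hne
  refine D.exists_halfPlaneChart (fun x hx ε hε => ?_) fun hb => ?_
  · obtain ⟨i, c, rfl⟩ := Γ.exists_eq_of_mem_frontier hU hx
    obtain ⟨δ, hδ, -, h⟩ := Γ.exists_isPreconnected_ball i c hε
    exact ⟨δ, hδ, h U hU⟩
  · obtain ⟨x, hx⟩ : (frontier U).Nonempty := nonempty_frontier_iff.2 ⟨hU.nonempty, hne⟩
    obtain ⟨i, c, rfl⟩ := Γ.exists_eq_of_mem_frontier hU hx
    exact not_isBounded_range (Γ.emb i) (hb.closure.subset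
      (Γ.range_subset_closure_of_mem hU (frontier_subset_closure hx)))

/-- Each closed complementary component carries a flow without fixed points in the interior which
translates the parameters of the boundary lines. -/
theorem exists_flow_closure [Nonempty ι] {U : Set ℂ} (hU : IsComponent Γ.carrierᶜ U) :
    ∃ φ : ℝ → ℂ → ℂ, ContinuousOn (fun p : ℝ × ℂ => φ p.1 p.2) (univ ×ˢ closure U) ∧
      (∀ t, MapsTo (φ t) U U) ∧ (∀ z ∈ U, φ 0 z = z) ∧
      (∀ s t, ∀ z ∈ U, φ (s + t) z = φ s (φ t z)) ∧ (∀ z ∈ U, φ 1 z ≠ z) ∧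
      ∀ i s t, Γ.γ i s ∈ closure U → φ t (Γ.γ i s) = Γ.γ i (s + t) := by
  obtain ⟨G, Ψ, h⟩ := Γ.exists_halfPlaneChart hU
  set A := {i : ι // range (Γ.γ i) ⊆ closure U} with hA
  set e : A → ℝ → ℝ := fun i s => (G (Γ.γ i s)).re with he
  have hcl : ∀ (i : A) s, Γ.γ i s ∈ closure U := fun i s => i.2 ⟨s, rfl⟩
  have hG : ∀ (i : A) s, G (Γ.γ i s) = e i s := fun i s => by
    apply Complex.ext
    · simp [he]
    · simpa using h.im_eq_zero _ (Γ.mem_frontier hU (hcl i s))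
  have hec : ∀ i, Continuous (e i) := fun i => continuous_re.comp
    (h.continuousOn.comp_continuous (Γ.emb i).continuous (hcl i))
  have hinj : ∀ i j s t, e i s = e j t → i = j ∧ s = t := fun i j s t hst => by
    have h1 : G (Γ.γ i s) = G (Γ.γ j t) := by rw [hG, hG, hst]
    have h2 : Γ.γ i s = Γ.γ j t := by
      rw [← h.left_inv _ (hcl i s), h1, h.left_inv _ (hcl j t)]
    have h3 : i = j := Subtype.ext (Γ.index_eq h2)
    subst h3
    exact ⟨rfl, Γ.param_eq h2⟩
  set H : ℝ → ℂ → ℂ := fun t w => (lineFlow e t w.re : ℝ) + (Real.exp t * w.im : ℝ) * I with hH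
  have hHre : ∀ t w, (H t w).re = lineFlow e t w.re := fun t w => by simp [hH]
  have hHim : ∀ t w, (H t w).im = Real.exp t * w.im := fun t w => by
    simp only [hH, add_im, ofReal_im, im_ofReal_mul, I_im, mul_one, zero_add]
  have hHc : Continuous fun p : ℝ × ℂ => H p.1 p.2 := by
    have h1 : Continuous fun p : ℝ × ℂ => lineFlow e p.1 p.2.re :=
      (continuous_lineFlow hec hinj).comp
        (continuous_fst.prodMk (continuous_re.comp continuous_snd))
    have h2 : Continuous fun p : ℝ × ℂ => Real.exp p.1 * p.2.im :=
      (Real.continuous_exp.comp continuous_fst).mul (continuous_im.comp continuous_snd)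
    exact (continuous_ofReal.comp h1).add ((continuous_ofReal.comp h2).mul continuous_const)
  have hHe : ∀ t i s, H t (e i s) = e i (s + t) := fun t i s => by
    apply Complex.ext
    · rw [hHre, ofReal_re, ofReal_re, lineFlow_apply hinj]
    · rw [hHim, ofReal_im, ofReal_im, mul_zero]
  have hHpos : ∀ t w, 0 < w.im → 0 < (H t w).im := fun t w hw => by
    rw [hHim]
    exact mul_pos (Real.exp_pos t) hw
  have hcases : ∀ z ∈ closure U, z ∈ U ∨ ∃ (i : A) (s : ℝ), z = Γ.γ i s := fun z hz => by
    by_cases hzU : z ∈ U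
    · exact Or.inl hzU
    · have hzf : z ∈ frontier U := by
        rw [(hU.isOpen Γ.isClosed_carrier.isOpen_compl).frontier_eq]
        exact ⟨hz, hzU⟩
      obtain ⟨i, s, rfl⟩ := Γ.exists_eq_of_mem_frontier hU hzf
      exact Or.inr ⟨⟨i, Γ.range_subset_closure_of_mem hU hz⟩, s, rfl⟩
  have hHmem : ∀ t, ∀ z ∈ closure U, H t (G z) ∈ G '' closure U := fun t z hz => by
    rcases hcases z hz with hzU | ⟨i, s, rfl⟩
    · exact h.mem_image_of_im_pos (hHpos t _ (h.im_pos hzU))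
    · rw [hG, hHe, ← hG]
      exact mem_image_of_mem G (hcl i _)
  refine ⟨fun t z => Ψ (H t (G z)), ?_, fun t z hz => ?_, fun z hz => ?_, fun s t z hz => ?_,
    fun z hz heq => ?_, fun i s t hi => ?_⟩
  · refine h.continuousOn_symm.comp (hHc.comp_continuousOn (continuousOn_fst.prodMk
      (h.continuousOn.comp continuousOn_snd fun p hp => hp.2))) fun p hp => hHmem p.1 p.2 hp.2
  · exact h.symm_mem_of_im_pos (hHpos t _ (h.im_pos hz))
  · have h1 : H 0 (G z) = G z := by
      apply Complex.ext
      · rw [hHre, lineFlow_zero hinj]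
      · rw [hHim, Real.exp_zero, one_mul]
    change Ψ (H 0 (G z)) = z
    rw [h1, h.left_inv z (subset_closure hz)]
  · change Ψ (H (s + t) (G z)) = Ψ (H s (G (Ψ (H t (G z)))))
    rw [h.right_inv (hHmem t z (subset_closure hz))]
    congr 1
    apply Complex.ext
    · rw [hHre, hHre, hHre, lineFlow_add hinj]
    · rw [hHim, hHim, hHim, Real.exp_add, mul_assoc]
  · have h1 := congrArg G heq
    rw [h.right_inv (hHmem 1 z (subset_closure hz))] at h1
    have h2 := congrArg im h1
    rw [hHim] at h2
    have h3 := h.im_pos hz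
    have h4 := Real.one_lt_exp_iff.2 one_pos
    nlinarith
  · have hiA : range (Γ.γ i) ⊆ closure U := Γ.range_subset_closure_of_mem hU hi
    have h1 := hG ⟨i, hiA⟩
    have h2 := hHe t ⟨i, hiA⟩ s
    change Ψ (H t (G (Γ.γ i s))) = _
    rw [h1 s, h2, ← h1, h.left_inv _ (hiA ⟨_, rfl⟩)]

end LineFamily

/-- A weak form of the invariance of domain in the plane. -/
theorem range_mem_nhds_of_injective {f : ℂ → ℂ} (hf : Continuous f)
    (hinj : Function.Injective f) : range f ∈ 𝓝 (f 0) := by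
  by_contra hcon
  set K : ℝ × ℝ → ℂ := fun p => f (exp (p.1 * I)) - f (-(|p.2| : ℝ) * exp (p.1 * I)) with hK
  have hKc : Continuous K := by
    refine (hf.comp (by fun_prop)).sub (hf.comp ?_)
    exact ((continuous_ofReal.comp (continuous_abs.comp continuous_snd)).neg).mul (by fun_prop)
  have hK0 : ∀ p, K p ≠ 0 := fun p h => by
    have h1 := hinj (sub_eq_zero.1 h)
    have h2 : (1 + (|p.2| : ℝ) : ℂ) = 0 := by
      have := exp_ne_zero (p.1 * I)
      refine (mul_eq_zero.1 (?_ : (1 + (|p.2| : ℝ) : ℂ) * exp (p.1 * I) = 0)).resolve_right this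
      linear_combination h1
    have h3 : 1 + |p.2| = 0 := by exact_mod_cast h2
    linarith [abs_nonneg p.2]
  obtain ⟨L, hLc, hL⟩ := exists_log_of_simplyConnected hKc hK0
  obtain ⟨ζ₀, hζ₀, hmin⟩ := (isCompact_sphere (0 : ℂ) 1).exists_isMinOn ⟨1, by simp⟩
    (f := fun ζ => ‖f ζ - f 0‖) (by fun_prop)
  have hm : 0 < ‖f ζ₀ - f 0‖ := norm_pos_iff.2 (sub_ne_zero.2 fun h => by
    rw [hinj h] at hζ₀
    simp at hζ₀)
  obtain ⟨y, hy, hyr⟩ : ∃ y ∈ Metric.ball (f 0) ‖f ζ₀ - f 0‖, y ∉ range f := by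
    by_contra! h
    exact hcon (mem_of_superset (Metric.ball_mem_nhds _ hm) h)
  obtain ⟨g, hgc, hg⟩ := exists_log_of_simplyConnected (f := fun z => f z - y) (by fun_prop)
    fun z hz => hyr ⟨z, sub_eq_zero.1 hz⟩
  have hcirc : ∀ θ : ℝ, exp (θ * I) ∈ Metric.sphere (0 : ℂ) 1 := fun θ => by
    simp [norm_exp_ofReal_mul_I]
  have hne : ∀ θ : ℝ, f (exp (θ * I)) - f 0 ≠ 0 := fun θ h => by
    have := hinj (sub_eq_zero.1 h)
    exact exp_ne_zero _ this
  set q : ℝ → ℂ := fun θ => (f (exp (θ * I)) - y) / (f (exp (θ * I)) - f 0) with hq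
  have hqs : ∀ θ, q θ ∈ slitPlane := fun θ => by
    refine ball_one_subset_slitPlane ?_
    have h1 : q θ - 1 = (f 0 - y) / (f (exp (θ * I)) - f 0) := by
      rw [hq]
      field_simp [hne θ]
      ring
    have h2 : ‖f ζ₀ - f 0‖ ≤ ‖f (exp (θ * I)) - f 0‖ := hmin (hcirc θ)
    rw [mem_ball_iff_norm, h1, norm_div, div_lt_one (hm.trans_le h2)]
    rw [mem_ball_iff_norm, norm_sub_rev] at hy
    exact hy.trans_le h2
  have hqc : Continuous q := by
    refine Continuous.div ?_ ?_ hne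
    · exact (hf.comp (by fun_prop)).sub continuous_const
    · exact (hf.comp (by fun_prop)).sub continuous_const
  set l : ℝ → ℂ := fun θ => g (exp (θ * I)) - log (q θ) with hl
  have hlc : Continuous l := (hgc.comp (by fun_prop)).sub (hqc.clog hqs)
  have hper : ∀ θ : ℝ, exp ((θ + 2 * Real.pi : ℝ) * I) = exp (θ * I) := fun θ => by
    push_cast
    rw [add_mul]
    exact exp_periodic _
  have hanti : ∀ θ : ℝ, exp ((θ + Real.pi : ℝ) * I) = -exp (θ * I) := fun θ => by
    push_cast
    rw [add_mul, exp_add, exp_pi_mul_I, mul_neg_one]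
  have h1 : ∀ θ, L (θ, 0) - l θ = L (0, 0) - l 0 := fun θ => by
    refine eqOn_const_of_exp_eq_one isPreconnected_univ (u := fun θ => L (θ, 0) - l θ)
      ((hLc.comp (by fun_prop)).sub hlc).continuousOn (fun θ _ => ?_) (mem_univ θ) (mem_univ 0)
    rw [exp_sub, hL, hl, exp_sub, hg, exp_log (slitPlane_ne_zero (hqs θ)), hq, hK]
    have h2 : f (exp (θ * I)) - y ≠ 0 := fun h => hyr ⟨_, sub_eq_zero.1 h⟩
    have h3 := hne θ
    simp only [abs_zero, ofReal_zero, neg_zero, zero_mul]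
    field_simp
  have h2 : ∀ p : ℝ × ℝ, L (p.1 + 2 * Real.pi, p.2) - L p = L (0 + 2 * Real.pi, 0) - L (0, 0) :=
    fun p => by
    refine eqOn_const_of_exp_eq_one isPreconnected_univ
      (u := fun p : ℝ × ℝ => L (p.1 + 2 * Real.pi, p.2) - L p)
      ((hLc.comp (by fun_prop)).sub hLc).continuousOn (fun p _ => ?_) (mem_univ p)
      (mem_univ (0, 0))
    rw [exp_sub, hL, hL, div_eq_one_iff_eq (hK0 p), hK]
    simp only [hper]
  have h3 : l (0 + 2 * Real.pi) = l 0 := by simp only [hl, hq, hper]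
  have h4 := h1 (0 + 2 * Real.pi)
  have h5 : ∀ θ, L (θ + Real.pi, 1) - L (θ, 1) - Real.pi * I =
      L (0 + Real.pi, 1) - L (0, 1) - Real.pi * I := fun θ => by
    refine eqOn_const_of_exp_eq_one isPreconnected_univ
      (u := fun θ => L (θ + Real.pi, 1) - L (θ, 1) - Real.pi * I)
      (((hLc.comp (by fun_prop)).sub (hLc.comp (by fun_prop))).sub
        continuous_const).continuousOn (fun θ _ => ?_) (mem_univ θ) (mem_univ 0)
    rw [exp_sub, exp_sub, hL, hL, exp_pi_mul_I, div_neg, div_one, neg_eq_iff_eq_neg,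
      div_eq_iff (hK0 _), hK]
    simp only [hanti, abs_one, ofReal_one, neg_one_mul, neg_neg]
    ring
  have h6 := h5 Real.pi
  have h7 := h2 (0, 1)
  have h8 : L (0 + Real.pi, 1) = L (0, 1) := by
    have h9 : (0 + 2 * Real.pi : ℝ) = Real.pi + Real.pi := by ring
    rw [h3] at h4
    simp only at h7
    rw [h9] at h7 h4
    rw [zero_add] at h6 ⊢
    linear_combination (1 / 2 : ℂ) * (h7 + h4 - h6)
  have h10 := hK0 (0, 1)
  have h11 : K (0 + Real.pi, 1) = K (0, 1) := by rw [← hL, ← hL, h8]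
  simp only [hK, hanti, abs_one, ofReal_one, neg_one_mul, neg_neg] at h10 h11
  exact h10 (by linear_combination (-1 / 2 : ℂ) * h11)

namespace LineFamily

variable {ι : Type} (Γ : LineFamily ι) [Finite ι]

/-- A half-plane glued along the `i`-th line to a complementary component adjacent to it. -/
theorem exists_collar {U : Set ℂ} (hU : IsComponent Γ.carrierᶜ U) {i : ι} {c : ℝ}
    (hi : Γ.γ i c ∈ closure U) : ∃ P : ℝ → ℝ → ℂ, (Continuous fun p : ℝ × ℝ => P p.1 p.2) ∧
      (∀ u v, 0 < v → P u v ∈ U) ∧ (∀ u, P u 0 = Γ.γ i (c + u)) ∧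
      ∀ u v u' v', 0 ≤ v → 0 ≤ v' → P u v = P u' v' → u = u' ∧ v = v' := by
  have : Nonempty ι := ⟨i⟩
  obtain ⟨G, Ψ, h⟩ := Γ.exists_halfPlaneChart hU
  have hcl : ∀ s, Γ.γ i s ∈ closure U := fun s =>
    Γ.range_subset_closure_of_mem hU hi ⟨s, rfl⟩
  have him : ∀ s, (G (Γ.γ i s)).im = 0 := fun s => h.im_eq_zero _ (Γ.mem_frontier hU (hcl s))
  have him' : ∀ s v : ℝ, (G (Γ.γ i s) + (v : ℂ) * I).im = v := fun s v => by simp [him]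
  have hre : ∀ s v : ℝ, (G (Γ.γ i s) + (v : ℂ) * I).re = (G (Γ.γ i s)).re := fun s v => by simp
  have hmem : ∀ s v : ℝ, 0 ≤ v → G (Γ.γ i s) + (v : ℂ) * I ∈ G '' closure U := fun s v hv => by
    rcases hv.eq_or_lt with rfl | hv
    · rw [ofReal_zero, zero_mul, add_zero]
      exact mem_image_of_mem G (hcl s)
    · exact h.mem_image_of_im_pos (by rwa [him'])
  refine ⟨fun u v => Ψ (G (Γ.γ i (c + u)) + ((max v 0 : ℝ) : ℂ) * I), ?_, fun u v hv => ?_,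
    fun u => ?_, fun u v u' v' hv hv' heq => ?_⟩
  · refine h.continuousOn_symm.comp_continuous (Continuous.add ?_ (by fun_prop))
      fun p => hmem _ _ (le_max_right _ _)
    exact h.continuousOn.comp_continuous ((Γ.emb i).continuous.comp (by fun_prop)) fun p => hcl _
  · refine h.symm_mem_of_im_pos ?_
    rw [him']
    exact hv.trans_le (le_max_left _ _)
  · simp only [max_self, ofReal_zero, zero_mul, add_zero]
    exact h.left_inv _ (hcl _)
  · simp only [max_eq_left hv, max_eq_left hv'] at heq
    have h1 : G (Γ.γ i (c + u)) + (v : ℂ) * I = G (Γ.γ i (c + u')) + (v' : ℂ) * I := by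
      rw [← h.right_inv (hmem _ _ hv), heq, h.right_inv (hmem _ _ hv')]
    have h2 := congrArg im h1
    rw [him', him'] at h2
    subst h2
    have h3 := Γ.param_eq (i := i) (s := c + u) (t := c + u') (by
      rw [← h.left_inv _ (hcl (c + u)), add_right_cancel h1, h.left_inv _ (hcl _)])
    exact ⟨add_left_cancel h3, rfl⟩

theorem mem_or_mem_of_mem_closure {U₁ U₂ U : Set ℂ} (h₁ : IsComponent Γ.carrierᶜ U₁)
    (h₂ : IsComponent Γ.carrierᶜ U₂) (hU : IsComponent Γ.carrierᶜ U) (hne : U₁ ≠ U₂) {i : ι}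
    {c : ℝ} (hi₁ : Γ.γ i c ∈ closure U₁) (hi₂ : Γ.γ i c ∈ closure U₂)
    (hi : Γ.γ i c ∈ closure U) : U = U₁ ∨ U = U₂ := by
  obtain ⟨P, hPc, hPU, hP0, hPi⟩ := Γ.exists_collar h₁ hi₁
  obtain ⟨Q, hQc, hQU, hQ0, hQi⟩ := Γ.exists_collar h₂ hi₂
  set Θ : ℂ → ℂ := fun z => if 0 ≤ z.im then P z.re z.im else Q z.re (-z.im) with hΘ
  have hΘc : Continuous Θ := by
    refine Continuous.if_le ?_ ?_ continuous_const continuous_im ?_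
    · exact hPc.comp (continuous_re.prodMk continuous_im)
    · exact hQc.comp (continuous_re.prodMk continuous_im.neg)
    · intro z hz
      rw [← hz, neg_zero, hP0, hQ0]
  have hcases : ∀ z, (z.im = 0 ∧ Θ z = Γ.γ i (c + z.re)) ∨
      (0 < z.im ∧ Θ z = P z.re z.im ∧ Θ z ∈ U₁) ∨
      (z.im < 0 ∧ Θ z = Q z.re (-z.im) ∧ Θ z ∈ U₂) := fun z => by
    rcases lt_trichotomy z.im 0 with h | h | h
    · refine Or.inr (Or.inr ⟨h, ?_⟩)
      simp only [hΘ, if_neg (not_le.2 h), true_and]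
      exact hQU _ _ (by linarith)
    · refine Or.inl ⟨h, ?_⟩
      simp only [hΘ, h, le_refl, if_true, hP0]
    · refine Or.inr (Or.inl ⟨h, ?_⟩)
      simp only [hΘ, if_pos h.le, true_and]
      exact hPU _ _ h
  have hd1 : ∀ s, Γ.γ i s ∉ U₁ := fun s hs => h₁.subset hs (Γ.γ_mem i s)
  have hd2 : ∀ s, Γ.γ i s ∉ U₂ := fun s hs => h₂.subset hs (Γ.γ_mem i s)
  have hd : ∀ z ∈ U₁, z ∉ U₂ := fun z hz1 hz2 => hne (h₁.eq_of_mem h₂ hz1 hz2)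
  have hinj : Function.Injective Θ := by
    intro z z' heq
    rcases hcases z with ⟨h1, h2⟩ | ⟨h1, h2, h3⟩ | ⟨h1, h2, h3⟩ <;>
      rcases hcases z' with ⟨k1, k2⟩ | ⟨k1, k2, k3⟩ | ⟨k1, k2, k3⟩
    · have := Γ.param_eq (h2.symm.trans (heq.trans k2))
      exact Complex.ext (add_left_cancel this) (h1.trans k1.symm)
    · exact absurd k3 (heq ▸ h2 ▸ hd1 _)
    · exact absurd k3 (heq ▸ h2 ▸ hd2 _)
    · exact absurd h3 (heq ▸ k2 ▸ hd1 _)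
    · obtain ⟨a, b⟩ := hPi _ _ _ _ h1.le k1.le (h2.symm.trans (heq.trans k2))
      exact Complex.ext a b
    · exact absurd k3 (heq ▸ hd _ h3)
    · exact absurd h3 (heq ▸ k2 ▸ hd2 _)
    · exact absurd h3 (heq ▸ hd _ k3)
    · obtain ⟨a, b⟩ := hQi _ _ _ _ (by linarith) (by linarith) (h2.symm.trans (heq.trans k2))
      exact Complex.ext a (neg_injective b)
  have hΘ0 : Θ 0 = Γ.γ i c := by simp [hΘ, hP0]
  have hr := range_mem_nhds_of_injective hΘc hinj
  rw [hΘ0] at hr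
  obtain ⟨_, ⟨z, rfl⟩, hzU⟩ := mem_closure_iff_nhds.1 hi _ hr
  rcases hcases z with ⟨h1, h2⟩ | ⟨-, -, h3⟩ | ⟨-, -, h3⟩
  · rw [h2] at hzU
    exact absurd (Γ.γ_mem _ _) (hU.subset hzU)
  · exact Or.inl (hU.eq_of_mem h₁ hzU h3)
  · exact Or.inr (hU.eq_of_mem h₂ hzU h3)

theorem finite_adjacent (i : ι) (c : ℝ) :
    {U | IsComponent Γ.carrierᶜ U ∧ Γ.γ i c ∈ closure U}.Finite := by
  by_cases h : {U | IsComponent Γ.carrierᶜ U ∧ Γ.γ i c ∈ closure U}.Subsingleton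
  · exact h.finite
  · rw [not_subsingleton_iff] at h
    obtain ⟨U₁, h₁, U₂, h₂, hne⟩ := h
    exact (toFinite {U₁, U₂}).subset fun U hU =>
      Γ.mem_or_mem_of_mem_closure h₁.1 h₂.1 hU.1 hne h₁.2 h₂.2 hU.2

theorem eventually_mem (i : ι) (c : ℝ) : ∀ᶠ z in 𝓝 (Γ.γ i c), z ∈ range (Γ.γ i) ∨
    ∃ U ∈ {U | IsComponent Γ.carrierᶜ U ∧ Γ.γ i c ∈ closure U}, z ∈ U := by
  obtain ⟨r, hr, hd⟩ := Γ.exists_ball_disjoint_others i c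
  filter_upwards [Metric.ball_mem_nhds _ hr] with z hz
  by_cases hzF : z ∈ Γ.carrier
  · left
    obtain ⟨j, s, rfl⟩ := mem_iUnion.1 hzF
    by_cases hj : j = i
    · exact hj ▸ ⟨s, rfl⟩
    · exact absurd (Γ.mem_others.2 ⟨j, hj, s, rfl⟩) (disjoint_left.1 hd hz)
  · right
    have hU : IsComponent Γ.carrierᶜ (connectedComponentIn Γ.carrierᶜ z) := ⟨z, hzF, rfl⟩
    have hzU := mem_connectedComponentIn (F := Γ.carrierᶜ) hzF
    exact ⟨_, ⟨hU, Γ.range_subset_closure hd hU hz hzU ⟨c, rfl⟩⟩, hzU⟩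

/-- There is a flow of the plane translating the parameters of all the lines of the family, whose
time one map has no fixed point. -/
theorem exists_flow : ∃ φ : ℝ → ℂ → ℂ, (Continuous fun p : ℝ × ℂ => φ p.1 p.2) ∧
    (∀ z, φ 0 z = z) ∧ (∀ s t z, φ (s + t) z = φ s (φ t z)) ∧ (∀ z, φ 1 z ≠ z) ∧
    ∀ i s t, φ t (Γ.γ i s) = Γ.γ i (s + t) := by
  classical
  rcases isEmpty_or_nonempty ι with hι | hι
  · refine ⟨fun t z => z + t, by fun_prop, by simp, fun s t z => ?_, by simp, fun i => isEmptyElim i⟩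
    push_cast
    ring
  choose! Φ hc hmaps h0 hadd hfix hγ using
    fun U (hU : IsComponent Γ.carrierᶜ U) => Γ.exists_flow_closure hU
  set φ : ℝ → ℂ → ℂ := fun t z => if h : ∃ p : ι × ℝ, Γ.γ p.1 p.2 = z then
    Γ.γ h.choose.1 (h.choose.2 + t) else Φ (connectedComponentIn Γ.carrierᶜ z) t z with hφ
  have hφγ : ∀ i s t, φ t (Γ.γ i s) = Γ.γ i (s + t) := fun i s t => by
    have h : ∃ p : ι × ℝ, Γ.γ p.1 p.2 = Γ.γ i s := ⟨(i, s), rfl⟩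
    have h1 : h.choose.1 = i := Γ.index_eq h.choose_spec
    have h2 := h.choose_spec
    rw [h1] at h2
    simp only [hφ, dif_pos h, h1, Γ.param_eq h2]
  have hφU : ∀ U, IsComponent Γ.carrierᶜ U → ∀ z ∈ U, ∀ t, φ t z = Φ U t z := fun U hU z hz t => by
    have h : ¬ ∃ p : ι × ℝ, Γ.γ p.1 p.2 = z := by
      rintro ⟨p, rfl⟩
      exact hU.subset hz (Γ.γ_mem _ _)
    simp only [hφ, dif_neg h, ← hU.eq_connectedComponentIn hz]
  have hφcl : ∀ U, IsComponent Γ.carrierᶜ U → ∀ z ∈ closure U, ∀ t, φ t z = Φ U t z :=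
    fun U hU z hz t => by
    by_cases hzU : z ∈ U
    · exact hφU U hU z hzU t
    · obtain ⟨i, c, rfl⟩ := Γ.exists_eq_of_mem_frontier hU (z := z) (by
        rw [(hU.isOpen Γ.isClosed_carrier.isOpen_compl).frontier_eq]
        exact ⟨hz, hzU⟩)
      rw [hφγ, hγ U hU i c t hz]
  have hcl : ∀ U, IsComponent Γ.carrierᶜ U →
      ContinuousOn (fun p : ℝ × ℂ => φ p.1 p.2) (univ ×ˢ closure U) := fun U hU =>
    (hc U hU).congr fun p hp => hφcl U hU p.2 hp.2 p.1
  have hline : ∀ i, ContinuousOn (fun p : ℝ × ℂ => φ p.1 p.2) (univ ×ˢ range (Γ.γ i)) :=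
    fun i => by
    refine ContinuousOn.congr (f := fun p : ℝ × ℂ =>
      Γ.γ i (Function.invFun (Γ.γ i) p.2 + p.1)) ?_ ?_
    · refine (Γ.emb i).continuous.comp_continuousOn (ContinuousOn.add ?_ continuousOn_fst)
      exact (continuousOn_invFun_range (Γ.emb i).isEmbedding).comp continuousOn_snd fun p hp => hp.2
    · rintro ⟨t, _⟩ ⟨-, s, rfl⟩
      simp only [hφγ, Function.leftInverse_invFun (Γ.emb i).injective s]
  have hcases : ∀ z, (∃ i s, z = Γ.γ i s) ∨ ∃ U, IsComponent Γ.carrierᶜ U ∧ z ∈ U := fun z => by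
    by_cases hzF : z ∈ Γ.carrier
    · obtain ⟨i, s, rfl⟩ := mem_iUnion.1 hzF
      exact Or.inl ⟨i, s, rfl⟩
    · exact Or.inr ⟨_, ⟨z, hzF, rfl⟩, mem_connectedComponentIn (F := Γ.carrierᶜ) hzF⟩
  refine ⟨φ, ?_, fun z => ?_, fun s t z => ?_, fun z => ?_, hφγ⟩
  · rw [continuous_iff_continuousAt]
    rintro ⟨t, z⟩
    rcases hcases z with ⟨i, c, rfl⟩ | ⟨U, hU, hz⟩
    · set S := {U | IsComponent Γ.carrierᶜ U ∧ Γ.γ i c ∈ closure U} with hS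
      have hw : ContinuousWithinAt (fun p : ℝ × ℂ => φ p.1 p.2)
          (univ ×ˢ range (Γ.γ i) ∪ ⋃ U ∈ S, univ ×ˢ closure U) (t, Γ.γ i c) := by
        refine (hline i _ ⟨mem_univ _, c, rfl⟩).union ?_
        rw [ContinuousWithinAt, nhdsWithin_biUnion (Γ.finite_adjacent i c), tendsto_iSup]
        intro U
        rw [tendsto_iSup]
        intro hU
        exact hcl U hU.1 _ ⟨mem_univ _, hU.2⟩
      refine hw.continuousAt ?_
      have := (continuous_snd.tendsto (t, Γ.γ i c)).eventually (Γ.eventually_mem i c)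
      filter_upwards [this] with p hp
      rcases hp with hp | ⟨U, hU, hp⟩
      · exact Or.inl ⟨mem_univ _, hp⟩
      · exact Or.inr (mem_biUnion hU ⟨mem_univ _, subset_closure hp⟩)
    · refine (hcl U hU).continuousAt (mem_of_superset (prod_mem_nhds univ_mem
        ((hU.isOpen Γ.isClosed_carrier.isOpen_compl).mem_nhds hz)) ?_)
      exact prod_mono_right subset_closure
  · rcases hcases z with ⟨i, c, rfl⟩ | ⟨U, hU, hz⟩
    · rw [hφγ, add_zero]
    · rw [hφU U hU z hz, h0 U hU z hz]
  · rcases hcases z with ⟨i, c, rfl⟩ | ⟨U, hU, hz⟩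
    · rw [hφγ, hφγ, hφγ]
      congr 1
      ring
    · rw [hφU U hU z hz, hφU U hU z hz, hφU U hU _ (hmaps U hU t hz), hadd U hU s t z hz]
  · rcases hcases z with ⟨i, c, rfl⟩ | ⟨U, hU, hz⟩
    · rw [hφγ]
      intro h
      linarith [Γ.param_eq h]
    · rw [hφU U hU z hz]
      exact hfix U hU z hz

end LineFamily

end PlaneFlow

theorem IsTopLine.exists_isClosedEmbedding {L : Set Plane} (hL : IsTopLine L) :
    ∃ f : ℝ → Plane, Topology.IsClosedEmbedding f ∧ range f = L := by
  obtain ⟨f, hc, hi, hp, hr⟩ := hL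
  exact ⟨f, .of_continuous_injective_isClosedMap hc hi hp.isClosedMap, hr⟩

/-- A fixed point free homeomorphism of a closed embedded line is conjugate to a translation. -/
theorem exists_isClosedEmbedding_add_one {X : Type*} [TopologicalSpace X] {f : ℝ → X}
    (hf : Topology.IsClosedEmbedding f) {g : X → X} (hg : ContinuousOn g (range f))
    (hbij : BijOn g (range f) (range f)) (hfix : ∀ x ∈ range f, g x ≠ x) :
    ∃ γ : ℝ → X, Topology.IsClosedEmbedding γ ∧ range γ = range f ∧ ∀ s, g (γ s) = γ (s + 1) := by
  have hfi : ∀ x ∈ range f, f (Function.invFun f x) = x := fun x hx => Function.invFun_eq hx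
  have hkf : ∀ s, f (Function.invFun f (g (f s))) = g (f s) :=
    fun s => hfi _ (hbij.mapsTo (mem_range_self s))
  have hk : Continuous fun s => Function.invFun f (g (f s)) := by
    rw [hf.isEmbedding.continuous_iff]
    have : Continuous fun s => g (f s) := hg.comp_continuous hf.continuous mem_range_self
    exact this.congr fun s => (hkf s).symm
  obtain ⟨u, hu⟩ := PlaneFlow.exists_conj_add_one hk
    ⟨fun s t hst => by
      have h1 : g (f s) = g (f t) := by rw [← hkf s, ← hkf t]; exact congrArg f hst
      exact hf.injective (hbij.injOn (mem_range_self s) (mem_range_self t) h1),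
    fun t => by
      obtain ⟨_, ⟨s, rfl⟩, hs⟩ := hbij.surjOn (mem_range_self t)
      exact ⟨s, hf.injective ((hkf s).trans hs)⟩⟩
    (fun s hs => hfix _ (mem_range_self s) ((hkf s).symm.trans (congrArg f hs)))
  refine ⟨f ∘ u, hf.comp u.isClosedEmbedding, u.surjective.range_comp f, fun s => ?_⟩
  rw [Function.comp_apply, Function.comp_apply, ← hu s, hkf]

/-- A fixed point free homeomorphism of a finite union of
pairwise disjoint topological lines preserving each line extends to the time
one map of a flow, fixed point free on the whole plane. -/
theorem extension_to_time_one_map_of_flow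
    (ℱ : Set (Set Plane)) (hfin : ℱ.Finite)
    (hline : ∀ L ∈ ℱ, IsTopLine L)
    (hdisj : ℱ.Pairwise Disjoint)
    (h' : (⋃₀ ℱ : Set Plane) ≃ₜ (⋃₀ ℱ : Set Plane))
    (hfpf : ∀ x, h' x ≠ x)
    (hpres : ∀ L ∈ ℱ, ∀ x : (⋃₀ ℱ : Set Plane), (x : Plane) ∈ L → (h' x : Plane) ∈ L) :
    ∃ φ : ℝ → Plane → Plane, IsFlow φ ∧ (∀ x, φ 1 x ≠ x) ∧
      ∀ x : (⋃₀ ℱ : Set Plane), φ 1 (x : Plane) = (h' x : Plane) := by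
  classical
  have key : ∀ L : ℱ, ∃ γ : ℝ → Plane, Topology.IsClosedEmbedding γ ∧ range γ = L.1 ∧
      ∀ s (hs : γ s ∈ ⋃₀ ℱ), (h' ⟨γ s, hs⟩ : Plane) = γ (s + 1) := by
    rintro ⟨L, hL⟩
    obtain ⟨f, hf, rfl⟩ := (hline L hL).exists_isClosedEmbedding
    have hsub : range f ⊆ ⋃₀ ℱ := subset_sUnion_of_mem hL
    let g : Plane → Plane := fun x => if hx : x ∈ ⋃₀ ℱ then (h' ⟨x, hx⟩ : Plane) else x
    have hg : ∀ x (hx : x ∈ ⋃₀ ℱ), g x = h' ⟨x, hx⟩ := fun x hx => dif_pos hx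
    have hgc : ContinuousOn g (⋃₀ ℱ) := by
      rw [continuousOn_iff_continuous_domRestrict]
      exact (continuous_subtype_val.comp h'.continuous).congr fun x => (hg x x.2).symm
    obtain ⟨γ, hγ, hr, hs⟩ := exists_isClosedEmbedding_add_one hf (hgc.mono hsub)
      ⟨fun x hx => by rw [hg x (hsub hx)]; exact hpres _ hL _ hx,
      fun x hx y hy hxy => by
        rw [hg x (hsub hx), hg y (hsub hy)] at hxy
        exact congrArg Subtype.val (h'.injective (Subtype.ext hxy)),
      fun y hy => by
        obtain ⟨x, hx⟩ := h'.surjective ⟨y, hsub hy⟩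
        obtain ⟨L', hL', hxL'⟩ := x.2
        have hy' : y ∈ L' := by simpa [hx] using hpres L' hL' x hxL'
        have hLL : L' = range f := by
          by_contra hne
          exact (hdisj hL' hL hne).le_bot ⟨hy', hy⟩
        exact ⟨x, hLL ▸ hxL', by rw [hg x x.2, Subtype.coe_eta, hx]⟩⟩
      (fun x hx hxx => hfpf ⟨x, hsub hx⟩ (Subtype.ext (by rw [← hg x (hsub hx)]; exact hxx)))
    exact ⟨γ, hγ, hr, fun s hs' => by rw [← hg _ hs', hs]⟩
  choose γ hγ hr hs using key
  have := hfin.to_subtype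
  let e := Complex.equivRealProdCLM.toHomeomorph
  obtain ⟨φ, hc, h0, hadd, hne, hφ⟩ := PlaneFlow.LineFamily.exists_flow
    { γ := fun L => e.symm ∘ γ L
      emb := fun L => e.symm.isClosedEmbedding.comp (hγ L)
      disj := fun L L' hLL => by
        rw [range_comp, range_comp, disjoint_image_iff e.symm.injective, hr, hr]
        exact hdisj L.2 L'.2 (fun h => hLL (Subtype.ext h)) : PlaneFlow.LineFamily ℱ }
  refine ⟨fun t x => e (φ t (e.symm x)), ⟨?_, fun x => by simp [h0], fun s t x => by simp [hadd]⟩,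
    fun x hx => hne (e.symm x) ?_, ?_⟩
  · exact e.continuous.comp (hc.comp (continuous_fst.prodMk (e.symm.continuous.comp continuous_snd)))
  · exact (e.symm_apply_apply _).symm.trans (congrArg e.symm hx)
  · rintro ⟨x, hx⟩
    obtain ⟨L, hL, hxL⟩ := id hx
    obtain ⟨s, rfl⟩ : x ∈ range (γ ⟨L, hL⟩) := by rw [hr]; exact hxL
    rw [hs ⟨L, hL⟩ s hx]
    have := hφ ⟨L, hL⟩ s 1
    simp only [Function.comp_apply] at this
    simp [this]
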